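/- For every integer d ≥ 1 there exists a constant A ≥ 1 depending only on d with the following property. Let n ≥ 1, let ε ∈ (0,1), let k be an integer with k ≥ A·ε^{-4d·7^d}, and let η > 0 satisfy η ≤ n^{-A·k}·k^{-A·k}. Then for every probability measure μ on ℝ^n that approximately matches the moments of the standard Gaussian up to degree k with slack η, and for every multilinear polynomial p in n real variables of total degree at most d (i.e., every monomial of p has each variable appearing with exponent at most 1), one has |∫ sgn(p(x)) dμ(x) − ∫ sgn(p(y)) dγₙ(y)| ≤ A·ε. -/

import Mathlib

open MeasureTheory ProbabilityTheory

/-- The standard Gaussian measure on `ι → ℝ` (product of `N(0,1)`). -/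
noncomputable def stdGaussianPi (ι : Type) [Fintype ι] : Measure (ι → ℝ) :=
  Measure.pi fun _ => gaussianReal 0 1

/-- `μ` approximately matches the moments of the standard Gaussian up to degree `k`
with slack `η`: all absolute moments of order at most `k` are finite and each moment
of order at most `k` is within `η` of the corresponding Gaussian moment. -/
def MomentMatches {ι : Type} [Fintype ι] (k : ℕ) (η : ℝ)
    (μ : Measure (ι → ℝ)) : Prop :=
  ∀ α : ι → ℕ, (∑ i, α i) ≤ k →
    Integrable (fun x => ∏ i, |x i| ^ α i) μ ∧
    |(∫ x, ∏ i, (x i) ^ α i ∂μ) - ∫ y, ∏ i, (y i) ^ α i ∂(stdGaussianPi ι)| ≤ η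

/-- The sign function: `1` if `0 ≤ t`, `-1` otherwise. -/
noncomputable def sgn (t : ℝ) : ℝ := if 0 ≤ t then 1 else -1

section FA
open MvPolynomial

lemma gauss_int_pow (k : ℕ) : Integrable (fun x : ℝ => x ^ k) (gaussianReal 0 1) := by
  have h := memLp_id_gaussianReal (μ := 0) (v := 1) (k : NNReal)
  rcases Nat.eq_zero_or_pos k with rfl | hk
  · simp
  have := h.integrable_norm_rpow (by simpa using hk.ne') (by simp)
  refine this.mono' (by fun_prop) (Filter.Eventually.of_forall fun x => ?_)
  simp

lemma gauss_stein (k : ℕ) :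
    ∫ x, x ^ (k + 1) ∂(gaussianReal 0 1) = k * ∫ x, x ^ (k - 1) ∂(gaussianReal 0 1) := by
  have hI : ∀ m : ℕ, Integrable (fun x : ℝ => x ^ m * Real.exp (-(1/2) * x ^ 2)) := by
    intro m
    have := integrable_rpow_mul_exp_neg_mul_sq (b := 1/2) (by norm_num) (s := m)
      (by have : (0:ℝ) ≤ m := by positivity
          linarith)
    simpa using this
  have hE : ∀ m : ℕ, ∫ x, x ^ m ∂(gaussianReal 0 1)
      = (Real.sqrt (2 * Real.pi))⁻¹ * ∫ x : ℝ, x ^ m * Real.exp (-(1/2) * x ^ 2) := by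
    intro m
    rw [integral_gaussianReal_eq_integral_smul (by simp), ← integral_const_mul]
    congr 1; ext x
    simp only [gaussianPDFReal, smul_eq_mul]
    have : -(x - 0) ^ 2 / (2 * ((1 : NNReal) : ℝ)) = -(1/2) * x ^ 2 := by
      simp; ring
    rw [this]; simp; ring
  have hz : ∫ x : ℝ, ((k : ℝ) * (x ^ (k - 1) * Real.exp (-(1/2) * x ^ 2))
      - x ^ (k + 1) * Real.exp (-(1/2) * x ^ 2)) = 0 := by
    refine integral_eq_zero_of_hasDerivAt_of_integrable
      (f := fun x : ℝ => x ^ k * Real.exp (-(1/2) * x ^ 2)) (fun x => ?_)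
      (((hI _).const_mul _).sub (hI _)) (hI k)
    have h1 : HasDerivAt (fun x : ℝ => Real.exp (-(1/2) * x ^ 2))
        (Real.exp (-(1/2) * x ^ 2) * (-(1/2) * (2 * x))) x := by
      have := ((hasDerivAt_pow 2 x).const_mul (-(1/2) : ℝ)).exp
      simpa using this
    convert! (hasDerivAt_pow k x).mul h1 using 1
    ring
  rw [integral_sub ((hI _).const_mul _) (hI _), integral_const_mul] at hz
  rw [hE, hE]
  linear_combination (-(Real.sqrt (2 * Real.pi))⁻¹) * hz

variable {ι : Type} [Fintype ι]

instance : IsProbabilityMeasure (stdGaussianPi ι) := by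
  unfold stdGaussianPi; infer_instance

lemma eval_monomial' (x : ι → ℝ) (m : ι →₀ ℕ) (c : ℝ) :
    eval x (monomial m c) = c * ∏ i, x i ^ m i := by
  rw [eval_monomial, Finsupp.prod_fintype]; simp

lemma int_eval (p : MvPolynomial ι ℝ) : Integrable (fun x => eval x p) (stdGaussianPi ι) := by
  induction p using MvPolynomial.induction_on' with
  | monomial m c =>
    simp only [eval_monomial']
    exact (Integrable.fintype_prod (fun i => gauss_int_pow (m i))).const_mul c
  | add p q hp hq => simp only [map_add]; exact hp.add hq

/-- Gaussian expectation. -/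
noncomputable def gE (p : MvPolynomial ι ℝ) : ℝ := ∫ x, eval x p ∂(stdGaussianPi ι)

lemma gE_add (p q : MvPolynomial ι ℝ) : gE (p + q) = gE p + gE q := by
  simp only [gE, map_add]; exact integral_add (int_eval p) (int_eval q)

lemma gE_smul (c : ℝ) (p : MvPolynomial ι ℝ) : gE (C c * p) = c * gE p := by
  simp only [gE, map_mul, eval_C]; exact integral_const_mul _ _

lemma gE_C (c : ℝ) : gE (C c : MvPolynomial ι ℝ) = c := by simp [gE]

lemma gE_zero : gE (0 : MvPolynomial ι ℝ) = 0 := by simp [gE]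

lemma gE_sum {κ : Type*} (s : Finset κ) (f : κ → MvPolynomial ι ℝ) :
    gE (∑ k ∈ s, f k) = ∑ k ∈ s, gE (f k) := by
  classical
  induction s using Finset.induction_on with
  | empty => simp [gE_zero]
  | insert a s ha ih => rw [Finset.sum_insert ha, Finset.sum_insert ha, gE_add, ih]

lemma gE_mono {p q : MvPolynomial ι ℝ} (h : ∀ x, eval x p ≤ eval x q) : gE p ≤ gE q :=
  integral_mono (int_eval p) (int_eval q) h

lemma gE_nonneg {p : MvPolynomial ι ℝ} (h : ∀ x, 0 ≤ eval x p) : 0 ≤ gE p :=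
  integral_nonneg h

lemma gE_monomial (m : ι →₀ ℕ) (c : ℝ) :
    gE (monomial m c) = c * ∏ i, ∫ x, x ^ m i ∂(gaussianReal 0 1) := by
  simp only [gE, eval_monomial']
  rw [integral_const_mul, stdGaussianPi, integral_fintype_prod_eq_prod (fun i x => x ^ m i)]

lemma gE_X_mul (j : ι) (p : MvPolynomial ι ℝ) : gE (X j * p) = gE (pderiv j p) := by
  classical
  induction p using MvPolynomial.induction_on' with
  | add p q hp hq => rw [mul_add, gE_add, map_add, gE_add, hp, hq]
  | monomial m c =>
    rw [pderiv_monomial, X, monomial_mul, gE_monomial, gE_monomial, one_mul,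
      ← Finset.mul_prod_erase _ _ (Finset.mem_univ j), ← Finset.mul_prod_erase _ _ (Finset.mem_univ j)]
    have e1 : (Finsupp.single j 1 + m : ι →₀ ℕ) j = m j + 1 := by simp [add_comm]
    have e2 : (m - Finsupp.single j 1 : ι →₀ ℕ) j = m j - 1 := by simp
    rw [e1, e2, gauss_stein]
    have : ∏ x ∈ Finset.univ.erase j, ∫ y, y ^ (Finsupp.single j 1 + m : ι →₀ ℕ) x ∂(gaussianReal 0 1)
        = ∏ x ∈ Finset.univ.erase j, ∫ y, y ^ (m - Finsupp.single j 1 : ι →₀ ℕ) x ∂(gaussianReal 0 1) := by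
      refine Finset.prod_congr rfl fun i hi => ?_
      have hij : j ≠ i := (Finset.ne_of_mem_erase hi).symm
      simp [Finsupp.single_apply, hij]
    rw [this]; ring

end FA

section FC
set_option linter.unusedSectionVars false
open MvPolynomial Matrix

/-- `tr (M Mᵀ)^3`. -/
def phi {α β R : Type} [Fintype α] [Fintype β] [CommRing R] (M : Matrix α β R) : R :=
  trace (M * Mᵀ * (M * Mᵀ) * (M * Mᵀ))

/-- row flattening -/
def flL {α β ι R : Type} (N : ι → Matrix α β R) : Matrix (α × ι) β R := fun a b => N a.2 a.1 b
/-- column flattening -/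
def flR {α β ι R : Type} (N : ι → Matrix α β R) : Matrix α (β × ι) R := fun a b => N b.2 a b.1

section real
variable {α β γ ι : Type} [Fintype α] [Fintype β] [Fintype γ] [Fintype ι]

lemma fro_cs (A B : Matrix α β ℝ) :
    (trace (A * Bᵀ)) ^ 2 ≤ trace (A * Aᵀ) * trace (B * Bᵀ) := by
  have := Finset.sum_mul_sq_le_sq_mul_sq (Finset.univ : Finset (α × β))
    (fun p => A p.1 p.2) (fun p => B p.1 p.2)
  simpa [trace, mul_apply, Fintype.sum_prod_type, pow_two] using this

lemma fro_am (A B : Matrix α β ℝ) :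
    2 * trace (A * Bᵀ) ≤ trace (A * Aᵀ) + trace (B * Bᵀ) := by
  simp only [trace, mul_apply, diag_apply, transpose_apply, Finset.mul_sum, ← Finset.sum_add_distrib]
  refine Finset.sum_le_sum fun i _ => Finset.sum_le_sum fun j _ => ?_
  nlinarith [sq_nonneg (A i j - B i j)]

lemma fro_nonneg (A : Matrix α β ℝ) : 0 ≤ trace (A * Aᵀ) := by
  simp only [trace, mul_apply, diag_apply, transpose_apply]
  exact Finset.sum_nonneg fun i _ => Finset.sum_nonneg fun j _ => mul_self_nonneg _

lemma phi_eq (M : Matrix α β ℝ) : phi M = trace ((M * (Mᵀ * M)) * (M * (Mᵀ * M))ᵀ) := by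
  simp only [phi, transpose_mul, transpose_transpose, Matrix.mul_assoc]

lemma phi_nonneg (M : Matrix α β ℝ) : 0 ≤ phi M := by
  rw [phi_eq]; exact fro_nonneg _

lemma phi_tr {R : Type} [CommRing R] (M : Matrix α β R) : phi Mᵀ = phi M := by
  rw [phi, phi, transpose_transpose, Matrix.mul_assoc, Matrix.mul_assoc Mᵀ, trace_mul_comm]
  simp only [Matrix.mul_assoc]

lemma hold3_aux {A y p m : ℝ} (hA : 0 ≤ A) (hp : 0 ≤ p)
    (h1 : A ^ 2 ≤ y * m) (h2 : y ^ 2 ≤ p * A) : A ^ 3 ≤ p * m ^ 2 := by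
  rcases hA.eq_or_lt with h | h
  · rw [← h]; simp; positivity
  · have h3 : A ^ 4 ≤ (p * A) * m ^ 2 := by
      calc A ^ 4 = (A ^ 2) ^ 2 := by ring
        _ ≤ (y * m) ^ 2 := by gcongr
        _ = y ^ 2 * m ^ 2 := by ring
        _ ≤ _ := by gcongr
    by_contra! hc
    have := mul_lt_mul_of_pos_right hc h
    linarith [this, h3, show p * m ^ 2 * A = p * A * m ^ 2 by ring, show A ^ 3 * A = A ^ 4 by ring]

lemma hold3_eq (L : Matrix α γ ℝ) (M : Matrix α β ℝ) :
    trace (L * Lᵀ * (M * Mᵀ) * (M * Mᵀ)) = trace ((M * Mᵀ * L) * (M * Mᵀ * L)ᵀ) := by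
  have : (M * Mᵀ * L) * (M * Mᵀ * L)ᵀ = (M * Mᵀ) * (L * Lᵀ * (M * Mᵀ)) := by
    simp only [transpose_mul, transpose_transpose, Matrix.mul_assoc]
  rw [this, trace_mul_comm (M * Mᵀ)]

lemma hold3 (L : Matrix α γ ℝ) (M : Matrix α β ℝ) :
    (trace (L * Lᵀ * (M * Mᵀ) * (M * Mᵀ))) ^ 3 ≤ phi L * phi M ^ 2 := by
  refine hold3_aux (y := trace (L * Lᵀ * M * (L * Lᵀ * M)ᵀ)) ?_ (phi_nonneg L) ?_ ?_
  · rw [hold3_eq]; exact fro_nonneg _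
  · have := fro_cs (L * Lᵀ * M) (M * (Mᵀ * M))
    rw [← phi_eq] at this
    refine le_trans (le_of_eq ?_) this
    simp only [transpose_mul, transpose_transpose, Matrix.mul_assoc]
  · have := fro_cs (L * (Lᵀ * L)) (M * Mᵀ * L)
    rw [← phi_eq, ← hold3_eq] at this
    refine le_trans (le_of_eq ?_) this
    rw [trace_mul_comm (L * Lᵀ * M)]
    simp only [transpose_mul, transpose_transpose, Matrix.mul_assoc]
    rw [trace_mul_comm Mᵀ]
    simp only [Matrix.mul_assoc]

lemma flR_mul {R : Type} [CommRing R] (N : ι → Matrix α β R) : flR N * (flR N)ᵀ = ∑ j, N j * (N j)ᵀ := by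
  ext a b
  simp only [mul_apply, Matrix.sum_apply, transpose_apply, flR, Fintype.sum_prod_type]
  exact Finset.sum_comm

lemma flL_mul {R : Type} [CommRing R] (N : ι → Matrix α β R) :
    (flL N)ᵀ * ((flL N)ᵀ)ᵀ = ∑ j, (N j)ᵀ * N j := by
  ext a b
  simp only [mul_apply, Matrix.sum_apply, transpose_apply, flL, Fintype.sum_prod_type]
  exact Finset.sum_comm

lemma tr_sum_A (N : ι → Matrix α β ℝ) (M : Matrix α β ℝ) :
    trace (flR N * (flR N)ᵀ * (M * Mᵀ) * (M * Mᵀ)) =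
      ∑ j, trace ((M * Mᵀ * N j) * (M * Mᵀ * N j)ᵀ) := by
  rw [flR_mul, Matrix.sum_mul, Matrix.sum_mul, trace_sum]
  exact Finset.sum_congr rfl fun j _ => hold3_eq _ _

lemma tr_sum_B (N : ι → Matrix α β ℝ) (M : Matrix α β ℝ) :
    trace ((flL N)ᵀ * ((flL N)ᵀ)ᵀ * (Mᵀ * Mᵀᵀ) * (Mᵀ * Mᵀᵀ)) =
      ∑ j, trace ((N j * (Mᵀ * M)) * (N j * (Mᵀ * M))ᵀ) := by
  rw [flL_mul, Matrix.sum_mul, Matrix.sum_mul, trace_sum]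
  refine Finset.sum_congr rfl fun j _ => ?_
  have := hold3_eq (N j)ᵀ Mᵀ
  rw [transpose_transpose] at this
  rw [this, trace_mul_comm (N j * _)]
  simp only [transpose_mul, transpose_transpose, Matrix.mul_assoc]

lemma z_sq_A (N M : Matrix α β ℝ) : (trace (N * Mᵀ * (M * Mᵀ) * (M * Mᵀ))) ^ 2 ≤
    trace ((M * Mᵀ * N) * (M * Mᵀ * N)ᵀ) * phi M := by
  have := fro_cs (M * Mᵀ * N) (M * (Mᵀ * M))
  rw [← phi_eq] at this
  refine le_trans (le_of_eq ?_) this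
  have h : M * Mᵀ * N * (M * (Mᵀ * M))ᵀ = (M * Mᵀ) * (N * Mᵀ * (M * Mᵀ)) := by
    simp only [transpose_mul, transpose_transpose, Matrix.mul_assoc]
  rw [h, trace_mul_comm (M * Mᵀ)]

lemma z_sq_B (N M : Matrix α β ℝ) : (trace (N * Mᵀ * (M * Mᵀ) * (M * Mᵀ))) ^ 2 ≤
    trace ((N * (Mᵀ * M)) * (N * (Mᵀ * M))ᵀ) * phi M := by
  have := fro_cs (N * (Mᵀ * M)) (M * (Mᵀ * M))
  rw [← phi_eq] at this
  refine le_trans (le_of_eq ?_) this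
  simp only [transpose_mul, transpose_transpose, Matrix.mul_assoc]

lemma dz_bd (N M : Matrix α β ℝ) :
    trace (N * Nᵀ * (M * Mᵀ) * (M * Mᵀ) + N * Mᵀ * (N * Mᵀ + M * Nᵀ) * (M * Mᵀ)
      + N * Mᵀ * (M * Mᵀ) * (N * Mᵀ + M * Nᵀ)) ≤
    3 * (trace ((M * Mᵀ * N) * (M * Mᵀ * N)ᵀ) + trace ((N * (Mᵀ * M)) * (N * (Mᵀ * M))ᵀ)) := by
  have e1 := hold3_eq N M
  set A := trace ((M * Mᵀ * N) * (M * Mᵀ * N)ᵀ) with hA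
  set B := trace ((N * (Mᵀ * M)) * (N * (Mᵀ * M))ᵀ) with hB
  -- term3
  have h3 : 2 * trace (N * Mᵀ * (M * Nᵀ) * (M * Mᵀ)) ≤ A + B := by
    have := fro_am (M * Mᵀ * N) (N * (Mᵀ * M))
    have h : (M * Mᵀ * N) * (N * (Mᵀ * M))ᵀ = (M * Mᵀ) * (N * Mᵀ * (M * Nᵀ)) := by
      simp only [transpose_mul, transpose_transpose, Matrix.mul_assoc]
    rw [h, trace_mul_comm (M * Mᵀ)] at this
    exact this
  have h5 : trace (N * Mᵀ * (M * Mᵀ) * (M * Nᵀ)) = B := by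
    rw [hB]; simp only [transpose_mul, transpose_transpose, Matrix.mul_assoc]
  have h24 : trace (N * Mᵀ * (N * Mᵀ) * (M * Mᵀ)) = trace (N * Mᵀ * (M * Mᵀ) * (N * Mᵀ)) := by
    rw [Matrix.mul_assoc, trace_mul_comm]
  have h2 : 2 * trace (N * Mᵀ * (N * Mᵀ) * (M * Mᵀ)) ≤
      A + trace (N * Mᵀ * (M * Nᵀ) * (M * Mᵀ)) := by
    have := fro_am (M * Mᵀ * N) ((Mᵀ * N * Mᵀ)ᵀ)
    have h : (M * Mᵀ * N) * ((Mᵀ * N * Mᵀ)ᵀ)ᵀ = (M * Mᵀ) * (N * Mᵀ * (N * Mᵀ)) := by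
      simp only [transpose_transpose, Matrix.mul_assoc]
    have h' : (Mᵀ * N * Mᵀ)ᵀ * ((Mᵀ * N * Mᵀ)ᵀ)ᵀ = (M * Nᵀ) * ((M * Mᵀ) * (N * Mᵀ)) := by
      simp only [transpose_mul, transpose_transpose, Matrix.mul_assoc]
    rw [h, h', ← hA, trace_mul_comm (M * Mᵀ), trace_mul_comm (M * Nᵀ), Matrix.mul_assoc (M * Mᵀ),
      trace_mul_comm (M * Mᵀ)] at this
    exact this
  simp only [trace_add, Matrix.mul_add, Matrix.add_mul]
  have hA0 : 0 ≤ A := fro_nonneg _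
  have hB0 : 0 ≤ B := fro_nonneg _
  linarith
lemma young_aux {t K : ℝ} (ht : 0 ≤ t) (hK : 0 ≤ K) (N : ℕ) :
    K * t ^ N ≤ 2 ^ (N + 1) * K ^ (N + 1) + t ^ (N + 1) / 2 := by
  rcases le_total t (2 * K) with h | h
  · have : K * t ^ N ≤ K * (2 * K) ^ N := by gcongr
    have e : K * (2 * K) ^ N = 2 ^ N * K ^ (N + 1) := by ring
    have : (0:ℝ) ≤ 2 ^ N * K ^ (N + 1) := by positivity
    have : 0 ≤ t ^ (N + 1) := by positivity
    rw [pow_succ 2]; linarith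
  · have : K * t ^ N ≤ t / 2 * t ^ N := by gcongr; linarith
    have : (0:ℝ) ≤ 2 ^ (N+1) * K ^ (N + 1) := by positivity
    have : t / 2 * t ^ N = t ^ (N + 1) / 2 := by ring
    linarith

/-- pointwise numeric inequality -/
lemma s6_num {A B P P1 P2 D Z : ℝ} (q : ℕ) (hq : 1 ≤ q) (hP : 0 ≤ P) (h1 : 0 ≤ P1) (h2 : 0 ≤ P2)
    (hA : A ^ 3 ≤ P1 * P ^ 2) (hB : B ^ 3 ≤ P2 * P ^ 2)
    (hD : D ≤ 3 * (A + B)) (hZ : Z ≤ B * P) :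
    D * P ^ (q - 1) + (q - 1 : ℕ) * (6 * Z * P ^ (q - 2)) ≤
      P ^ q / 2 + 13824 ^ q * (P1 ^ q + (q : ℝ) ^ (3 * q) * P2 ^ q) := by
  obtain ⟨t, ht, rfl⟩ : ∃ t : ℝ, 0 ≤ t ∧ t ^ 3 = P :=
    ⟨P ^ ((1:ℝ)/3), by positivity, by rw [← Real.rpow_natCast, ← Real.rpow_mul hP]; norm_num⟩
  obtain ⟨a, ha, rfl⟩ : ∃ t : ℝ, 0 ≤ t ∧ t ^ 3 = P1 :=
    ⟨P1 ^ ((1:ℝ)/3), by positivity, by rw [← Real.rpow_natCast, ← Real.rpow_mul h1]; norm_num⟩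
  obtain ⟨b, hb, rfl⟩ : ∃ t : ℝ, 0 ≤ t ∧ t ^ 3 = P2 :=
    ⟨P2 ^ ((1:ℝ)/3), by positivity, by rw [← Real.rpow_natCast, ← Real.rpow_mul h2]; norm_num⟩
  have hA' : A ≤ a * t ^ 2 := by
    refine le_of_pow_le_pow_left₀ (n := 3) (by norm_num) (by positivity) (hA.trans_eq (by ring))
  have hB' : B ≤ b * t ^ 2 := by
    refine le_of_pow_le_pow_left₀ (n := 3) (by norm_num) (by positivity) (hB.trans_eq (by ring))
  obtain ⟨m, rfl⟩ : ∃ m, q = m + 1 := ⟨q - 1, by omega⟩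
  set K := 3 * a + 6 * ((m + 1 : ℕ) : ℝ) * b with hK
  have hK0 : 0 ≤ K := by positivity
  have step : D * (t ^ 3) ^ (m + 1 - 1) + (m + 1 - 1 : ℕ) * (6 * Z * (t ^ 3) ^ (m + 1 - 2))
      ≤ K * t ^ (3 * m + 2) := by
    have i1 : D * (t ^ 3) ^ m ≤ 3 * (a * t ^ 2 + b * t ^ 2) * (t ^ 3) ^ m := by
      gcongr; linarith
    have i2 : (m : ℝ) * (6 * Z * (t ^ 3) ^ (m - 1)) ≤ m * (6 * (b * t ^ 2) * (t ^ 3) ^ m) := by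
      rcases m with _ | m
      · simp
      · have : Z ≤ b * t ^ 2 * t ^ 3 := hZ.trans (by gcongr)
        have : 6 * Z * (t ^ 3) ^ (m + 1 - 1) ≤ 6 * (b * t ^ 2 * t ^ 3) * (t ^ 3) ^ m := by
          simp only [Nat.add_sub_cancel]; gcongr
        calc _ ≤ ((m + 1 : ℕ) : ℝ) * (6 * (b * t ^ 2 * t ^ 3) * (t ^ 3) ^ m) := by gcongr
          _ = _ := by ring
    have e : 3 * (a * t ^ 2 + b * t ^ 2) * (t ^ 3) ^ m + m * (6 * (b * t ^ 2) * (t ^ 3) ^ m)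
        = (3 * a + (3 + 6 * m) * b) * t ^ (3 * m + 2) := by ring
    have : (3 * a + (3 + 6 * m) * b) * t ^ (3 * m + 2) ≤ K * t ^ (3 * m + 2) := by
      gcongr; rw [hK]; push_cast; nlinarith
    have e2 : m + 1 - 2 = m - 1 := by omega
    rw [e2, Nat.add_sub_cancel]; linarith
  refine step.trans ((young_aux ht hK0 _).trans ?_)
  have k1 : K ^ (3 * m + 2 + 1) ≤ 2 ^ (3 * m + 3) * ((3 * a) ^ (3 * m + 3)
      + (6 * ((m + 1 : ℕ) : ℝ) * b) ^ (3 * m + 3)) := by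
    have := add_pow_le (a := 3 * a) (b := 6 * ((m + 1 : ℕ) : ℝ) * b) (by positivity) (by positivity) (3 * m + 3)
    refine this.trans ?_
    gcongr
    · norm_num
    · omega
  have e3 : 2 ^ (3 * m + 2 + 1) * (2 ^ (3 * m + 3) * ((3 * a) ^ (3 * m + 3)
      + (6 * ((m + 1 : ℕ) : ℝ) * b) ^ (3 * m + 3))) =
      1728 ^ (m + 1) * (a ^ 3) ^ (m + 1) + 13824 ^ (m + 1) * (((m + 1 : ℕ) : ℝ) ^ (3 * (m + 1)) * (b ^ 3) ^ (m + 1)) := by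
    rw [show 3 * m + 2 + 1 = 3 * (m + 1) by ring]
    simp only [mul_pow, pow_mul]
    have h1 : (1728 : ℝ) ^ (m + 1) = (2 ^ 3) ^ (m + 1) * ((2 ^ 3) ^ (m + 1) * (3 ^ 3) ^ (m + 1)) := by
      rw [← mul_pow, ← mul_pow]; norm_num
    have h2 : (13824 : ℝ) ^ (m + 1) = (2 ^ 3) ^ (m + 1) * ((2 ^ 3) ^ (m + 1) * (6 ^ 3) ^ (m + 1)) := by
      rw [← mul_pow, ← mul_pow]; norm_num
    rw [h1, h2]; ring
  have k2 : 2 ^ (3 * m + 2 + 1) * K ^ (3 * m + 2 + 1) ≤ _ := (mul_le_mul_of_nonneg_left k1 (by positivity)).trans_eq e3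
  have k3 : (1728:ℝ) ^ (m + 1) * (a ^ 3) ^ (m + 1) ≤ 13824 ^ (m + 1) * (a ^ 3) ^ (m + 1) := by gcongr; norm_num
  have e4 : t ^ (3 * m + 2 + 1) = (t ^ 3) ^ (m + 1) := by ring
  rw [e4]; linarith
end real

section poly
variable {α β ι : Type} [Fintype α] [Fintype β] [Fintype ι] 

lemma eval_phi (x : ι → ℝ) (M : Matrix α β (MvPolynomial ι ℝ)) :
    eval x (phi M) = phi (M.map (eval x)) := by
  simp only [phi, ← Matrix.map_mul, ← Matrix.transpose_map]
  simp [trace, mul_apply, map_sum]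

lemma eval_tr (x : ι → ℝ) (M : Matrix α α (MvPolynomial ι ℝ)) :
    eval x (trace M) = trace (M.map (eval x)) := by simp [trace]

lemma eval_madd (x : ι → ℝ) (M N : Matrix α β (MvPolynomial ι ℝ)) :
    (M + N).map (eval x) = M.map (eval x) + N.map (eval x) := Matrix.map_add _ (map_add _) _ _

lemma d_mul {κ : Type} (j : ι) (M : Matrix α β (MvPolynomial ι ℝ)) (N : Matrix β κ (MvPolynomial ι ℝ)) :
    (M * N).map (pderiv j) = M.map (pderiv j) * N + M * N.map (pderiv j) := by
  ext1 a b
  simp only [map_apply, mul_apply, Matrix.add_apply, map_sum, Derivation.leibniz, smul_eq_mul,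
    ← Finset.sum_add_distrib]
  exact Finset.sum_congr rfl fun i _ => by ring

lemma d_tr (j : ι) (M : Matrix α α (MvPolynomial ι ℝ)) :
    pderiv j (trace M) = trace (M.map (pderiv j)) := by simp [trace]

lemma d_R (j : ι) (M : Matrix α β (MvPolynomial ι ℝ)) :
    (M * Mᵀ).map (pderiv j) = M.map (pderiv j) * Mᵀ + M * (M.map (pderiv j))ᵀ := by
  rw [d_mul, transpose_map]

lemma d_phi (j : ι) (M : Matrix α β (MvPolynomial ι ℝ)) :
    pderiv j (phi M) = 6 * trace (M.map (pderiv j) * Mᵀ * (M * Mᵀ) * (M * Mᵀ)) := by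
  rw [phi, d_tr, d_mul, d_mul, d_R]
  set N := M.map (pderiv j) with hN
  have hR : (M * Mᵀ)ᵀ = M * Mᵀ := by simp
  generalize M * Mᵀ = R at hR ⊢
  have a1 : trace (M * Nᵀ * R * R) = trace (N * Mᵀ * R * R) := by
    rw [← trace_transpose (M * Nᵀ * R * R), transpose_mul, transpose_mul, transpose_mul, hR,
      transpose_transpose, ← Matrix.mul_assoc R R, trace_mul_comm (R * R), ← Matrix.mul_assoc]
  have a2 : trace ((N * Mᵀ + M * Nᵀ) * R * R) = 2 * trace (N * Mᵀ * R * R) := by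
    rw [Matrix.add_mul, Matrix.add_mul, trace_add, a1]; ring
  have a3 : trace (R * (N * Mᵀ + M * Nᵀ) * R) = 2 * trace (N * Mᵀ * R * R) := by
    rw [← a2, Matrix.mul_assoc, trace_mul_comm]
  have a4 : trace (R * R * (N * Mᵀ + M * Nᵀ)) = 2 * trace (N * Mᵀ * R * R) := by
    rw [← a2, trace_mul_comm (R * R), ← Matrix.mul_assoc]
  rw [Matrix.add_mul, trace_add, trace_add, a2, a3, a4]; ring

/-- the S6 step -/
lemma s6_step (cl : ι → Prop) (N : ι → Matrix α β (MvPolynomial ι ℝ))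
    (h0 : ∀ j, ¬ cl j → N j = 0) (hd : ∀ j, cl j → ∀ j' a b, pderiv j (N j' a b) = 0)
    (q : ℕ) (hq : 1 ≤ q) :
    gE (phi (∑ j, X (R := ℝ) j • N j) ^ q) ≤
      27648 ^ q * (gE (phi (flR N) ^ q) + (q : ℝ) ^ (3 * q) * gE (phi (flL N) ^ q)) ∧
    gE (phi (∑ j, X (R := ℝ) j • N j) ^ q) ≤
      27648 ^ q * (gE (phi (flL N) ^ q) + (q : ℝ) ^ (3 * q) * gE (phi (flR N) ^ q)) := by
  classical
  set M := ∑ j, X (R := ℝ) j • N j with hM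
  have hDM : ∀ j, cl j → M.map (pderiv j) = N j := by
    intro j hj
    ext1 a b
    simp only [hM, map_apply, Matrix.sum_apply, Matrix.smul_apply, smul_eq_mul, map_sum,
      Derivation.leibniz, hd j hj, mul_zero, zero_add, pderiv_X]
    simp [Pi.single_apply]
  let z : ι → MvPolynomial ι ℝ := fun j => trace (N j * Mᵀ * (M * Mᵀ) * (M * Mᵀ))
  let dz : ι → MvPolynomial ι ℝ := fun j => trace (N j * (N j)ᵀ * (M * Mᵀ) * (M * Mᵀ)
      + N j * Mᵀ * (N j * Mᵀ + M * (N j)ᵀ) * (M * Mᵀ)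
      + N j * Mᵀ * (M * Mᵀ) * (N j * Mᵀ + M * (N j)ᵀ))
  have hphi : phi M = ∑ j, X j * z j := by
    have : M * Mᵀ * (M * Mᵀ) * (M * Mᵀ) = ∑ j, X (R := ℝ) j • (N j * Mᵀ * (M * Mᵀ) * (M * Mᵀ)) := by
      conv_lhs => rw [Matrix.mul_assoc, Matrix.mul_assoc]; arg 1; rw [hM]
      rw [Matrix.sum_mul]
      exact Finset.sum_congr rfl fun j _ => by simp only [smul_mul, Matrix.mul_assoc]
    rw [phi, this, trace_sum]
    simp [z]
  have hzero : ∀ j, ¬ cl j → z j = 0 ∧ dz j = 0 := by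
    intro j hj; simp [z, dz, h0 j hj]
  have hdz : ∀ j, cl j → pderiv j (z j) = dz j := by
    intro j hj
    have e0 : (N j).map (pderiv j) = 0 := by ext1 a b; simp [hd j hj]
    simp only [z, dz]
    rw [d_tr, d_mul, d_mul, d_mul, d_R, transpose_map, hDM j hj, e0]
    simp only [Matrix.zero_mul, zero_add, Matrix.mul_add, Matrix.add_mul]
  have hibp : gE (phi M ^ q) = gE ((∑ j, dz j) * phi M ^ (q - 1)
      + C ((q - 1 : ℕ) : ℝ) * (C 6 * (∑ j, z j ^ 2) * phi M ^ (q - 2))) := by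
    have e1 : phi M ^ q = ∑ j, X j * (z j * phi M ^ (q - 1)) := by
      obtain ⟨m, rfl⟩ : ∃ m, q = m + 1 := ⟨q - 1, by omega⟩
      rw [pow_succ', Nat.add_sub_cancel]
      conv_lhs => arg 1; rw [hphi]
      rw [Finset.sum_mul]
      exact Finset.sum_congr rfl fun j _ => by ring
    have e2 : (∑ j, dz j) * phi M ^ (q - 1)
      + C ((q - 1 : ℕ) : ℝ) * (C 6 * (∑ j, z j ^ 2) * phi M ^ (q - 2)) =
      ∑ j, (dz j * phi M ^ (q - 1) + C ((q - 1 : ℕ) : ℝ) * (C 6 * z j ^ 2 * phi M ^ (q - 2))) := by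
      rw [Finset.sum_add_distrib, Finset.sum_mul, Finset.mul_sum, Finset.sum_mul, Finset.mul_sum]
    rw [e1, e2, gE_sum, gE_sum]
    refine Finset.sum_congr rfl fun j _ => ?_
    by_cases hj : cl j
    · rw [gE_X_mul, Derivation.leibniz, hdz j hj, Derivation.leibniz_pow, d_phi, hDM j hj]
      congr 1
      simp only [smul_eq_mul, nsmul_eq_mul]
      rw [Nat.sub_sub, map_natCast, show (C (6:ℝ) : MvPolynomial ι ℝ) = 6 from map_ofNat C 6]
      simp only [z]; ring
    · obtain ⟨a, b⟩ := hzero j hj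
      simp [a, b]
  have key : ∀ x : ι → ℝ, ∀ P1 P2 A B : ℝ, 0 ≤ P1 → 0 ≤ P2 → 
      A ^ 3 ≤ P1 * eval x (phi M) ^ 2 → B ^ 3 ≤ P2 * eval x (phi M) ^ 2 → 
      eval x (∑ j, dz j) ≤ 3 * (A + B) → eval x (∑ j, z j ^ 2) ≤ B * eval x (phi M) → 
      eval x ((∑ j, dz j) * phi M ^ (q - 1)
      + C ((q - 1 : ℕ) : ℝ) * (C 6 * (∑ j, z j ^ 2) * phi M ^ (q - 2))) ≤
      eval x (phi M) ^ q / 2 + 13824 ^ q * (P1 ^ q + (q : ℝ) ^ (3 * q) * P2 ^ q) := by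
    intro x P1 P2 A B h1 h2 hA hB hD hZ
    simp only [map_add, map_mul, map_pow, eval_C]
    refine s6_num q hq ?_ h1 h2 hA hB hD hZ
    rw [eval_phi]; exact phi_nonneg _
  have fin : ∀ F1 F2 : MvPolynomial ι ℝ, 
      (∀ x, eval x ((∑ j, dz j) * phi M ^ (q - 1)
      + C ((q - 1 : ℕ) : ℝ) * (C 6 * (∑ j, z j ^ 2) * phi M ^ (q - 2))) ≤
      eval x (phi M) ^ q / 2 + 13824 ^ q * (eval x F1 ^ q + (q : ℝ) ^ (3 * q) * eval x F2 ^ q)) → 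
      (∀ x, 0 ≤ eval x F1) → (∀ x, 0 ≤ eval x F2) →
      gE (phi M ^ q) ≤ 27648 ^ q * (gE (F1 ^ q) + (q : ℝ) ^ (3 * q) * gE (F2 ^ q)) := by
    intro F1 F2 h hF1 hF2
    have := gE_mono (q := C (1/2) * phi M ^ q + C (13824 ^ q) * (F1 ^ q + C ((q:ℝ) ^ (3 * q)) * F2 ^ q))
      (fun x => (h x).trans_eq (by simp only [map_add, map_mul, map_pow, eval_C]; ring))
    rw [← hibp] at this
    simp only [gE_add, gE_smul] at this
    have hn : 0 ≤ gE (F1 ^ q) + (q : ℝ) ^ (3 * q) * gE (F2 ^ q) := by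
      have a1 := gE_nonneg (p := F1 ^ q) (fun x => by rw [map_pow]; exact pow_nonneg (hF1 x) _)
      have a2 := gE_nonneg (p := F2 ^ q) (fun x => by rw [map_pow]; exact pow_nonneg (hF2 x) _)
      positivity
    have h2 : (27648 : ℝ) ^ q ≥ 2 * 13824 ^ q := by
      rw [show (27648:ℝ) = 2 * 13824 by norm_num, mul_pow]
      have : (2:ℝ) ≤ 2 ^ q := le_self_pow₀ (by norm_num) (by omega)
      gcongr
    have := mul_le_mul_of_nonneg_right h2 hn
    linarith
  have hev : ∀ x : ι → ℝ, (flR N).map (eval x) = flR (fun j => (N j).map (eval x)) := fun x => rfl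
  have hev' : ∀ x : ι → ℝ, (flL N).map (eval x) = flL (fun j => (N j).map (eval x)) := fun x => rfl
  have hA3 := fun x : ι → ℝ => hold3 (flR (fun j => (N j).map (eval x))) (M.map (eval x))
  have hB3 := fun x : ι → ℝ => hold3 (flL (fun j => (N j).map (eval x)))ᵀ (M.map (eval x))ᵀ
  simp only [tr_sum_A] at hA3
  simp only [tr_sum_B, phi_tr] at hB3
  have hD : ∀ x : ι → ℝ, eval x (∑ j, dz j) ≤ 3 * (_ + _) := fun x => by
    have := Finset.sum_le_sum (s := Finset.univ)
      fun j _ => dz_bd ((N j).map (eval x)) (M.map (eval x))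
    rw [← Finset.mul_sum, Finset.sum_add_distrib] at this
    refine le_trans (le_of_eq ?_) this
    simp only [dz, map_sum, eval_tr, eval_madd, Matrix.map_mul, transpose_map]
  have hZA : ∀ x : ι → ℝ, eval x (∑ j, z j ^ 2) ≤ _ * eval x (phi M) := fun x => by
    have := Finset.sum_le_sum (s := Finset.univ)
      fun j _ => z_sq_A ((N j).map (eval x)) (M.map (eval x))
    rw [← Finset.sum_mul, ← eval_phi] at this
    refine le_trans (le_of_eq ?_) this
    simp only [z, map_sum, map_pow, eval_tr, Matrix.map_mul, transpose_map]
  have hZB : ∀ x : ι → ℝ, eval x (∑ j, z j ^ 2) ≤ _ * eval x (phi M) := fun x => by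
    have := Finset.sum_le_sum (s := Finset.univ)
      fun j _ => z_sq_B ((N j).map (eval x)) (M.map (eval x))
    rw [← Finset.sum_mul, ← eval_phi] at this
    refine le_trans (le_of_eq ?_) this
    simp only [z, map_sum, map_pow, eval_tr, Matrix.map_mul, transpose_map]
  have n1 : ∀ x, 0 ≤ eval x (phi (flR N)) := fun x => by rw [eval_phi]; exact phi_nonneg _
  have n2 : ∀ x, 0 ≤ eval x (phi (flL N)) := fun x => by rw [eval_phi]; exact phi_nonneg _
  constructor
  · refine fin _ _ (fun x => key x _ _ _ _ (n1 x) (n2 x) ?_ ?_ (hD x) (hZB x)) n1 n2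
    · rw [eval_phi, eval_phi]; exact hA3 x
    · rw [eval_phi, eval_phi]; exact hB3 x
  · refine fin _ _ (fun x => key x _ _ _ _ (n2 x) (n1 x) ?_ ?_ ((hD x).trans_eq (by rw [add_comm])) (hZA x)) n2 n1
    · rw [eval_phi, eval_phi]; exact hB3 x
    · rw [eval_phi, eval_phi]; exact hA3 x
end poly

end FC

section FD
open MvPolynomial Matrix
set_option linter.unusedSectionVars false

variable {ι : Type} [Fintype ι] [DecidableEq ι]

/-- regularity (squared form) -/
def Reg (i q : ℕ) (f : Finset ι → ℝ) : Prop :=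
  ∀ (D : Finset ι) (Q R : Finset ι → ℝ) (e e' : ℕ), 1 ≤ e → 1 ≤ e' → e + e' = i →
    (∀ S, Q S ≠ 0 → S ⊆ D ∧ S.card = e) → (∀ S, R S ≠ 0 → Disjoint S D ∧ S.card = e') →
    (∑ S, ∑ T, f (S ∪ T) * Q S * R T) ^ 2 * (q : ℝ) ^ (3 * min e e')
      ≤ (∑ S, Q S ^ 2) * ∑ S, R S ^ 2

lemma phi_op {α β : Type} [Fintype α] [Fintype β] (M : Matrix α β ℝ) (τ : ℝ) (hτ : 0 ≤ τ)
    (h : ∀ (y : α → ℝ) (w : β → ℝ), (∑ a, ∑ b, y a * M a b * w b) ^ 2 ≤ τ * (∑ a, y a ^ 2) * ∑ b, w b ^ 2) :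
    phi M ≤ τ ^ 2 * ∑ a, ∑ b, M a b ^ 2 := by
  have gen : ∀ {α β : Type} [Fintype α] [Fintype β] (M : Matrix α β ℝ),
      (∀ (y : α → ℝ) (w : β → ℝ), (∑ a, ∑ b, y a * M a b * w b) ^ 2 ≤ τ * (∑ a, y a ^ 2) * ∑ b, w b ^ 2) →
      ∀ {κ : Type} [Fintype κ] (Y : Matrix β κ ℝ), trace ((M * Y) * (M * Y)ᵀ) ≤ τ * trace (Y * Yᵀ) := by
    intro α β _ _ M h κ _ Y
    have e : ∀ {α β : Type} [Fintype α] [Fintype β] (Z : Matrix α β ℝ),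
        trace (Z * Zᵀ) = ∑ k, ∑ a, Z a k ^ 2 := by
      intro α β _ _ Z
      rw [Finset.sum_comm]; simp [trace, mul_apply, pow_two]
    rw [e, e, Finset.mul_sum]
    refine Finset.sum_le_sum fun k _ => ?_
    have := h (fun a => (M * Y) a k) (fun b => Y b k)
    have e2 : ∑ a, ∑ b, (M * Y) a k * M a b * Y b k = ∑ a, (M * Y) a k ^ 2 := by
      refine Finset.sum_congr rfl fun a _ => ?_
      rw [pow_two, mul_apply, Finset.mul_sum]
      exact Finset.sum_congr rfl fun b _ => by ring
    rw [e2] at this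
    have h0 : 0 ≤ ∑ a, (M * Y) a k ^ 2 := Finset.sum_nonneg fun _ _ => sq_nonneg _
    have h1 : 0 ≤ ∑ b, Y b k ^ 2 := Finset.sum_nonneg fun _ _ => sq_nonneg _
    rcases h0.eq_or_lt with h' | h'
    · rw [← h']; positivity
    · nlinarith
  have h1 := gen M h (Mᵀ * M)
  have h2 := gen Mᵀ (fun y w => by
    have := h w y
    rw [Finset.sum_comm] at this
    calc _ = (∑ b, ∑ a, w a * M a b * y b) ^ 2 := by
          congr 1
          exact Finset.sum_congr rfl fun _ _ => Finset.sum_congr rfl fun _ _ => by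
            simp only [transpose_apply]; ring
      _ ≤ _ := this
      _ = _ := by ring) M
  rw [← phi_eq] at h1
  have e3 : trace (Mᵀ * M * (Mᵀ * M)ᵀ) = trace (Mᵀ * M * (Mᵀ * M)ᵀ) := rfl
  have e4 : trace (M * Mᵀ) = ∑ a, ∑ b, M a b ^ 2 := by simp [trace, mul_apply, pow_two]
  rw [e4] at h2
  calc _ ≤ _ := h1
    _ ≤ τ * (τ * _) := mul_le_mul_of_nonneg_left h2 hτ
    _ = _ := by ring

/-- the structured matrix -/
noncomputable def TM (f : Finset ι → ℝ) (χ : ι → ℕ) (r c : ℕ) {α β : Type} (A : α → Finset ι)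
    (B : β → Finset ι) (ua : α → ℝ) (ub : β → ℝ) : Matrix α β (MvPolynomial ι ℝ) := fun a b =>
  ∑ φ : Fin r → ι, if ∀ l, χ (φ l) = c + l then
    C (ua a * ub b * f (A a ∪ B b ∪ Finset.univ.image φ)) * ∏ l, X (φ l) else 0

lemma pd_prod {r : ℕ} (φ : Fin r → ι) (j : ι) (h : ∀ l, φ l ≠ j) (c : ℝ) :
    pderiv j (C c * ∏ l, X (R := ℝ) (φ l)) = 0 := by
  have : pderiv j (∏ l, X (R := ℝ) (φ l)) = 0 := by
    refine Finset.prod_induction _ (fun p => pderiv j p = 0) (fun p q hp hq => ?_) ?_ fun l _ => ?_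
    · rw [Derivation.leibniz, hp, hq]; simp
    · simp
    · exact pderiv_X_of_ne (h l)
  rw [Derivation.leibniz, this]; simp

/-- the coefficient of a variable -/
noncomputable def TN (f : Finset ι → ℝ) (χ : ι → ℕ) (r c : ℕ) {α β : Type} (A : α → Finset ι)
    (B : β → Finset ι) (ua : α → ℝ) (ub : β → ℝ) (v : ι → ℝ) (j : ι) :
    Matrix α β (MvPolynomial ι ℝ) := fun a b =>
  ∑ φ : Fin r → ι, if ∀ l, χ (φ l) = c + 1 + l then
    C (ua a * ub b * v j * f (insert j (A a ∪ B b ∪ Finset.univ.image φ))) * ∏ l, X (φ l) else 0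

lemma TN_pd (f : Finset ι → ℝ) (χ : ι → ℕ) (r c : ℕ) {α β : Type} (A : α → Finset ι)
    (B : β → Finset ι) (ua : α → ℝ) (ub : β → ℝ) (v : ι → ℝ) (j : ι) (hj : χ j = c) (j' a b) :
    pderiv j (TN f χ r c A B ua ub v j' a b) = 0 := by
  rw [TN, map_sum]
  refine Finset.sum_eq_zero fun φ _ => ?_
  by_cases h : ∀ l, χ (φ l) = c + 1 + l
  · rw [if_pos h]
    refine pd_prod φ j (fun l hl => ?_) _
    have := h l
    rw [hl] at this; omega
  · rw [if_neg h, map_zero]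

lemma TN_sum (f : Finset ι → ℝ) (χ : ι → ℕ) (r c : ℕ) {α β : Type} (A : α → Finset ι)
    (B : β → Finset ι) (ua : α → ℝ) (ub : β → ℝ) (v : ι → ℝ)
    (hv : v = fun j => if χ j = c then 1 else 0) :
    TM f χ (r + 1) c A B ua ub = ∑ j, X (R := ℝ) j • TN f χ r c A B ua ub v j := by
  ext1 a b
  simp only [TM, TN, Matrix.sum_apply, Matrix.smul_apply, smul_eq_mul]
  rw [← (Fin.consEquiv (fun _ => ι)).sum_comp, Fintype.sum_prod_type]
  refine Finset.sum_congr rfl fun j _ => ?_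
  rw [Finset.mul_sum]
  refine Finset.sum_congr rfl fun φ _ => ?_
  have e : Finset.univ.image (Fin.cons j φ : Fin (r+1) → ι) = insert j (Finset.univ.image φ) := by
    ext x; simp [Fin.exists_fin_succ, eq_comm]
  have hh : (∀ l, χ ((Fin.cons j φ : Fin (r+1) → ι) l) = c + l) ↔ χ j = c ∧ ∀ l, χ (φ l) = c + 1 + l := by
    rw [Fin.forall_fin_succ]
    refine and_congr (by simp) (forall_congr' fun l => ?_)
    rw [Fin.cons_succ, Fin.val_succ, add_assoc, add_comm 1 (l:ℕ)]
  change (if ∀ l, χ ((Fin.cons j φ : Fin (r+1) → ι) l) = c + l then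
    C (ua a * ub b * f (A a ∪ B b ∪ Finset.univ.image (Fin.cons j φ : Fin (r+1) → ι))) *
      ∏ l, X ((Fin.cons j φ : Fin (r+1) → ι) l) else 0) = _
  rw [e, Fin.prod_univ_succ, Finset.union_insert]
  simp only [Fin.cons_zero, Fin.cons_succ]
  by_cases h1 : χ j = c
  · have hv1 : v j = 1 := by rw [hv]; simp [h1]
    by_cases h2 : ∀ l, χ (φ l) = c + 1 + l
    · rw [if_pos (hh.2 ⟨h1, h2⟩), if_pos h2, hv1, mul_one]; ring
    · rw [if_neg (fun h => h2 (hh.1 h).2), if_neg h2, mul_zero]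
  · have hv1 : v j = 0 := by rw [hv]; simp [h1]
    rw [if_neg (fun h => h1 (hh.1 h).1), hv1]
    simp

lemma TN_flL (f : Finset ι → ℝ) (χ : ι → ℕ) (r c : ℕ) {α β : Type} (A : α → Finset ι)
    (B : β → Finset ι) (ua : α → ℝ) (ub : β → ℝ) (v : ι → ℝ) :
    flL (TN f χ r c A B ua ub v) = TM f χ r (c + 1) (fun p : α × ι => insert p.2 (A p.1)) B
        (fun p => ua p.1 * v p.2) ub := by
  ext1 a b
  simp only [TM, TN, flL, Finset.insert_union]
  refine Finset.sum_congr rfl fun φ _ => ?_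
  rw [mul_right_comm (ua a.1)]

lemma TN_flR (f : Finset ι → ℝ) (χ : ι → ℕ) (r c : ℕ) {α β : Type} (A : α → Finset ι)
    (B : β → Finset ι) (ua : α → ℝ) (ub : β → ℝ) (v : ι → ℝ) :
    flR (TN f χ r c A B ua ub v) = TM f χ r (c + 1) A (fun p : β × ι => insert p.2 (B p.1))
        ua (fun p => ub p.1 * v p.2) := by
  ext1 a b
  simp only [TM, TN, flR, Finset.insert_union, Finset.union_insert]
  refine Finset.sum_congr rfl fun φ _ => ?_
  rw [mul_assoc (ua a)]

end FD

section FD2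
open MvPolynomial Matrix
set_option linter.unusedSectionVars false

variable {ι : Type} [Fintype ι] [DecidableEq ι]

structure SI {α : Type} (χ : ι → ℕ) (c n : ℕ) (P : ι → Prop) (A : α → Finset ι) (u : α → ℝ) : Prop where
  u01 : ∀ a, u a = 0 ∨ u a = 1
  card : ∀ a, u a ≠ 0 → (A a).card = n
  mem : ∀ a, u a ≠ 0 → ∀ j ∈ A a, χ j < c ∧ P j
  inj : ∀ a a', u a ≠ 0 → u a' ≠ 0 → A a = A a' → a = a'

lemma SI.mono {α : Type} {χ : ι → ℕ} {c n : ℕ} {P P' : ι → Prop} {A : α → Finset ι} {u : α → ℝ}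
    (h : SI χ c n P A u) (hP : ∀ j, χ j < c → P j → P' j) : SI χ (c + 1) n P' A u :=
  ⟨h.u01, h.card, fun a ha j hj => ⟨(h.mem a ha j hj).1.trans (Nat.lt_succ_self _),
    hP j (h.mem a ha j hj).1 (h.mem a ha j hj).2⟩, h.inj⟩

lemma SI.step {α : Type} {χ : ι → ℕ} {c n : ℕ} {P P' : ι → Prop} {A : α → Finset ι} {u : α → ℝ}
    (h : SI χ c n P A u) (hP : ∀ j, χ j < c → P j → P' j) (hP' : ∀ j, χ j = c → P' j) :
    SI χ (c + 1) (n + 1) P' (fun p : α × ι => insert p.2 (A p.1))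
      (fun p => u p.1 * (fun j => if χ j = c then (1:ℝ) else 0) p.2) := by
  have key : ∀ p : α × ι, u p.1 * (if χ p.2 = c then (1:ℝ) else 0) ≠ 0 → u p.1 ≠ 0 ∧ χ p.2 = c := by
    intro p hp
    refine ⟨left_ne_zero_of_mul hp, by_contra fun h => hp (by simp [h])⟩
  have nm : ∀ p : α × ι, u p.1 ≠ 0 → χ p.2 = c → p.2 ∉ A p.1 := by
    intro p h1 h2 h3
    have := (h.mem p.1 h1 _ h3).1
    omega
  refine ⟨fun p => ?_, fun p hp => ?_, fun p hp j hj => ?_, fun p p' hp hp' e => ?_⟩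
  · by_cases hc : χ p.2 = c
    · simpa [hc] using h.u01 p.1
    · simp [hc]
  · obtain ⟨h1, h2⟩ := key p hp
    rw [Finset.card_insert_of_notMem (nm p h1 h2), h.card _ h1]
  · obtain ⟨h1, h2⟩ := key p hp
    rcases Finset.mem_insert.1 hj with rfl | hj
    · exact ⟨by omega, hP' _ h2⟩
    · exact (h.mono hP).mem _ h1 _ hj
  · obtain ⟨h1, h2⟩ := key p hp
    obtain ⟨h1', h2'⟩ := key p' hp'
    have e : insert p.2 (A p.1) = insert p'.2 (A p'.1) := e
    have e2 : p.2 = p'.2 := by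
      have : p.2 ∈ insert p'.2 (A p'.1) := e ▸ Finset.mem_insert_self _ _
      rcases Finset.mem_insert.1 this with h' | h'
      · exact h'
      · have := (h.mem _ h1' _ h').1; omega
    have e3 : A p.1 = A p'.1 := by
      rw [← Finset.erase_insert (nm p h1 h2), ← Finset.erase_insert (nm p' h1' h2'), e, e2]
    exact Prod.ext (h.inj _ _ h1 h1' e3) e2

lemma fiber_le {κ : Type} [Fintype κ] (g : κ → Finset ι) (u : κ → ℝ) (h01 : ∀ a, u a = 0 ∨ u a = 1)
    (inj : ∀ a a', u a ≠ 0 → u a' ≠ 0 → g a = g a' → a = a') (S : Finset ι) :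
    ∑ a, (if g a = S then u a else 0) ^ 2 ≤ 1 := by
  classical
  by_cases h : ∃ a, g a = S ∧ u a ≠ 0
  · obtain ⟨a, ha, hu⟩ := h
    rw [Finset.sum_eq_single a]
    · rcases h01 a with h | h <;> simp [h, ha]
    · intro b _ hb
      by_cases h1 : g b = S
      · by_cases h2 : u b = 0
        · simp [h2]
        · exact absurd (inj b a h2 hu (h1.trans ha.symm)) hb
      · simp [h1]
    · simp
  · push Not at h
    rw [Finset.sum_eq_zero]
    · simp
    · intro a _
      by_cases h1 : g a = S
      · simp [h1, h a h1]
      · simp [h1]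

lemma push_sq {κ : Type} [Fintype κ] (g : κ → Finset ι) (u y : κ → ℝ) (h01 : ∀ a, u a = 0 ∨ u a = 1)
    (inj : ∀ a a', u a ≠ 0 → u a' ≠ 0 → g a = g a' → a = a') :
    ∑ S, (∑ a, if g a = S then u a * y a else 0) ^ 2 ≤ ∑ a, y a ^ 2 := by
  classical
  calc _ ≤ ∑ S, ∑ a, (if g a = S then y a else 0) ^ 2 := by
        refine Finset.sum_le_sum fun S _ => ?_
        have := Finset.sum_mul_sq_le_sq_mul_sq Finset.univ (fun a => if g a = S then u a else 0)
          (fun a => if g a = S then y a else 0)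
        have h2 := fiber_le g u h01 inj S
        have h3 : 0 ≤ ∑ a, (if g a = S then y a else 0) ^ 2 := Finset.sum_nonneg fun _ _ => sq_nonneg _
        calc _ = (∑ a, (if g a = S then u a else 0) * (if g a = S then y a else 0)) ^ 2 := by
              congr 1; refine Finset.sum_congr rfl fun a _ => ?_
              split_ifs <;> simp
          _ ≤ _ := this
          _ ≤ _ := by nlinarith
    _ = _ := by
        rw [Finset.sum_comm]
        refine Finset.sum_congr rfl fun a _ => ?_
        simp [ite_pow]

lemma push_f {κ : Type} [Fintype κ] (g : κ → Finset ι) (u : κ → ℝ) (f : Finset ι → ℝ) (h01 : ∀ a, u a = 0 ∨ u a = 1)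
    (inj : ∀ a a', u a ≠ 0 → u a' ≠ 0 → g a = g a' → a = a') :
    ∑ a, (u a * f (g a)) ^ 2 ≤ ∑ S, f S ^ 2 := by
  classical
  calc _ = ∑ S, (∑ a, (if g a = S then u a else 0) ^ 2) * f S ^ 2 := by
        simp only [Finset.sum_mul]
        rw [Finset.sum_comm]
        refine Finset.sum_congr rfl fun a _ => ?_
        simp [ite_pow, mul_pow, ite_mul]
    _ ≤ _ := Finset.sum_le_sum fun S _ => by
        have := fiber_le g u h01 inj S
        nlinarith [sq_nonneg (f S)]

lemma mom_base {i q : ℕ} (hq : 1 ≤ q) (f : Finset ι → ℝ) (hf : Reg i q f) (hf1 : ∑ S, f S ^ 2 ≤ 1)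
    {α β : Type} [Fintype α] [Fintype β] (χ : ι → ℕ) (c na nb : ℕ) (hi : na + nb = i) (D : Finset ι)
    (A : α → Finset ι) (B : β → Finset ι) (ua : α → ℝ) (ub : β → ℝ)
    (hA : SI χ c na (· ∈ D) A ua) (hB : SI χ c nb (· ∉ D) B ub) :
    phi (Matrix.of fun a b => ua a * ub b * f (A a ∪ B b)) ≤ (((q:ℝ) ^ (3 * min na nb))⁻¹) ^ 2 := by
  classical
  have hq0 : (0:ℝ) < q := by exact_mod_cast hq
  have hfro : ∑ a, ∑ b, (ua a * ub b * f (A a ∪ B b)) ^ 2 ≤ 1 := by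
    rw [← Fintype.sum_prod_type']
    refine (push_f (fun p : α × β => A p.1 ∪ B p.2) (fun p => ua p.1 * ub p.2) f ?_ ?_).trans hf1
    · intro p
      rcases hA.u01 p.1 with h | h <;> rcases hB.u01 p.2 with h' | h' <;> simp [h, h']
    · rintro ⟨a, b⟩ ⟨a', b'⟩ h h' e
      have ha := left_ne_zero_of_mul h; have hb := right_ne_zero_of_mul h
      have ha' := left_ne_zero_of_mul h'; have hb' := right_ne_zero_of_mul h'
      have e1 : ∀ a b, ua a ≠ 0 → ub b ≠ 0 → A a = (A a ∪ B b) ∩ D ∧ B b = (A a ∪ B b) \ D := by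
        intro a b ha hb
        constructor
        · ext j
          have := fun h => (hA.mem a ha j h).2
          have := fun h => (hB.mem b hb j h).2
          simp only [Finset.mem_inter, Finset.mem_union]; tauto
        · ext j
          have := fun h => (hA.mem a ha j h).2
          have := fun h => (hB.mem b hb j h).2
          simp only [Finset.mem_sdiff, Finset.mem_union]; tauto
      have e : A a ∪ B b = A a' ∪ B b' := e
      refine Prod.ext (hA.inj _ _ ha ha' ?_) (hB.inj _ _ hb hb' ?_)
      · rw [(e1 a b ha hb).1, e, ← (e1 a' b' ha' hb').1]
      · rw [(e1 a b ha hb).2, e, ← (e1 a' b' ha' hb').2]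
  refine (phi_op _ ((q:ℝ) ^ (3 * min na nb))⁻¹ (by positivity) fun y w => ?_).trans ?_
  · rw [mul_assoc, ← div_eq_inv_mul, le_div_iff₀ (by positivity)]
    by_cases h0 : 1 ≤ na ∧ 1 ≤ nb
    · have := hf D (fun S => ∑ a, if A a = S then ua a * y a else 0)
        (fun S => ∑ b, if B b = S then ub b * w b else 0) na nb h0.1 h0.2 hi ?_ ?_
      · refine le_trans (le_of_eq ?_) (this.trans ?_)
        · congr 2
          simp only [Finset.mul_sum, Finset.sum_mul]
          symm
          calc _ = ∑ S, ∑ b, ∑ T, ∑ a, f (S ∪ T) * (if A a = S then ua a * y a else 0) * (if B b = T then ub b * w b else 0) := by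
                refine Finset.sum_congr rfl fun S _ => ?_
                rw [Finset.sum_comm]
            _ = ∑ S, ∑ b, ∑ a, f (S ∪ B b) * (if A a = S then ua a * y a else 0) * (ub b * w b) := by
                refine Finset.sum_congr rfl fun S _ => Finset.sum_congr rfl fun b _ => ?_
                rw [Finset.sum_comm]
                refine Finset.sum_congr rfl fun a _ => ?_
                simp
            _ = ∑ a, ∑ b, ∑ S, f (S ∪ B b) * (if A a = S then ua a * y a else 0) * (ub b * w b) := by
                rw [Finset.sum_comm, Finset.sum_comm (s := (Finset.univ : Finset α))]
                refine Finset.sum_congr rfl fun b _ => ?_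
                rw [Finset.sum_comm]
            _ = _ := by
                refine Finset.sum_congr rfl fun a _ => Finset.sum_congr rfl fun b _ => ?_
                simp only [mul_ite, ite_mul, mul_zero, zero_mul, Finset.sum_ite_eq, Finset.mem_univ, if_true, Matrix.of_apply]
                ring
        · exact mul_le_mul (push_sq A ua y hA.u01 hA.inj) (push_sq B ub w hB.u01 hB.inj)
            (Finset.sum_nonneg fun _ _ => sq_nonneg _) (Finset.sum_nonneg fun _ _ => sq_nonneg _)
      · intro S hS
        obtain ⟨a, -, ha⟩ := Finset.exists_ne_zero_of_sum_ne_zero hS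
        have h1 : A a = S := by_contra fun h => ha (if_neg h)
        rw [if_pos h1] at ha
        have := left_ne_zero_of_mul ha
        subst h1
        exact ⟨fun j hj => (hA.mem a this j hj).2, hA.card a this⟩
      · intro S hS
        obtain ⟨a, -, ha⟩ := Finset.exists_ne_zero_of_sum_ne_zero hS
        have h1 : B a = S := by_contra fun h => ha (if_neg h)
        rw [if_pos h1] at ha
        have := left_ne_zero_of_mul ha
        subst h1
        exact ⟨Finset.disjoint_left.2 fun j hj => (hB.mem a this j hj).2, hB.card a this⟩
    · have : min na nb = 0 := by omega
      rw [this, mul_zero, pow_zero, mul_one]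
      have := Finset.sum_mul_sq_le_sq_mul_sq Finset.univ (fun p : α × β => ua p.1 * ub p.2 * f (A p.1 ∪ B p.2))
          (fun p => y p.1 * w p.2)
      simp only [Fintype.sum_prod_type] at this
      have e : ∑ a, ∑ b, (y a * w b) ^ 2 = (∑ a, y a ^ 2) * ∑ b, w b ^ 2 := by
        simp only [mul_pow, Finset.sum_mul_sum]
      rw [e] at this
      have h3 : 0 ≤ (∑ a, y a ^ 2) * ∑ b, w b ^ 2 :=
        mul_nonneg (Finset.sum_nonneg fun _ _ => sq_nonneg _) (Finset.sum_nonneg fun _ _ => sq_nonneg _)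
      calc _ = (∑ x, ∑ x_1, ua x * ub x_1 * f (A x ∪ B x_1) * (y x * w x_1)) ^ 2 := by
            congr 1
            exact Finset.sum_congr rfl fun a _ => Finset.sum_congr rfl fun b _ => by
              simp only [Matrix.of_apply]; ring
        _ ≤ _ := this
        _ ≤ _ := by nlinarith
  · exact mul_le_of_le_one_right (by positivity) hfro

lemma mom_ind {i q : ℕ} (hq : 1 ≤ q) (f : Finset ι → ℝ) (hf : Reg i q f) (hf1 : ∑ S, f S ^ 2 ≤ 1)
    (χ : ι → ℕ) (r : ℕ) : ∀ {α β : Type} [Fintype α] [Fintype β] (c na nb : ℕ) (D : Finset ι)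
    (A : α → Finset ι) (B : β → Finset ι) (ua : α → ℝ) (ub : β → ℝ), na + nb = c → c + r = i →
    (∀ j ∈ D, χ j < c) → SI χ c na (· ∈ D) A ua → SI χ c nb (· ∉ D) B ub →
    gE (phi (TM f χ r c A B ua ub) ^ q) ≤
      (55296 ^ r * (q:ℝ) ^ (-3 * min (2 * (na:ℤ)) (min (2 * nb) (na + nb - 1)))) ^ q := by
  have hq0 : (0:ℝ) < q := by exact_mod_cast hq
  have hq1 : (1:ℝ) ≤ q := by exact_mod_cast hq
  induction r with
  | zero =>
    intro α β _ _ c na nb D A B ua ub hc hi hD hA hB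
    have e : ∀ x : ι → ℝ, (TM f χ 0 c A B ua ub).map (eval x) = Matrix.of fun a b => ua a * ub b * f (A a ∪ B b) := by
      intro x; ext a b
      simp [TM]
    have : gE (phi (TM f χ 0 c A B ua ub) ^ q) = phi (Matrix.of fun a b => ua a * ub b * f (A a ∪ B b)) ^ q := by
      simp [gE, eval_phi, e]
    rw [this]
    refine pow_le_pow_left₀ (phi_nonneg _) ((mom_base hq f hf hf1 χ c na nb (by omega) D A B ua ub hA hB).trans ?_) q
    rw [pow_zero, one_mul, inv_pow, ← pow_mul, ← zpow_natCast, ← _root_.zpow_neg]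
    refine zpow_le_zpow_right₀ hq1 ?_
    push_cast
    omega
  | succ r ih =>
    intro α β _ _ c na nb D A B ua ub hc hi hD hA hB
    set v : ι → ℝ := fun j => if χ j = c then 1 else 0 with hv
    have hs := s6_step (fun j => χ j = c) (TN f χ r c A B ua ub v)
      (fun j hj => by
        ext1 a b
        have : v j = 0 := by rw [hv]; simp [hj]
        simp [TN, this]) (fun j hj j' a b => TN_pd f χ r c A B ua ub v j hj j' a b) q hq
    rw [← TN_sum f χ r c A B ua ub v hv, TN_flL, TN_flR] at hs
    have iL := ih (c + 1) (na + 1) nb (D ∪ Finset.univ.filter fun j => χ j = c)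
      (fun p : α × ι => insert p.2 (A p.1)) B (fun p => ua p.1 * v p.2) ub (by omega) (by omega)
      (by
        intro j hj
        rcases Finset.mem_union.1 hj with h | h
        · have := hD j h; omega
        · have := (Finset.mem_filter.1 h).2; omega)
      (hA.step (fun j _ h => Finset.mem_union_left _ h) fun j h => by simp [h])
      (hB.mono fun j h h' => by
        simp only [Finset.mem_union, Finset.mem_filter, Finset.mem_univ, true_and]
        rintro (h1 | h1)
        · exact h' h1
        · omega)
    have iR := ih (c + 1) na (nb + 1) D
      A (fun p : β × ι => insert p.2 (B p.1)) ua (fun p => ub p.1 * v p.2) (by omega) (by omega)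
      (fun j hj => by have := hD j hj; omega)
      (hA.mono fun j _ h => h)
      (hB.step (fun j h h' => h') fun j h h' => by have := hD j h'; omega)
    have fin : ∀ (G1 G2 : ℝ) (b1 b2 b : ℤ), b1 ≤ b → 3 + b2 ≤ b →
        G1 ≤ (55296 ^ r * (q:ℝ) ^ b1) ^ q → G2 ≤ (55296 ^ r * (q:ℝ) ^ b2) ^ q →
        27648 ^ q * (G1 + (q:ℝ) ^ (3 * q) * G2) ≤ (55296 ^ (r + 1) * (q:ℝ) ^ b) ^ q := by
      intro G1 G2 b1 b2 b h1 h2 h3 h4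
      have k1 : G1 ≤ (55296 ^ r * (q:ℝ) ^ b) ^ q := h3.trans (by gcongr)
      have k2 : (q:ℝ) ^ (3 * q) * G2 ≤ (55296 ^ r * (q:ℝ) ^ b) ^ q := by
        calc _ ≤ (q:ℝ) ^ (3 * q) * (55296 ^ r * (q:ℝ) ^ b2) ^ q := by gcongr
          _ = (55296 ^ r * (q:ℝ) ^ (3 + b2)) ^ q := by
              rw [zpow_add₀ hq0.ne', pow_mul, ← mul_pow]
              congr 1
              rw [← zpow_natCast]; push_cast; ring
          _ ≤ _ := by gcongr
      have k3 : (2:ℝ) ≤ 2 ^ q := by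
        calc (2:ℝ) = 2 ^ 1 := by norm_num
          _ ≤ _ := pow_le_pow_right₀ (by norm_num) hq
      have k4 : 0 ≤ (55296 ^ r * (q:ℝ) ^ b) ^ q := by positivity
      calc _ ≤ 27648 ^ q * (2 * (55296 ^ r * (q:ℝ) ^ b) ^ q) := by gcongr; linarith
        _ ≤ 27648 ^ q * (2 ^ q * (55296 ^ r * (q:ℝ) ^ b) ^ q) := by gcongr
        _ = _ := by rw [← mul_pow, ← mul_pow]; congr 1; ring
    rcases le_total na nb with hab | hab
    · refine hs.1.trans (fin _ _ _ _ _ ?_ ?_ iR iL) <;> push_cast <;> omega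
    · refine hs.2.trans (fin _ _ _ _ _ ?_ ?_ iL iR) <;> push_cast <;> omega

end FD2

section FD3
open MvPolynomial Matrix
set_option linter.unusedSectionVars false

variable {ι : Type} [Fintype ι] [DecidableEq ι]

/-- multilinear polynomial with given coefficients -/
noncomputable def mp (f : Finset ι → ℝ) : MvPolynomial ι ℝ := ∑ S, C (f S) * ∏ i ∈ S, X i

lemma eval_mp (f : Finset ι → ℝ) (x : ι → ℝ) : eval x (mp f) = ∑ S, f S * ∏ i ∈ S, x i := by
  simp [mp, map_sum, map_prod]

lemma count_phi (i : ℕ) (S : Finset ι) (hS : S.card = i) :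
    (Finset.univ.filter fun φ : Fin i → ι => Finset.univ.image φ = S).card = i.factorial := by
  have e0 : Fin i ≃ S := (Fintype.equivFinOfCardEq (by simpa using hS)).symm
  have e1 : i.factorial = Fintype.card (Fin i ≃ S) := by rw [Fintype.card_equiv e0, Fintype.card_fin]
  rw [e1, ← Finset.card_univ]
  symm
  refine Finset.card_bij (fun (e : Fin i ≃ S) _ l => (e l : ι)) ?_ ?_ ?_
  · intro e _
    simp only [Finset.mem_filter, Finset.mem_univ, true_and]
    ext x
    simp only [Finset.mem_image, Finset.mem_univ, true_and]
    constructor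
    · rintro ⟨l, rfl⟩; exact (e l).2
    · intro hx; exact ⟨e.symm ⟨x, hx⟩, by simp⟩
  · intro e _ e' _ h
    ext l; exact congrFun h l
  · intro φ hφ
    have hφ := (Finset.mem_filter.1 hφ).2
    have hm : ∀ l, φ l ∈ S := fun l => hφ ▸ Finset.mem_image_of_mem _ (Finset.mem_univ l)
    have hsurj : Function.Surjective (fun l => (⟨φ l, hm l⟩ : S)) := by
      rintro ⟨x, hx⟩
      rw [← hφ] at hx
      obtain ⟨l, -, h⟩ := Finset.mem_image.1 hx
      exact ⟨l, by simp [h]⟩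
    refine ⟨Equiv.ofBijective _ ((Fintype.bijective_iff_surjective_and_card _).2 ⟨hsurj, by simp [hS]⟩), Finset.mem_univ _, ?_⟩
    rfl

lemma count_chi (i : ℕ) (φ : Fin i → ι) (hφ : Function.Injective φ) :
    (Finset.univ.filter fun χ : ι → Fin i => ∀ l, χ (φ l) = l).card = i ^ (Fintype.card ι - i) := by
  have e : (Finset.univ.filter fun χ : ι → Fin i => ∀ l, χ (φ l) = l) =
      Fintype.piFinset (fun j => Finset.univ.filter fun c => ∀ l, φ l = j → c = l) := by
    ext χ
    simp only [Finset.mem_filter, Finset.mem_univ, true_and, Fintype.mem_piFinset]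
    exact ⟨fun h j l hl => by rw [← hl, h], fun h l => h _ l rfl⟩
  rw [e, Fintype.card_piFinset]
  have : ∀ j, (Finset.univ.filter fun c => ∀ l, φ l = j → c = l).card =
      if j ∈ Finset.univ.image φ then 1 else i := by
    intro j
    split_ifs with h
    · obtain ⟨l, -, rfl⟩ := Finset.mem_image.1 h
      rw [Finset.card_eq_one]
      refine ⟨l, ?_⟩
      ext c
      simp only [Finset.mem_filter, Finset.mem_univ, true_and, Finset.mem_singleton]
      exact ⟨fun h => h l rfl, fun h l' hl' => by rw [h, hφ hl']⟩
    · rw [Finset.filter_true_of_mem, Finset.card_univ, Fintype.card_fin]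
      intro c _ l hl
      exact absurd (Finset.mem_image.2 ⟨l, Finset.mem_univ _, hl⟩) h
  simp only [this, Finset.prod_ite, Finset.prod_const, one_pow, one_mul]
  congr 1
  rw [Finset.filter_not, Finset.card_sdiff_of_subset (Finset.filter_subset _ _), Finset.filter_mem_eq_inter,
    Finset.univ_inter, Finset.card_image_of_injective _ hφ]
  simp

lemma sum_chi (i : ℕ) (f : Finset ι → ℝ) (hf : ∀ S, f S ≠ 0 → S.card = i) (x : ι → ℝ) :
    ∑ χ : ι → Fin i, (∑ φ : Fin i → ι, if ∀ l, χ (φ l) = l then f (Finset.univ.image φ) * ∏ l, x (φ l) else 0)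
      = (i ^ (Fintype.card ι - i) : ℕ) * i.factorial * eval x (mp f) := by
  rw [Finset.sum_comm]
  have h1 : ∀ φ : Fin i → ι, (∑ χ : ι → Fin i, if ∀ l, χ (φ l) = l then f (Finset.univ.image φ) * ∏ l, x (φ l) else 0)
      = (i ^ (Fintype.card ι - i) : ℕ) * (f (Finset.univ.image φ) * ∏ j ∈ Finset.univ.image φ, x j) := by
    intro φ
    by_cases h : f (Finset.univ.image φ) = 0
    · simp [h]
    · have hinj : Function.Injective φ := by
        have := hf _ h
        have h2 : Set.InjOn φ ((Finset.univ : Finset (Fin i)) : Set (Fin i)) :=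
          Finset.card_image_iff.1 (by simpa using this)
        exact Set.injOn_univ.1 (by simpa using h2)
      rw [← Finset.sum_filter, Finset.sum_const, count_chi i φ hinj, nsmul_eq_mul,
        Finset.prod_image (fun a _ b _ h => hinj h)]
  simp only [h1]
  rw [← Finset.mul_sum, mul_assoc, eval_mp]
  congr 1
  rw [← Finset.sum_fiberwise_of_maps_to (s := Finset.univ) (t := Finset.univ) (g := fun φ : Fin i → ι => Finset.univ.image φ) (fun _ _ => Finset.mem_univ _), Finset.mul_sum]
  refine Finset.sum_congr rfl fun S _ => ?_
  rw [Finset.sum_congr rfl (g := fun _ => f S * ∏ j ∈ S, x j) (fun φ hφ => by rw [(Finset.mem_filter.1 hφ).2])]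
  rw [Finset.sum_const, nsmul_eq_mul]
  by_cases h : f S = 0
  · simp [h]
  · rw [count_phi i S (hf S h)]

theorem moment_bound {i q : ℕ} (hi : 1 ≤ i) (hq : 1 ≤ q) (f : Finset ι → ℝ)
    (h0 : ∀ S, f S ≠ 0 → S.card = i) (hf : Reg i q f) (hf1 : ∑ S, f S ^ 2 ≤ 1) :
    gE (mp f ^ (6 * q)) ≤ ((i:ℝ) ^ (2 * i) * 55296 ^ i * q) ^ (3 * q) := by
  have hi0 : (0:ℝ) < i := by exact_mod_cast hi
  have hi1 : (1:ℝ) ≤ i := by exact_mod_cast hi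
  have hq0 : (0:ℝ) < q := by exact_mod_cast hq
  by_cases hn : i ≤ Fintype.card ι
  swap
  · have : f = 0 := by
      funext S; by_contra h
      have := h0 S h
      have := Finset.card_le_univ S
      omega
    have : mp f = 0 := by simp [mp, this]
    rw [this, zero_pow (by omega), gE_zero]; positivity
  set n := Fintype.card ι
  set T : (ι → Fin i) → MvPolynomial ι ℝ := fun χ =>
    TM f (fun j => (χ j : ℕ)) i 0 (fun _ : Unit => ∅) (fun _ : Unit => ∅) (fun _ => 1) (fun _ => 1) () () with hT
  have hTe : ∀ χ x, eval x (T χ) = ∑ φ : Fin i → ι, if ∀ l, χ (φ l) = l then f (Finset.univ.image φ) * ∏ l, x (φ l) else 0 := by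
    intro χ x
    simp only [hT, TM, map_sum]
    refine Finset.sum_congr rfl fun φ _ => ?_
    have : (∀ l, ((χ (φ l) : Fin i) : ℕ) = 0 + l) ↔ ∀ l, χ (φ l) = l := by
      simp [Fin.ext_iff]
    simp only [this]
    split_ifs <;> simp [map_prod]
  have hTm : ∀ χ, gE (T χ ^ (6 * q)) ≤ (55296 ^ i * (q:ℝ) ^ 3) ^ q := by
    intro χ
    have := mom_ind hq f hf hf1 (fun j => (χ j : ℕ)) i 0 0 0 ∅ (fun _ : Unit => ∅) (fun _ : Unit => ∅)
      (fun _ => 1) (fun _ => 1) rfl (by simp) (by simp)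
      ⟨by simp, by simp, by simp, by simp⟩ ⟨by simp, by simp, by simp, by simp⟩
    have e : phi (TM f (fun j => (χ j : ℕ)) i 0 (fun _ : Unit => ∅) (fun _ : Unit => ∅) (fun _ => 1) (fun _ => 1)) = T χ ^ 6 := by
      simp only [phi, trace, mul_apply, diag_apply, Finset.univ_unique, Finset.sum_singleton, transpose_apply, hT]
      ring_nf
    rw [e, ← pow_mul] at this
    refine this.trans (le_of_eq ?_)
    norm_num
  have hpt : ∀ x, eval x (mp f ^ (6 * q)) ≤ eval x (C (((i:ℝ) ^ i) ^ (6 * q) / i ^ n) * ∑ χ, T χ ^ (6 * q)) := by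
    intro x
    have hs := sum_chi i f h0 x
    simp only [← hTe] at hs
    have hcard : (Fintype.card (ι → Fin i) : ℝ) = (i:ℝ) ^ n := by simp [n]
    have hJ := Real.pow_arith_mean_le_arith_mean_pow_of_even Finset.univ (fun _ : ι → Fin i => 1 / (i:ℝ) ^ n)
      (fun χ => eval x (T χ)) (fun _ _ => by positivity)
      (by rw [Finset.sum_const, nsmul_eq_mul, Finset.card_univ, hcard]; field_simp) (n := 6 * q) ⟨3 * q, by ring⟩
    rw [← Finset.mul_sum, ← Finset.mul_sum, hs] at hJ
    have hfac : (1:ℝ) ≤ (i.factorial : ℝ) := by exact_mod_cast Nat.one_le_iff_ne_zero.2 (Nat.factorial_ne_zero i)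
    have hpw : (i:ℝ) ^ n = i ^ (n - i) * i ^ i := by rw [← pow_add]; congr 1; omega
    have ev : Even (6 * q) := ⟨3 * q, by ring⟩
    have key : eval x (mp f) ^ (6 * q) ≤ ((i:ℝ) ^ i) ^ (6 * q) * (1 / (i:ℝ) ^ n * (((i ^ (n - i) : ℕ) : ℝ) * i.factorial * eval x (mp f))) ^ (6 * q) := by
      rw [← mul_pow, ← ev.pow_abs, ← ev.pow_abs ((i:ℝ) ^ i * _)]
      refine pow_le_pow_left₀ (abs_nonneg _) ?_ _
      have : (i:ℝ) ^ i * (1 / (i:ℝ) ^ n * (((i ^ (n - i) : ℕ) : ℝ) * i.factorial * eval x (mp f))) = i.factorial * eval x (mp f) := by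
        rw [hpw]; push_cast; field_simp
      rw [this, abs_mul, abs_of_pos (show (0:ℝ) < i.factorial by linarith)]
      nlinarith [abs_nonneg (eval x (mp f))]
    simp only [map_pow, map_mul, eval_C, map_sum]
    refine key.trans ?_
    calc _ ≤ ((i:ℝ) ^ i) ^ (6 * q) * (1 / (i:ℝ) ^ n * ∑ χ, eval x (T χ) ^ (6 * q)) := by gcongr
      _ = _ := by ring
  refine (gE_mono hpt).trans ?_
  rw [gE_smul, gE_sum]
  have : ∑ χ, gE (T χ ^ (6 * q)) ≤ (i:ℝ) ^ n * (55296 ^ i * (q:ℝ) ^ 3) ^ q := by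
    refine (Finset.sum_le_sum fun χ _ => hTm χ).trans (le_of_eq ?_)
    rw [Finset.sum_const, nsmul_eq_mul, Finset.card_univ]; simp [n]
  calc _ ≤ ((i:ℝ) ^ i) ^ (6 * q) / i ^ n * ((i:ℝ) ^ n * (55296 ^ i * (q:ℝ) ^ 3) ^ q) := by gcongr
    _ = (((i:ℝ) ^ i) ^ 6 * (55296 ^ i * (q:ℝ) ^ 3)) ^ q := by
        rw [mul_pow _ (55296 ^ i * (q:ℝ) ^ 3) q, ← pow_mul ((i:ℝ) ^ i) 6 q]; field_simp
    _ ≤ ((i:ℝ) ^ (2 * i) * 55296 ^ i * q) ^ (3 * q) := by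
        rw [pow_mul _ 3 q]
        refine pow_le_pow_left₀ (by positivity) ?_ _
        have : (1:ℝ) ≤ 55296 ^ i := one_le_pow₀ (by norm_num)
        have e : ((i:ℝ) ^ (2 * i) * 55296 ^ i * q) ^ 3 = ((i:ℝ) ^ i) ^ 6 * ((55296 ^ i) ^ 3 * (q:ℝ) ^ 3) := by ring
        rw [e]
        gcongr
        exact le_self_pow₀ this (by norm_num)

end FD3

section FB1
open MvPolynomial
set_option linter.unusedSectionVars false

variable {ι : Type} [Fintype ι] [DecidableEq ι]

lemma sum_split (j : ι) {R : Type} [AddCommMonoid R] (F : Finset ι → R) :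
    ∑ S, F S = ∑ S, if j ∈ S then 0 else F S + F (insert j S) := by
  have h1 : ∑ S, (if j ∈ S then F S else 0) = ∑ S, if j ∈ S then 0 else F (insert j S) := by
    rw [← Finset.sum_filter]
    have : ∀ S, (if j ∈ S then 0 else F (insert j S)) = if j ∉ S then F (insert j S) else 0 := by
      intro S; split_ifs <;> simp_all
    simp only [this]
    rw [← Finset.sum_filter]
    refine Finset.sum_bij' (fun S _ => S.erase j) (fun S _ => insert j S) ?_ ?_ ?_ ?_ ?_
    · intro S hS; simp
    · intro S hS; simp
    · intro S hS; exact Finset.insert_erase (Finset.mem_filter.1 hS).2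
    · intro S hS; exact Finset.erase_insert (Finset.mem_filter.1 hS).2
    · intro S hS; rw [Finset.insert_erase (Finset.mem_filter.1 hS).2]
  calc _ = ∑ S, ((if j ∈ S then 0 else F S) + if j ∈ S then F S else 0) :=
        Finset.sum_congr rfl fun S _ => by split_ifs <;> simp
    _ = _ := by
        rw [Finset.sum_add_distrib, h1, ← Finset.sum_add_distrib]
        exact Finset.sum_congr rfl fun S _ => by split_ifs <;> simp

lemma pd_mp (j : ι) (f : Finset ι → ℝ) (h : ∀ S, j ∈ S → f S = 0) : pderiv j (mp f) = 0 := by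
  rw [mp, map_sum]
  refine Finset.sum_eq_zero fun S _ => ?_
  by_cases hj : j ∈ S
  · simp [h S hj]
  · have : pderiv j (∏ l ∈ S, X (R := ℝ) l) = 0 := by
      refine Finset.prod_induction _ (fun p => pderiv j p = 0) (fun p q hp hq => ?_) ?_ fun l hl => ?_
      · rw [Derivation.leibniz, hp, hq]; simp
      · simp
      · exact pderiv_X_of_ne fun h => hj (h ▸ hl)
    rw [Derivation.leibniz, this]; simp

lemma mp_split (j : ι) (f : Finset ι → ℝ) :
    mp f = X j * mp (fun S => if j ∈ S then 0 else f (insert j S)) + mp (fun S => if j ∈ S then 0 else f S) := by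
  rw [mp, sum_split j, mp, mp, Finset.mul_sum, ← Finset.sum_add_distrib]
  refine Finset.sum_congr rfl fun S _ => ?_
  split_ifs with h
  · simp
  · rw [Finset.prod_insert h]; ring

lemma gE_sq_split (j : ι) (p q : MvPolynomial ι ℝ) (hp : pderiv j p = 0) (hq : pderiv j q = 0) :
    gE ((X j * p + q) ^ 2) = gE (p ^ 2) + gE (q ^ 2) ∧
    gE ((X j * p + q) ^ 4) = 3 * gE (p ^ 4) + 6 * gE (p ^ 2 * q ^ 2) + gE (q ^ 4) := by
  have hX : ∀ a b : ℕ, pderiv j (p ^ a * q ^ b) = 0 := by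
    intro a b
    rw [Derivation.leibniz, Derivation.leibniz_pow, Derivation.leibniz_pow, hp, hq]; simp
  have h1 : ∀ a b : ℕ, gE (X j * (p ^ a * q ^ b)) = 0 := by
    intro a b; rw [gE_X_mul, hX, gE_zero]
  have h2 : ∀ a b : ℕ, gE (X j * (X j * (p ^ a * q ^ b))) = gE (p ^ a * q ^ b) := by
    intro a b; rw [gE_X_mul, Derivation.leibniz, hX]; simp
  have h3 : ∀ a b : ℕ, gE (X j * (X j * (X j * (p ^ a * q ^ b)))) = 0 := by
    intro a b; rw [gE_X_mul, Derivation.leibniz, Derivation.leibniz, hX]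
    simp [gE_add, h1]
  have h4 : ∀ a b : ℕ, gE (X j * (X j * (X j * (X j * (p ^ a * q ^ b))))) = 3 * gE (p ^ a * q ^ b) := by
    intro a b; rw [gE_X_mul, Derivation.leibniz, Derivation.leibniz, Derivation.leibniz, hX]
    simp [gE_add, h2, mul_add]; ring
  constructor
  · have : (X j * p + q) ^ 2 = X j * (X j * (p ^ 2 * q ^ 0)) + (C 2 * (X j * (p ^ 1 * q ^ 1)) + q ^ 2) := by
      rw [show (C 2 : MvPolynomial ι ℝ) = 2 from map_ofNat _ _]; ring
    rw [this, gE_add, gE_add, gE_smul, h2, h1]; simp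
  · have : (X j * p + q) ^ 4 = X j * (X j * (X j * (X j * (p ^ 4 * q ^ 0)))) + (C 4 * (X j * (X j * (X j * (p ^ 3 * q ^ 1))))
        + (C 6 * (X j * (X j * (p ^ 2 * q ^ 2))) + (C 4 * (X j * (p ^ 1 * q ^ 3)) + q ^ 4))) := by
      rw [show (C 4 : MvPolynomial ι ℝ) = 4 from map_ofNat _ _, show (C 6 : MvPolynomial ι ℝ) = 6 from map_ofNat _ _]; ring
    rw [this, gE_add, gE_add, gE_add, gE_add, gE_smul, gE_smul, gE_smul, h4, h3, h2, h1]; simp; ring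

lemma bonami (V : Finset ι) : ∀ (d : ℕ) (f : Finset ι → ℝ), (∀ S, f S ≠ 0 → S ⊆ V ∧ S.card ≤ d) →
    gE (mp f ^ 2) = ∑ S, f S ^ 2 ∧ gE (mp f ^ 4) ≤ 9 ^ d * (∑ S, f S ^ 2) ^ 2 := by
  induction V using Finset.induction_on with
  | empty =>
    intro d f hf
    have e : ∀ S, S ≠ ∅ → f S = 0 := fun S hS => by_contra fun h => hS (Finset.subset_empty.1 (hf S h).1)
    have e1 : mp f = C (f ∅) := by
      rw [mp, Finset.sum_eq_single ∅ (fun S _ hS => by simp [e S hS]) (by simp)]; simp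
    have e2 : ∑ S, f S ^ 2 = f ∅ ^ 2 := by
      rw [Finset.sum_eq_single ∅ (fun S _ hS => by simp [e S hS]) (by simp)]
    rw [e1, e2, ← map_pow, ← map_pow, gE_C, gE_C]
    refine ⟨rfl, ?_⟩
    have : (1:ℝ) ≤ 9 ^ d := one_le_pow₀ (by norm_num)
    nlinarith [sq_nonneg (f ∅ ^ 2)]
  | insert j V hj ih =>
    intro d f hf
    set p : Finset ι → ℝ := fun S => if j ∈ S then 0 else f (insert j S) with hp
    set r : Finset ι → ℝ := fun S => if j ∈ S then 0 else f S with hr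
    have ht : ∀ S, r S ≠ 0 → S ⊆ V ∧ S.card ≤ d := by
      intro S hS
      by_cases h : j ∈ S
      · simp [hr, h] at hS
      · have h2 : f S ≠ 0 := by simpa [hr, h] using hS
        exact ⟨(Finset.subset_insert_iff_of_notMem h).1 (hf S h2).1, (hf S h2).2⟩
    have hq : ∀ S, p S ≠ 0 → S ⊆ V ∧ S.card + 1 ≤ d := by
      intro S hS
      by_cases h : j ∈ S
      · simp [hp, h] at hS
      · have h2 : f (insert j S) ≠ 0 := by simpa [hp, h] using hS
        refine ⟨(Finset.insert_subset_insert_iff h).1 (hf _ h2).1, ?_⟩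
        have := (hf _ h2).2
        rwa [Finset.card_insert_of_notMem h] at this
    have hs : ∑ S, f S ^ 2 = ∑ S, p S ^ 2 + ∑ S, r S ^ 2 := by
      rw [sum_split j, ← Finset.sum_add_distrib]
      refine Finset.sum_congr rfl fun S _ => ?_
      by_cases h : j ∈ S <;> simp [hp, hr, h, add_comm]
    obtain ⟨k1, k2⟩ := gE_sq_split j (mp p) (mp r) (pd_mp j p fun S h => by simp [hp, h])
      (pd_mp j r fun S h => by simp [hr, h])
    rw [← mp_split j f] at k1 k2
    obtain ⟨r2, r4⟩ := ih d r ht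
    have hp' := ih (d - 1) p (fun S h => ⟨(hq S h).1, by have := (hq S h).2; omega⟩)
    rw [k1, k2, hs, hp'.1, r2]
    refine ⟨rfl, ?_⟩
    set a := ∑ S, p S ^ 2 with ha
    set b := ∑ S, r S ^ 2 with hb
    have hb0 : 0 ≤ b := Finset.sum_nonneg fun _ _ => sq_nonneg _
    have ha0 : 0 ≤ a := Finset.sum_nonneg fun _ _ => sq_nonneg _
    have zero : ∀ g : Finset ι → ℝ, ∑ S, g S ^ 2 = 0 → mp g = 0 := by
      intro g hg
      have : g = 0 := by
        funext S
        have := (Finset.sum_eq_zero_iff_of_nonneg (fun _ _ => sq_nonneg _)).1 hg S (Finset.mem_univ _)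
        simpa using this
      simp [mp, this]
    rcases ha0.eq_or_lt with h | h
    · rw [zero p h.symm, ← h]; simp only [ne_eq, OfNat.ofNat_ne_zero, not_false_eq_true, zero_pow, gE_zero, zero_mul, mul_zero, zero_add]; exact r4
    have hd : 1 ≤ d := by
      by_contra hd
      have : p = 0 := by funext S; by_contra h'; have := (hq S h').2; omega
      rw [ha, this] at h; simp at h
    have p4 : gE (mp p ^ 4) ≤ 9 ^ d / 9 * a ^ 2 := by
      have := hp'.2
      have e : (9:ℝ) ^ (d - 1) = 9 ^ d / 9 := by
        obtain ⟨m, rfl⟩ := Nat.exists_eq_add_of_le hd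
        rw [Nat.add_sub_cancel_left, pow_add]; ring
      rwa [e] at this
    have nine : (0:ℝ) < 9 ^ d := by positivity
    rcases hb0.eq_or_lt with h' | h'
    · rw [zero r h'.symm, ← h']; simp only [ne_eq, OfNat.ofNat_ne_zero, not_false_eq_true, zero_pow, gE_zero, mul_zero, add_zero]
      nlinarith [sq_nonneg a]
    have cross : 6 * gE (mp p ^ 2 * mp r ^ 2) ≤ 9 * b / a * gE (mp p ^ 4) + a / b * gE (mp r ^ 4) := by
      rw [← gE_smul, ← gE_smul, ← gE_smul, ← gE_add]
      refine gE_mono fun x => ?_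
      simp only [map_add, map_mul, map_pow, eval_C]
      set u := eval x (mp p); set v := eval x (mp r)
      have : 9 * b / a * u ^ 4 + a / b * v ^ 4 - 6 * (u ^ 2 * v ^ 2) = (3 * b * u ^ 2 - a * v ^ 2) ^ 2 / (a * b) := by
        field_simp; ring
      have h0 : 0 ≤ (3 * b * u ^ 2 - a * v ^ 2) ^ 2 / (a * b) := by positivity
      linarith
    calc _ ≤ 3 * (9 ^ d / 9 * a ^ 2) + (9 * b / a * (9 ^ d / 9 * a ^ 2) + a / b * (9 ^ d * b ^ 2)) + 9 ^ d * b ^ 2 := by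
          have : 9 * b / a * gE (mp p ^ 4) ≤ 9 * b / a * (9 ^ d / 9 * a ^ 2) := by gcongr
          have : a / b * gE (mp r ^ 4) ≤ a / b * (9 ^ d * b ^ 2) := by gcongr
          linarith
      _ = 9 ^ d * (a ^ 2 / 3 + 2 * a * b + b ^ 2) := by field_simp; ring
      _ ≤ _ := by gcongr; nlinarith [sq_nonneg a]

lemma gE_mp_sq (f : Finset ι → ℝ) : gE (mp f ^ 2) = ∑ S, f S ^ 2 :=
  (bonami Finset.univ (Fintype.card ι) f fun _ _ => ⟨Finset.subset_univ _, Finset.card_le_univ _⟩).1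

lemma paley (d : ℕ) (f : Finset ι → ℝ) (hf : ∀ S, f S ≠ 0 → S.card ≤ d) (h1 : ∑ S, f S ^ 2 = 1) :
    1 / (2 * 9 ^ d) ≤ (stdGaussianPi ι).real {x | 1 / 2 ≤ |eval x (mp f)|} := by
  have h4 := (bonami Finset.univ d f fun S h => ⟨Finset.subset_univ _, hf S h⟩).2
  have h2 := gE_mp_sq f
  rw [h1] at h4 h2
  have nine : (0:ℝ) < 9 ^ d := by positivity
  set A := {x | 1 / 2 ≤ |eval x (mp f)|} with hA
  have hcont : Continuous fun x => eval x (mp f) := MvPolynomial.continuous_eval _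
  have hm : MeasurableSet A := (isClosed_le continuous_const hcont.abs).measurableSet
  have key : gE (mp f ^ 2) ≤ ∫ x, (1 / 4 + (1 / (4 * 9 ^ d)) * eval x (mp f ^ 4) + 9 ^ d * A.indicator (fun _ => (1:ℝ)) x) ∂(stdGaussianPi ι) := by
    refine integral_mono (int_eval _) ?_ fun x => ?_
    · exact ((integrable_const _).add ((int_eval _).const_mul _)).add (((integrable_const _).indicator hm).const_mul _)
    · simp only [map_pow]
      set u := eval x (mp f) with hu
      by_cases hx : x ∈ A
      · rw [Set.indicator_of_mem hx]
        have : 1 / (4 * 9 ^ d) * u ^ 4 + 9 ^ d * 1 - u ^ 2 = (u ^ 2 / (2 * 9 ^ d) - 1) ^ 2 * 9 ^ d := by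
          field_simp; ring
        have h0 : 0 ≤ (u ^ 2 / (2 * 9 ^ d) - 1) ^ 2 * 9 ^ d := by positivity
        linarith
      · rw [Set.indicator_of_notMem hx]
        have h3 : |u| < 1 / 2 := not_le.1 hx
        have h5 : u ^ 2 ≤ 1 / 4 := by rw [← sq_abs]; nlinarith [abs_nonneg u]
        have h0 : 0 ≤ 1 / (4 * 9 ^ d) * u ^ 4 := by positivity
        linarith
  have e : ∀ x, 1 / 4 + (1 / (4 * 9 ^ d)) * eval x (mp f ^ 4) + 9 ^ d * A.indicator (fun _ => (1:ℝ)) x =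
      eval x (C (1 / 4) + C (1 / (4 * 9 ^ d)) * mp f ^ 4) + 9 ^ d * A.indicator (fun _ => (1:ℝ)) x := by
    intro x; simp
  simp only [e] at key
  rw [integral_add (int_eval _) (((integrable_const _).indicator hm).const_mul _), integral_const_mul,
    integral_indicator hm, setIntegral_const] at key
  change gE (mp f ^ 2) ≤ gE _ + _ at key
  simp only [gE_add, gE_C, gE_smul, smul_eq_mul, mul_one] at key
  rw [h2] at key
  have : 1 / (4 * 9 ^ d) * gE (mp f ^ 4) ≤ 1 / 4 := by
    calc _ ≤ (1:ℝ) / (4 * 9 ^ d) * (9 ^ d * 1 ^ 2) := by gcongr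
      _ = _ := by field_simp
  rw [div_le_iff₀ (by positivity)]
  nlinarith

end FB1

section FB2
set_option linter.unusedSectionVars false

variable {ι : Type} [Fintype ι] [DecidableEq ι]

lemma lagr (d K : ℕ) (hK : 1 ≤ K) (G : Polynomial ℝ) (hG : G.natDegree ≤ 2 * d) (s : Finset ℕ)
    (hs : s ⊆ Finset.range K) (hc : s.card = 2 * d + 1) (t : ℝ) (ht : 0 ≤ t)
    (h : ∀ k ∈ s, |G.eval (-(k:ℝ) / K)| ≤ t) (z : ℝ) (hz : |z| ≤ 1) :
    |G.eval z| ≤ (2 * d + 1) * t * (2 * K) ^ (2 * d) := by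
  have hK0 : (0:ℝ) < K := by exact_mod_cast hK
  have hinj : Set.InjOn (fun k : ℕ => -(k:ℝ) / K) s := by
    intro a _ b _ hab
    simp only [neg_div, neg_inj] at hab
    rw [div_left_inj' hK0.ne'] at hab
    exact_mod_cast hab
  have e := Lagrange.eq_interpolate (f := G) hinj
    (lt_of_le_of_lt Polynomial.degree_le_natDegree (by rw [hc]; exact_mod_cast Nat.lt_succ_of_le hG))
  rw [e, Lagrange.interpolate_apply, Polynomial.eval_finsetSum]
  refine (Finset.abs_sum_le_sum_abs _ _).trans ?_
  have : ∀ k ∈ s, |Polynomial.eval z (Polynomial.C (G.eval (-(k:ℝ) / K)) * Lagrange.basis s (fun k : ℕ => -(k:ℝ) / K) k)| ≤ t * (2 * K) ^ (2 * d) := by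
    intro k hk
    rw [Polynomial.eval_mul, Polynomial.eval_C, abs_mul]
    refine mul_le_mul (h k hk) ?_ (abs_nonneg _) ht
    rw [Lagrange.basis, Polynomial.eval_prod, Finset.abs_prod]
    have hce : (s.erase k).card = 2 * d := by rw [Finset.card_erase_of_mem hk, hc]; omega
    rw [← hce]
    refine (Finset.prod_le_prod (fun _ _ => abs_nonneg _) fun l hl => ?_).trans_eq (Finset.prod_const (2 * (K:ℝ)))
    have hlk := (Finset.mem_erase.1 hl).1
    have hl := Finset.mem_range.1 (hs (Finset.mem_erase.1 hl).2)
    have hlK : (l:ℝ) ≤ K := by exact_mod_cast hl.le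
    simp only [Lagrange.basisDivisor, Polynomial.eval_mul, Polynomial.eval_C, Polynomial.eval_sub, Polynomial.eval_X]
    rw [abs_mul, mul_comm, abs_inv]
    have h1 : |z - -(l:ℝ) / K| ≤ 2 := by
      have h3 : (l:ℝ) / K ≤ 1 := by rw [div_le_one hK0]; exact hlK
      have h4 : 0 ≤ (l:ℝ) / K := by positivity
      rw [abs_le] at hz ⊢
      rw [neg_div]; constructor <;> linarith [hz.1, hz.2]
    have h2 : 1 / (K:ℝ) ≤ |-(k:ℝ) / K - -(l:ℝ) / K| := by
      rw [← sub_div, abs_div, abs_of_pos hK0]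
      gcongr
      have : (1:ℤ) ≤ |(l:ℤ) - k| := Int.one_le_abs (by omega)
      have : (1:ℝ) ≤ |(l:ℝ) - k| := by exact_mod_cast this
      rwa [show -(k:ℝ) - -l = l - k by ring]
    have h5 : 0 < 1 / (K:ℝ) := by positivity
    calc _ ≤ 2 * (1 / (K:ℝ))⁻¹ := by
          gcongr
      _ = _ := by simp
  calc _ ≤ ∑ k ∈ s, t * (2 * K) ^ (2 * d) := Finset.sum_le_sum this
    _ = _ := by rw [Finset.sum_const, hc, nsmul_eq_mul]; push_cast; ring

lemma circ (d K : ℕ) (hK : 1 ≤ K) (f : Finset ι → ℝ) (hf : ∀ S, f S ≠ 0 → S.card ≤ d) (x y : ι → ℝ)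
    (R : ℝ → ι → ℝ) (hR : R = fun τ i => (1 - τ ^ 2) / (1 + τ ^ 2) * x i + 2 * τ / (1 + τ ^ 2) * y i)
    (s : Finset ℕ) (hs : s ⊆ Finset.range K) (hc : s.card = 2 * d + 1) (t : ℝ) (ht : 0 ≤ t)
    (h : ∀ k ∈ s, |MvPolynomial.eval (R (-(k:ℝ) / K)) (mp f)| ≤ t) (z : ℝ) (hz : |z| ≤ 1) :
    |MvPolynomial.eval (R z) (mp f)| ≤ (2 * d + 1) * (2 ^ d * t) * (2 * K) ^ (2 * d) := by
  have hK0 : (0:ℝ) < K := by exact_mod_cast hK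
  set G : Polynomial ℝ := ∑ S, Polynomial.C (f S) * ((1 + Polynomial.X ^ 2) ^ (d - S.card) *
    ∏ i ∈ S, (Polynomial.C (x i) * (1 - Polynomial.X ^ 2) + Polynomial.C (2 * y i) * Polynomial.X)) with hGd
  have hG : G.natDegree ≤ 2 * d := by
    refine Polynomial.natDegree_sum_le_of_forall_le _ _ fun S _ => ?_
    by_cases h0 : f S = 0
    · simp [h0]
    · have hS := hf S h0
      have e1 : ((1 + Polynomial.X ^ 2 : Polynomial ℝ) ^ (d - S.card)).natDegree ≤ (d - S.card) * 2 :=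
        Polynomial.natDegree_pow_le_of_le _ (by compute_degree)
      have e2 : (∏ i ∈ S, (Polynomial.C (x i) * (1 - Polynomial.X ^ 2) + Polynomial.C (2 * y i) * Polynomial.X)).natDegree ≤ S.card * 2 := by
        refine (Polynomial.natDegree_prod_le _ _).trans ?_
        refine (Finset.sum_le_card_nsmul _ _ 2 fun i _ => ?_).trans (by simp)
        compute_degree
      refine (Polynomial.natDegree_C_mul_le _ _).trans (Polynomial.natDegree_mul_le.trans ?_)
      omega
  have hev : ∀ τ, G.eval τ = (1 + τ ^ 2) ^ d * MvPolynomial.eval (R τ) (mp f) := by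
    intro τ
    have h0 : 0 < 1 + τ ^ 2 := by positivity
    rw [eval_mp, hGd, Polynomial.eval_finsetSum, Finset.mul_sum]
    refine Finset.sum_congr rfl fun S _ => ?_
    by_cases h0' : f S = 0
    · simp [h0']
    · have hS := hf S h0'
      have : (1 + τ ^ 2) ^ d = (1 + τ ^ 2) ^ (d - S.card) * ∏ i ∈ S, (1 + τ ^ 2) := by
        rw [Finset.prod_const, ← pow_add]; congr 1; omega
      simp only [Polynomial.eval_mul, Polynomial.eval_C, Polynomial.eval_pow, Polynomial.eval_add, Polynomial.eval_one,
        Polynomial.eval_X, Polynomial.eval_prod, Polynomial.eval_sub]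
      have e2 : ∏ i ∈ S, (x i * (1 - τ ^ 2) + 2 * y i * τ) = (∏ i ∈ S, (1 + τ ^ 2)) * ∏ i ∈ S, R τ i := by
        rw [← Finset.prod_mul_distrib]
        refine Finset.prod_congr rfl fun i _ => ?_
        rw [hR]; field_simp
      rw [this, e2]; ring
  have key := lagr d K hK G hG s hs hc (2 ^ d * t) (by positivity) (fun k hk => ?_) z hz
  · refine le_trans ?_ key
    rw [hev, abs_mul, abs_of_pos (show (0:ℝ) < (1 + z ^ 2) ^ d by positivity)]
    exact le_mul_of_one_le_left (abs_nonneg _) (one_le_pow₀ (by nlinarith [sq_nonneg z]))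
  · rw [hev, abs_mul, abs_of_pos (show (0:ℝ) < (1 + (-(k:ℝ) / K) ^ 2) ^ d by positivity)]
    have hk' : (k:ℝ) ≤ K := by exact_mod_cast (Finset.mem_range.1 (hs hk)).le
    have h3 : (k:ℝ) / K ≤ 1 := by rw [div_le_one hK0]; exact hk'
    have h4 : 0 ≤ (k:ℝ) / K := by positivity
    refine mul_le_mul (pow_le_pow_left₀ (by positivity) ?_ _) (h k hk) (abs_nonneg _) (by positivity)
    rw [neg_div]; nlinarith

instance : IsGaussian (stdGaussianPi ι) := by
  have h := iIndepFun.hasGaussianLaw (X := fun (i : ι) (ω : ι → ℝ) => ω i) (P := stdGaussianPi ι)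
    (fun i => ⟨by
      have := (measurePreserving_eval (fun _ : ι => gaussianReal 0 1) i).map_eq
      have e : (stdGaussianPi ι).map (fun ω => ω i) = gaussianReal 0 1 := this
      rw [e]; infer_instance⟩)
    (iIndepFun_pi (X := fun _ x => x) (fun _ => aemeasurable_id))
  have := h.isGaussian_map
  have e : (fun (ω : ι → ℝ) => ((fun i => ω i) : ι → ℝ)) = id := rfl
  rw [e, Measure.map_id] at this
  exact this

lemma rot_inv (θ : ℝ) : ((stdGaussianPi ι).prod (stdGaussianPi ι)).map (ContinuousLinearMap.rotation θ)
    = (stdGaussianPi ι).prod (stdGaussianPi ι) := by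
  refine IsGaussian.map_rotation_eq_self ?_ θ
  funext i
  have h1 : Integrable (id : (ι → ℝ) → ι → ℝ) (stdGaussianPi ι) := IsGaussian.integrable_id
  have : (∫ x, id x ∂(stdGaussianPi ι)) i = ∫ x, x i ∂(stdGaussianPi ι) := by
    rw [eval_integral (fun i => by simpa using h1.eval i)]; rfl
  rw [this]
  have h := gE_X_mul i (1 : MvPolynomial ι ℝ)
  simpa [gE] using h

theorem anticonc (d K : ℕ) (hK : 1 ≤ K) (f : Finset ι → ℝ) (hf : ∀ S, f S ≠ 0 → S.card ≤ d)
    (h1 : ∑ S, f S ^ 2 = 1) (t : ℝ) (ht : 0 ≤ t) (htK : (2 * d + 1) * (2 ^ d * t) * (2 * K) ^ (2 * d) < 1 / 2) :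
    (stdGaussianPi ι).real {x | |MvPolynomial.eval x (mp f)| ≤ t} ≤ 4 * d * 9 ^ d / K := by
  have hK0 : (0:ℝ) < K := by exact_mod_cast hK
  have hcont : Continuous fun x => MvPolynomial.eval x (mp f) := MvPolynomial.continuous_eval _
  set γ := stdGaussianPi ι
  set A := {x | |MvPolynomial.eval x (mp f)| ≤ t} with hA
  set B := {x | 1 / 2 ≤ |MvPolynomial.eval x (mp f)|} with hB
  have hAm : MeasurableSet A := (isClosed_le hcont.abs continuous_const).measurableSet
  have hBm : MeasurableSet B := (isClosed_le continuous_const hcont.abs).measurableSet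
  set E : ℕ → Set ((ι → ℝ) × (ι → ℝ)) := fun k => (ContinuousLinearMap.rotation (2 * Real.arctan (-(k:ℝ) / K))) ⁻¹' (A ×ˢ B) with hE
  have hEm : ∀ k, MeasurableSet (E k) := fun k =>
    (ContinuousLinearMap.continuous _).measurable (hAm.prod hBm)
  have hEp : ∀ k, (γ.prod γ).real (E k) = γ.real A * γ.real B := by
    intro k
    rw [← measureReal_prod_prod, ← rot_inv (2 * Real.arctan (-(k:ℝ) / K)),
      map_measureReal_apply (ContinuousLinearMap.continuous _).measurable (hAm.prod hBm), rot_inv]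
  have hpt : ∀ p : (ι → ℝ) × (ι → ℝ), ∑ k ∈ Finset.range K, (E k).indicator (fun _ => (1:ℝ)) p ≤ 2 * d := by
    intro p
    classical
    have : ∑ k ∈ Finset.range K, (E k).indicator (fun _ => (1:ℝ)) p = ((Finset.range K).filter fun k => p ∈ E k).card := by
      simp [Set.indicator_apply, Finset.sum_ite]
    rw [this]
    by_contra hcon
    push Not at hcon
    have hcon : 2 * d + 1 ≤ ((Finset.range K).filter fun k => p ∈ E k).card := by
      exact_mod_cast hcon
    obtain ⟨s, hs, hsc⟩ := Finset.exists_subset_card_eq hcon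
    have hsE : ∀ k ∈ s, p ∈ E k := fun k hk => (Finset.mem_filter.1 (hs hk)).2
    have hsr : s ⊆ Finset.range K := hs.trans (Finset.filter_subset _ _)
    obtain ⟨k, hk⟩ : s.Nonempty := Finset.card_pos.1 (by omega)
    set R : ℝ → ι → ℝ := fun τ i => (1 - τ ^ 2) / (1 + τ ^ 2) * p.1 i + 2 * τ / (1 + τ ^ 2) * p.2 i with hR
    have hcos : ∀ τ : ℝ, Real.cos (2 * Real.arctan τ) = (1 - τ ^ 2) / (1 + τ ^ 2) := by
      intro τ
      have h0 : 0 < 1 + τ ^ 2 := by positivity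
      rw [Real.cos_two_mul, Real.cos_sq_arctan]; field_simp; ring
    have hsin : ∀ τ : ℝ, Real.sin (2 * Real.arctan τ) = 2 * τ / (1 + τ ^ 2) := by
      intro τ
      have h0 : 0 < 1 + τ ^ 2 := by positivity
      have h2 : Real.sin (Real.arctan τ) = τ * Real.cos (Real.arctan τ) := by
        rw [Real.sin_arctan, Real.cos_arctan]; ring
      rw [Real.sin_two_mul, h2]
      calc _ = 2 * τ * Real.cos (Real.arctan τ) ^ 2 := by ring
        _ = _ := by rw [Real.cos_sq_arctan]; ring
    have hk' : (k:ℝ) ≤ K := by exact_mod_cast (Finset.mem_range.1 (hsr hk)).le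
    have hkn : 0 ≤ (k:ℝ) / K := by positivity
    have hk1 : (k:ℝ) / K ≤ 1 := by rw [div_le_one hK0]; exact hk'
    set τ := -(k:ℝ) / K with hτ
    have hτ0 : τ ≤ 0 := by rw [hτ, neg_div]; linarith
    have hτ1 : -1 ≤ τ := by rw [hτ, neg_div]; linarith
    have hc := circ d K hK f hf p.1 p.2 R hR s hsr hsc t ht (fun k hk => by
      have := (hsE k hk).1
      simp only [ContinuousLinearMap.rotation_apply] at this
      convert this using 3
      rw [hR, hcos, hsin]; rfl) ((1 + τ) / (1 - τ)) (by
        rw [abs_of_nonneg (div_nonneg (by linarith) (by linarith)), div_le_one (by linarith)]; linarith)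
    have := (hsE k hk).2
    simp only [ContinuousLinearMap.rotation_apply] at this
    have h0 : 0 < 1 - τ := by linarith
    have h00 : 0 < 1 + τ ^ 2 := by positivity
    have e : R ((1 + τ) / (1 - τ)) = -Real.sin (2 * Real.arctan τ) • p.1 + Real.cos (2 * Real.arctan τ) • p.2 := by
      have h01 : (1 - τ) ^ 2 + (1 + τ) ^ 2 = 2 * (1 + τ ^ 2) := by ring
      have e0 : 1 + ((1 + τ) / (1 - τ)) ^ 2 = 2 * (1 + τ ^ 2) / (1 - τ) ^ 2 := by
        rw [← h01]; field_simp
      have e1 : (1 - ((1 + τ) / (1 - τ)) ^ 2) / (1 + ((1 + τ) / (1 - τ)) ^ 2) = -(2 * τ / (1 + τ ^ 2)) := by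
        rw [e0]; field_simp; ring
      have e2 : 2 * ((1 + τ) / (1 - τ)) / (1 + ((1 + τ) / (1 - τ)) ^ 2) = (1 - τ ^ 2) / (1 + τ ^ 2) := by
        rw [e0]; field_simp; ring
      funext i
      rw [hR, hcos, hsin]
      simp only [e1, e2]; rfl
    rw [← e] at this
    have : 1 / 2 ≤ |MvPolynomial.eval (R ((1 + τ) / (1 - τ))) (mp f)| := this
    linarith
  have hint : ∑ k ∈ Finset.range K, (γ.prod γ).real (E k) ≤ 2 * d := by
    have : ∫ p, ∑ k ∈ Finset.range K, (E k).indicator (fun _ => (1:ℝ)) p ∂(γ.prod γ) ≤ ∫ _p, (2 * d : ℝ) ∂(γ.prod γ) :=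
      integral_mono (integrable_finsetSum _ fun k _ => (integrable_const _).indicator (hEm k)) (integrable_const _) hpt
    rw [integral_finsetSum _ fun k _ => (integrable_const _).indicator (hEm k)] at this
    simpa [integral_indicator, hEm] using this
  simp only [hEp, Finset.sum_const, Finset.card_range, nsmul_eq_mul] at hint
  have hp := paley d f hf h1
  have hA0 : 0 ≤ γ.real A := measureReal_nonneg
  rw [le_div_iff₀ hK0]
  have h9 : (0:ℝ) < 9 ^ d := by positivity
  have : (K:ℝ) * (γ.real A * (1 / (2 * 9 ^ d))) ≤ 2 * d := le_trans (by gcongr) hint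
  calc γ.real A * K = (K:ℝ) * (γ.real A * (1 / (2 * 9 ^ d))) * (2 * 9 ^ d) := by field_simp
    _ ≤ 2 * d * (2 * 9 ^ d) := by gcongr
    _ = _ := by ring

end FB2

section FE

noncomputable def gj (j : ℕ) (x : ℝ) : ℝ := ∫ s in (0:ℝ)..1, (1 - s) * s ^ j * Real.cos (s * x + j * (Real.pi / 2))

lemma gj_deriv (j : ℕ) (x : ℝ) : HasDerivAt (gj j) (gj (j + 1) x) x := by
  have key := intervalIntegral.hasDerivAt_integral_of_dominated_loc_of_deriv_le (𝕜 := ℝ) (μ := volume) (a := (0:ℝ)) (b := 1)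
    (F := fun x s => (1 - s) * s ^ j * Real.cos (s * x + j * (Real.pi / 2)))
    (F' := fun x s => (1 - s) * s ^ (j + 1) * Real.cos (s * x + (j + 1 : ℕ) * (Real.pi / 2)))
    (x₀ := x) (s := Set.univ) (bound := fun _ => 1) Filter.univ_mem
    (Filter.Eventually.of_forall fun y => (by fun_prop : Continuous _).aestronglyMeasurable)
    ((by fun_prop : Continuous _).intervalIntegrable _ _)
    ((by fun_prop : Continuous _).aestronglyMeasurable)
    (Filter.Eventually.of_forall fun s hs y _ => by
      rw [Set.uIoc_of_le zero_le_one] at hs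
      rw [Real.norm_eq_abs, abs_mul, abs_mul, abs_of_nonneg (sub_nonneg.2 hs.2), abs_of_nonneg (pow_nonneg hs.1.le _)]
      have h1 : (1 - s) * s ^ (j + 1) ≤ 1 := mul_le_one₀ (by linarith [hs.1]) (pow_nonneg hs.1.le _) (pow_le_one₀ hs.1.le hs.2)
      exact mul_le_one₀ h1 (abs_nonneg _) (Real.abs_cos_le_one _))
    (continuous_const.intervalIntegrable _ _)
    (Filter.Eventually.of_forall fun s hs y _ => by
      have h1 : HasDerivAt (fun y => s * y + j * (Real.pi / 2)) s y := by
        simpa using ((hasDerivAt_id y).const_mul s).add_const (j * (Real.pi / 2))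
      have h2 := (h1.cos).const_mul ((1 - s) * s ^ j)
      refine h2.congr_deriv ?_
      rw [show s * y + ((j + 1 : ℕ) : ℝ) * (Real.pi / 2) = (s * y + j * (Real.pi / 2)) + Real.pi / 2 by push_cast; ring,
        Real.cos_add_pi_div_two]; ring)
  exact key.2

lemma gj_cont (j : ℕ) : Continuous (gj j) :=
  continuous_iff_continuousAt.2 fun x => (gj_deriv j x).continuousAt

lemma int01 (f : ℝ → ℝ) (C : ℝ) (h : ∀ s ∈ Set.Icc (0:ℝ) 1, |f s| ≤ C) : |∫ s in (0:ℝ)..1, f s| ≤ C := by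
  have := intervalIntegral.norm_integral_le_of_norm_le_const (a := (0:ℝ)) (b := 1) (f := f) (C := C) (fun s hs => by
    rw [Set.uIoc_of_le zero_le_one] at hs
    exact h s ⟨hs.1.le, hs.2⟩)
  simpa using this

lemma gj_le_one (j : ℕ) (x : ℝ) : |gj j x| ≤ 1 := by
  refine int01 _ _ fun s hs => ?_
  rw [abs_mul, abs_mul, abs_of_nonneg (sub_nonneg.2 hs.2), abs_of_nonneg (pow_nonneg hs.1 _)]
  have h1 : (1 - s) * s ^ j ≤ 1 := mul_le_one₀ (by linarith [hs.1]) (pow_nonneg hs.1 _) (pow_le_one₀ hs.1 hs.2)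
  exact mul_le_one₀ h1 (abs_nonneg _) (Real.abs_cos_le_one _)

lemma gj_sq (j : ℕ) (x : ℝ) : |x ^ 2 * gj j x| ≤ 4 * (j + 1) ^ 2 := by
  set a : ℝ := j * (Real.pi / 2) with ha
  set u' : ℝ → ℝ := fun s => j * s ^ (j - 1) - (j + 1) * s ^ j with hu'
  set u2 : ℝ → ℝ := fun s => j * ((j - 1 : ℕ) * s ^ (j - 1 - 1)) - (j + 1) * (j * s ^ (j - 1)) with hu2
  set F : ℝ → ℝ := fun s => (1 - s) * s ^ j * (x * Real.sin (s * x + a)) + u' s * Real.cos (s * x + a) with hF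
  have hd : ∀ s, HasDerivAt F (x ^ 2 * ((1 - s) * s ^ j * Real.cos (s * x + a)) + u2 s * Real.cos (s * x + a)) s := by
    intro s
    have h1 : HasDerivAt (fun s => s * x + a) x s := by
      simpa using ((hasDerivAt_id s).mul_const x).add_const a
    have h2 : HasDerivAt (fun s : ℝ => (1 - s) * s ^ j) (u' s) s := by
      have e : (fun s : ℝ => (1 - s) * s ^ j) = fun s => s ^ j - s ^ (j + 1) := by funext s; ring
      rw [e]
      have := (hasDerivAt_pow j s).sub (hasDerivAt_pow (j + 1) s)
      exact this.congr_deriv (by simp [hu'])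
    have h3 : HasDerivAt u' (u2 s) s :=
      ((hasDerivAt_pow (j - 1) s).const_mul _).sub ((hasDerivAt_pow j s).const_mul _)
    have := (h2.mul ((h1.sin).const_mul x)).add (h3.mul h1.cos)
    exact this.congr_deriv (by ring)
  have hc1 : Continuous fun s => x ^ 2 * ((1 - s) * s ^ j * Real.cos (s * x + a)) := by fun_prop
  have hc2 : Continuous fun s => u2 s * Real.cos (s * x + a) := by fun_prop
  have h := intervalIntegral.integral_eq_sub_of_hasDerivAt (a := (0:ℝ)) (b := 1) (fun s _ => hd s)
    ((hc1.add hc2).intervalIntegrable _ _)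
  rw [intervalIntegral.integral_add (hc1.intervalIntegrable _ _) (hc2.intervalIntegrable _ _),
    intervalIntegral.integral_const_mul] at h
  have hj0 : (0:ℝ) ≤ j := Nat.cast_nonneg j
  have hjj : ((j - 1 : ℕ):ℝ) ≤ j := by exact_mod_cast Nat.sub_le _ _
  have h2 : |∫ s in (0:ℝ)..1, u2 s * Real.cos (s * x + a)| ≤ (j + 1) * j + j * j := by
    refine int01 _ _ fun s hs => ?_
    rw [abs_mul]
    have e1 : s ^ (j - 1) ≤ 1 := pow_le_one₀ hs.1 hs.2
    have e2 : s ^ (j - 1 - 1) ≤ 1 := pow_le_one₀ hs.1 hs.2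
    have e1' : 0 ≤ s ^ (j - 1) := pow_nonneg hs.1 _
    have e2' : 0 ≤ s ^ (j - 1 - 1) := pow_nonneg hs.1 _
    have a1 : 0 ≤ j * (((j - 1 : ℕ):ℝ) * s ^ (j - 1 - 1)) := by positivity
    have a2 : j * (((j - 1 : ℕ):ℝ) * s ^ (j - 1 - 1)) ≤ j * (j * 1) := by gcongr
    have a3 : (0:ℝ) ≤ (j + 1) * (j * s ^ (j - 1)) := by positivity
    have a4 : ((j:ℝ) + 1) * (j * s ^ (j - 1)) ≤ (j + 1) * (j * 1) := by gcongr
    have : |u2 s| ≤ (j + 1) * j + j * j := by rw [abs_le]; constructor <;> simp only [hu2] <;> nlinarith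
    calc _ ≤ ((j + 1) * j + j * j : ℝ) * 1 := mul_le_mul this (Real.abs_cos_le_one _) (abs_nonneg _) (by positivity)
      _ = _ := mul_one _
  have h3 : |F 1| ≤ 1 := by
    have : F 1 = -Real.cos (1 * x + a) := by simp [hF, hu']
    rw [this, abs_neg]; exact Real.abs_cos_le_one _
  have h4 : |F 0| ≤ 1 := by
    rcases j with _ | _ | j
    · simp [hF, hu', ha]
    · simp [hF, hu', ha]
    · simp [hF, hu']
  have : x ^ 2 * gj j x = F 1 - F 0 - ∫ s in (0:ℝ)..1, u2 s * Real.cos (s * x + a) := by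
    rw [← h]; simp [gj, ha]
  rw [this]
  rw [abs_le] at *
  constructor <;> nlinarith

lemma gj_dec (j : ℕ) (x : ℝ) : |gj j x| ≤ 5 * (j + 1) ^ 2 * (1 + x ^ 2)⁻¹ := by
  have h0 : 0 < 1 + x ^ 2 := by positivity
  rw [← div_eq_mul_inv, le_div_iff₀ h0]
  have h1 := gj_le_one j x
  have h2 := gj_sq j x
  rw [abs_mul, abs_of_nonneg (sq_nonneg x)] at h2
  nlinarith [Nat.cast_nonneg (α := ℝ) j]

noncomputable def hk (k : ℕ) (x : ℝ) : ℝ := ∑ j ∈ Finset.range (k + 1), (k.choose j : ℝ) * (gj j x * gj (k - j) x)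

lemma hk_deriv (k : ℕ) (x : ℝ) : HasDerivAt (hk k) (hk (k + 1) x) x := by
  have h : HasDerivAt (hk k) (∑ j ∈ Finset.range (k + 1), (k.choose j : ℝ) * (gj (j + 1) x * gj (k - j) x + gj j x * gj (k - j + 1) x)) x :=
    HasDerivAt.fun_sum fun j _ => ((gj_deriv j x).mul (gj_deriv (k - j) x)).const_mul _
  convert h using 1
  rw [hk, Finset.sum_range_succ', Finset.sum_congr rfl (g := fun j => ((k.choose j : ℝ) + k.choose (j + 1)) * (gj (j + 1) x * gj (k - j) x))]
  · simp only [add_mul, mul_add, Finset.sum_add_distrib]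
    rw [add_assoc]
    congr 1
    rw [Finset.sum_range_succ, Finset.sum_range_succ' (fun j => (k.choose j : ℝ) * (gj j x * gj (k - j + 1) x))]
    simp only [Nat.choose_succ_self, Nat.cast_zero, zero_mul, add_zero]
    congr 1
    · refine Finset.sum_congr rfl fun j hj => ?_
      rw [show k - (j + 1) + 1 = k - j by have := Finset.mem_range.1 hj; omega]
    · simp
  · intro j hj
    rw [Nat.choose_succ_succ, show k + 1 - (j + 1) = k - j by omega]; push_cast; ring

lemma hk_cont (k : ℕ) : Continuous (hk k) :=
  continuous_iff_continuousAt.2 fun x => (hk_deriv k x).continuousAt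

lemma hk_dec (k : ℕ) (x : ℝ) : |hk k x| ≤ 25 * (2 ^ k * (k + 1) ^ 4) * ((1 + x ^ 2)⁻¹ * (1 + x ^ 2)⁻¹) := by
  have h0 : 0 < 1 + x ^ 2 := by positivity
  refine (Finset.abs_sum_le_sum_abs _ _).trans ?_
  have : ∀ j ∈ Finset.range (k + 1), |(k.choose j : ℝ) * (gj j x * gj (k - j) x)| ≤
      k.choose j * (25 * (k + 1) ^ 4 * ((1 + x ^ 2)⁻¹ * (1 + x ^ 2)⁻¹)) := by
    intro j hj
    rw [abs_mul, Nat.abs_cast, abs_mul]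
    have hj' : (j:ℝ) ≤ k := by exact_mod_cast Nat.lt_succ_iff.1 (Finset.mem_range.1 hj)
    have hj2 : ((k - j : ℕ):ℝ) ≤ k := by exact_mod_cast Nat.sub_le _ _
    refine mul_le_mul_of_nonneg_left ?_ (Nat.cast_nonneg _)
    calc |gj j x| * |gj (k - j) x| ≤ (5 * (k + 1) ^ 2 * (1 + x ^ 2)⁻¹) * (5 * (k + 1) ^ 2 * (1 + x ^ 2)⁻¹) := by
          refine mul_le_mul ((gj_dec _ _).trans ?_) ((gj_dec _ _).trans ?_) (abs_nonneg _) (by positivity)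
          · gcongr
          · gcongr
      _ = _ := by ring
  refine (Finset.sum_le_sum this).trans (le_of_eq ?_)
  rw [← Finset.sum_mul, ← Nat.cast_sum, Nat.sum_range_choose]; push_cast; ring

lemma hk_int (k : ℕ) : Integrable (hk k) := by
  refine (integrable_inv_one_add_sq.const_mul (25 * (2 ^ k * (k + 1) ^ 4))).mono' (hk_cont k).aestronglyMeasurable
    (Filter.Eventually.of_forall fun x => (hk_dec k x).trans ?_)
  have h0 : (1 + x ^ 2)⁻¹ ≤ 1 := inv_le_one_of_one_le₀ (by nlinarith [sq_nonneg x])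
  have h1 : 0 < (1 + x ^ 2)⁻¹ := by positivity
  have : (1 + x ^ 2)⁻¹ * (1 + x ^ 2)⁻¹ ≤ (1 + x ^ 2)⁻¹ := by nlinarith
  gcongr

lemma hk_l1 (k : ℕ) : ∫ x, |hk k x| ≤ 25 * (2 ^ k * (k + 1) ^ 4) * Real.pi := by
  rw [← integral_univ_inv_one_add_sq, ← integral_const_mul]
  refine integral_mono (hk_int k).abs (integrable_inv_one_add_sq.const_mul _) fun x => (hk_dec k x).trans ?_
  have h0 : (1 + x ^ 2)⁻¹ ≤ 1 := inv_le_one_of_one_le₀ (by nlinarith [sq_nonneg x])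
  have h1 : 0 < (1 + x ^ 2)⁻¹ := by positivity
  have : (1 + x ^ 2)⁻¹ * (1 + x ^ 2)⁻¹ ≤ (1 + x ^ 2)⁻¹ := by nlinarith
  show _ ≤ 25 * (2 ^ k * ((k:ℝ) + 1) ^ 4) * (1 + x ^ 2)⁻¹
  gcongr

lemma h0_eq (x : ℝ) : hk 0 x = gj 0 x ^ 2 := by simp [hk]; ring

lemma h0_even (x : ℝ) : hk 0 (-x) = hk 0 x := by
  rw [h0_eq, h0_eq]; congr 1
  simp only [gj]
  congr 1; funext s; congr 1
  rw [← Real.cos_neg]; congr 1; push_cast; ring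

lemma h0_sq_int : Integrable fun x => x ^ 2 * hk 0 x := by
  refine (integrable_inv_one_add_sq.const_mul 25).mono' ((continuous_pow 2).mul (hk_cont 0)).aestronglyMeasurable
    (Filter.Eventually.of_forall fun x => ?_)
  have h := hk_dec 0 x
  have h1 : 0 < (1 + x ^ 2)⁻¹ := by positivity
  rw [Real.norm_eq_abs, abs_mul, abs_of_nonneg (sq_nonneg x)]
  calc x ^ 2 * |hk 0 x| ≤ (1 + x ^ 2) * (25 * ((1 + x ^ 2)⁻¹ * (1 + x ^ 2)⁻¹)) := by
        refine mul_le_mul (by linarith) (by simpa using h) (abs_nonneg _) (by positivity)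
    _ = _ := by field_simp

lemma h0_pos : 0 < ∫ x, hk 0 x := by
  rw [integral_pos_iff_support_of_nonneg (fun x => by rw [h0_eq]; exact sq_nonneg _) (hk_int 0)]
  refine (hk_cont 0).isOpen_support.measure_pos _ ⟨0, ?_⟩
  rw [Function.mem_support, h0_eq]
  have : gj 0 0 = 1 / 2 := by
    simp only [gj, pow_zero, mul_one, mul_zero, Nat.cast_zero, zero_mul, add_zero, Real.cos_zero]
    rw [intervalIntegral.integral_sub (by simp) (by simp)]
    norm_num
  rw [this]; norm_num

/-- exponential type mollifier package -/
structure Moll (ψ : ℕ → ℝ → ℝ) (L : ℝ) : Prop where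
  der : ∀ k x, HasDerivAt (ψ k) (ψ (k + 1) x) x
  int : ∀ k, Integrable (ψ k)
  l1 : ∀ k, ∫ x, |ψ k x| ≤ L ^ k
  nn : ∀ x, 0 ≤ ψ 0 x
  one : ∫ x, ψ 0 x = 1
  ev : ∀ x, ψ 0 (-x) = ψ 0 x
  sq : Integrable fun x => x ^ 2 * ψ 0 x
  hL : 1 ≤ L

lemma moll_exists : ∃ ψ L, Moll ψ L := by
  set c := ∫ x, hk 0 x with hc
  have hc0 : 0 < c := h0_pos
  set K := 25 * Real.pi / c with hK
  have hK0 : 0 < K := by positivity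
  refine ⟨fun k x => c⁻¹ * hk k x, 32 * (1 + K), fun k x => (hk_deriv k x).const_mul _, fun k => (hk_int k).const_mul _,
    fun k => ?_, fun x => ?_, ?_, fun x => ?_, ?_, by linarith⟩
  · rcases k with _ | k
    · have : ∀ x, |c⁻¹ * hk 0 x| = c⁻¹ * hk 0 x := fun x =>
        abs_of_nonneg (mul_nonneg (by positivity) (by rw [h0_eq]; exact sq_nonneg _))
      simp only [this, integral_const_mul, ← hc, pow_zero]
      exact (inv_mul_cancel₀ hc0.ne').le
    · simp only [abs_mul, integral_const_mul, abs_of_pos (inv_pos.2 hc0)]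
      have h2 : (((k + 1 : ℕ):ℝ) + 1) ^ 4 ≤ 16 ^ (k + 1) := by
        have : (k + 1) + 1 ≤ 2 ^ (k + 1) := Nat.lt_two_pow_self
        have : (((k + 1 : ℕ):ℝ) + 1) ≤ 2 ^ (k + 1) := by exact_mod_cast this
        calc _ ≤ ((2:ℝ) ^ (k + 1)) ^ 4 := by gcongr
          _ = _ := by rw [← pow_mul, mul_comm, pow_mul]; norm_num
      calc c⁻¹ * ∫ x, |hk (k + 1) x| ≤ c⁻¹ * (25 * (2 ^ (k + 1) * (((k + 1 : ℕ):ℝ) + 1) ^ 4) * Real.pi) := by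
            gcongr; exact hk_l1 _
        _ ≤ c⁻¹ * (25 * (2 ^ (k + 1) * 16 ^ (k + 1)) * Real.pi) := by gcongr
        _ = 32 ^ (k + 1) * K := by rw [← mul_pow, hK]; field_simp; norm_num
        _ ≤ 32 ^ (k + 1) * (1 + K) ^ (k + 1) := by
            gcongr
            calc K ≤ (1 + K) ^ 1 := by linarith
              _ ≤ _ := pow_le_pow_right₀ (by linarith) (by omega)
        _ = _ := by rw [mul_pow]
  · exact mul_nonneg (by positivity) (by rw [h0_eq]; exact sq_nonneg _)
  · rw [integral_const_mul]; exact inv_mul_cancel₀ hc0.ne'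
  · simp only [h0_even]
  · simpa [mul_left_comm] using h0_sq_int.const_mul c⁻¹

variable {ψ : ℕ → ℝ → ℝ} {L : ℝ}

lemma Moll.cont (m : Moll ψ L) (k : ℕ) : Continuous (ψ k) :=
  continuous_iff_continuousAt.2 fun x => (m.der k x).continuousAt

lemma taylor_pt (m : Moll ψ L) (T : ℕ) (u v : ℝ) :
    ψ 0 (u - v) - ∑ k ∈ Finset.range (T + 1), (-v) ^ k / (k.factorial : ℝ) * ψ k u
      = ∫ t in (0:ℝ)..1, ((-v) ^ (T + 1) * (1 - t) ^ T / (T.factorial : ℝ)) * ψ (T + 1) (u - t * v) := by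
  have hd : ∀ t, HasDerivAt (fun t => ∑ k ∈ Finset.range (T + 1), ((-v) ^ k * (1 - t) ^ k / (k.factorial : ℝ)) * ψ k (u - t * v))
      (((-v) ^ (T + 1) * (1 - t) ^ T / (T.factorial : ℝ)) * ψ (T + 1) (u - t * v)) t := by
    intro t
    have hl : HasDerivAt (fun t => u - t * v) (-v) t := by
      simpa using ((hasDerivAt_id t).mul_const v).const_sub u
    have hl2 : HasDerivAt (fun t : ℝ => 1 - t) (-1) t := by simpa using (hasDerivAt_id t).const_sub 1
    have hψ : ∀ k, HasDerivAt (fun t => ψ k (u - t * v)) (ψ (k + 1) (u - t * v) * (-v)) t := fun k =>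
      (m.der k (u - t * v)).comp t hl
    induction T with
    | zero => simpa [mul_comm] using hψ 0
    | succ T ih =>
      simp only [Finset.sum_range_succ _ (T + 1)]
      have h1 := ih.add ((((hl2.pow (T + 1)).const_mul ((-v) ^ (T + 1))).div_const ((T + 1).factorial : ℝ)).mul (hψ (T + 1)))
      refine h1.congr_deriv ?_
      have : ((T + 1).factorial : ℝ) = (T + 1) * T.factorial := by push_cast [Nat.factorial_succ]; ring
      have h0 : (T.factorial : ℝ) ≠ 0 := by positivity
      have h0' : (T:ℝ) + 1 ≠ 0 := by positivity
      rw [this]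
      simp only [Pi.pow_apply]
      push_cast
      field_simp
      simp
      ring
  have h := intervalIntegral.integral_eq_sub_of_hasDerivAt (a := (0:ℝ)) (b := 1) (fun t _ => hd t)
    (((by fun_prop : Continuous fun t : ℝ => (-v) ^ (T + 1) * (1 - t) ^ T / (T.factorial : ℝ)).mul
      ((m.cont (T + 1)).comp (by fun_prop))).intervalIntegrable _ _)
  rw [h]
  congr 1
  · rw [Finset.sum_range_succ']; simp
  · simp

lemma taylor_l1 (m : Moll ψ L) (T : ℕ) (v : ℝ) :
    ∫ u, |ψ 0 (u - v) - ∑ k ∈ Finset.range T, (-v) ^ k / (k.factorial : ℝ) * ψ k u| ≤ (L * |v|) ^ T / T.factorial := by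
  rcases T with _ | T
  · simp only [Finset.range_zero, Finset.sum_empty, sub_zero, pow_zero, Nat.factorial_zero, Nat.cast_one, div_one]
    rw [integral_sub_right_eq_self (fun u => |ψ 0 u|) v]
    simpa using m.l1 0
  simp only [taylor_pt m T]
  set F : ℝ → ℝ → ℝ := fun u t => ((-v) ^ (T + 1) * (1 - t) ^ T / (T.factorial : ℝ)) * ψ (T + 1) (u - t * v) with hF
  have hFc : Continuous (Function.uncurry F) := by
    have := m.cont (T + 1)
    simp only [hF, Function.uncurry_def]
    fun_prop
  set μ := (volume : Measure ℝ).restrict (Set.Ioc 0 1) with hμ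
  have hprod : Integrable (Function.uncurry fun t u => F u t) (μ.prod volume) := by
    rw [integrable_prod_iff (show AEStronglyMeasurable (Function.uncurry fun t u => F u t) (μ.prod volume) from (hFc.comp continuous_swap).aestronglyMeasurable)]
    constructor
    · exact Filter.Eventually.of_forall fun t => ((m.int (T + 1)).comp_sub_right (t * v)).const_mul ((-v) ^ (T + 1) * (1 - t) ^ T / (T.factorial : ℝ))
    · have : ∀ t, ∫ u, ‖Function.uncurry (fun t u => F u t) (t, u)‖ = |(-v) ^ (T + 1) * (1 - t) ^ T / (T.factorial : ℝ)| * ∫ u, |ψ (T + 1) u| := by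
        intro t
        simp only [Function.uncurry_apply_pair, hF, norm_mul, Real.norm_eq_abs]
        rw [integral_const_mul, integral_sub_right_eq_self (fun u => |ψ (T + 1) u|) (t * v)]
      simp only [this]
      exact ((by fun_prop : Continuous _).intervalIntegrable (μ := volume) 0 1).1
  have hsw : Integrable (Function.uncurry F) (volume.prod μ) := hprod.swap
  have h1 : ∀ u, |∫ t in (0:ℝ)..1, F u t| ≤ ∫ t, |F u t| ∂μ := by
    intro u
    rw [intervalIntegral.integral_of_le zero_le_one]
    exact norm_integral_le_integral_norm (μ := μ) (F u)
  calc ∫ u, |∫ t in (0:ℝ)..1, F u t| ≤ ∫ u, ∫ t, |F u t| ∂μ := by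
        refine integral_mono_of_nonneg (Filter.Eventually.of_forall fun u => abs_nonneg _) hsw.abs.integral_prod_left
          (Filter.Eventually.of_forall h1)
    _ = ∫ t, (∫ u, |F u t|) ∂μ := integral_integral_swap hsw.abs
    _ = ∫ t, |(-v) ^ (T + 1) * (1 - t) ^ T / (T.factorial : ℝ)| * (∫ u, |ψ (T + 1) u|) ∂μ := by
        congr 1; funext t
        simp only [hF, abs_mul ((-v) ^ (T + 1) * (1 - t) ^ T / (T.factorial : ℝ))]
        rw [integral_const_mul, integral_sub_right_eq_self (fun u => |ψ (T + 1) u|) (t * v)]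
    _ = ∫ t in (0:ℝ)..1, (|v| ^ (T + 1) / T.factorial * (∫ u, |ψ (T + 1) u|)) * (1 - t) ^ T := by
        rw [intervalIntegral.integral_of_le zero_le_one]
        refine setIntegral_congr_fun measurableSet_Ioc fun t ht => ?_
        have : 0 ≤ 1 - t := sub_nonneg.2 ht.2
        simp only [abs_div, abs_mul, abs_pow, abs_neg, abs_of_nonneg this, Nat.abs_cast]
        ring
    _ = |v| ^ (T + 1) / (T + 1).factorial * ∫ u, |ψ (T + 1) u| := by
        rw [intervalIntegral.integral_const_mul, intervalIntegral.integral_comp_sub_left (fun t => t ^ T) 1]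
        have h0 : (T.factorial : ℝ) ≠ 0 := by positivity
        simp only [sub_self, sub_zero, integral_pow]
        push_cast [Nat.factorial_succ]
        field_simp; simp
    _ ≤ |v| ^ (T + 1) / (T + 1).factorial * L ^ (T + 1) := by gcongr; exact m.l1 _
    _ = _ := by rw [mul_pow]; ring

end FE

section FF
set_option linter.unusedSectionVars false
variable {ι : Type} [Fintype ι] [DecidableEq ι]
open MvPolynomial

noncomputable def l1 (p : MvPolynomial ι ℝ) : ℝ := ∑ m ∈ p.support, |coeff m p|

lemma l1_nonneg (p : MvPolynomial ι ℝ) : 0 ≤ l1 p := Finset.sum_nonneg fun _ _ => abs_nonneg _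

lemma l1_eq (p : MvPolynomial ι ℝ) (s : Finset (ι →₀ ℕ)) (h : p.support ⊆ s) : l1 p = ∑ m ∈ s, |coeff m p| :=
  Finset.sum_subset h fun m _ hm => by rw [notMem_support_iff.1 hm, abs_zero]

lemma l1_add (p q : MvPolynomial ι ℝ) : l1 (p + q) ≤ l1 p + l1 q := by
  rw [l1_eq (p + q) _ support_add, l1_eq p _ Finset.subset_union_left, l1_eq q _ Finset.subset_union_right, ← Finset.sum_add_distrib]
  exact Finset.sum_le_sum fun m _ => by rw [coeff_add]; exact abs_add_le _ _

lemma l1_zero : l1 (0 : MvPolynomial ι ℝ) = 0 := by simp [l1]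

lemma l1_sum {κ : Type*} (s : Finset κ) (f : κ → MvPolynomial ι ℝ) : l1 (∑ k ∈ s, f k) ≤ ∑ k ∈ s, l1 (f k) := by
  classical
  induction s using Finset.induction_on with
  | empty => simp [l1_zero]
  | insert a s ha ih => rw [Finset.sum_insert ha, Finset.sum_insert ha]; exact (l1_add _ _).trans (by gcongr)

lemma l1_monomial (m : ι →₀ ℕ) (c : ℝ) : l1 (monomial m c) ≤ |c| := by
  rw [l1_eq _ {m} support_monomial_subset]; simp

lemma l1_mul (p q : MvPolynomial ι ℝ) : l1 (p * q) ≤ l1 p * l1 q := by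
  have : p * q = ∑ m ∈ p.support, ∑ n ∈ q.support, monomial (m + n) (coeff m p * coeff n q) := by
    conv_lhs => rw [p.as_sum, q.as_sum]
    rw [Finset.sum_mul_sum]
    simp only [monomial_mul]
  rw [this, show l1 p * l1 q = ∑ m ∈ p.support, ∑ n ∈ q.support, |coeff m p| * |coeff n q| from Finset.sum_mul_sum ..]
  refine (l1_sum _ _).trans (Finset.sum_le_sum fun m _ => (l1_sum _ _).trans (Finset.sum_le_sum fun n _ => ?_))
  rw [← abs_mul]; exact l1_monomial _ _

lemma l1_C (c : ℝ) : l1 (C c : MvPolynomial ι ℝ) ≤ |c| := l1_monomial 0 c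

lemma l1_pow (p : MvPolynomial ι ℝ) (j : ℕ) : l1 (p ^ j) ≤ l1 p ^ j := by
  induction j with
  | zero => simpa using l1_C (ι := ι) 1
  | succ j ih => rw [pow_succ, pow_succ]; exact (l1_mul _ _).trans (by gcongr; exact l1_nonneg _)

lemma mm_poly {k : ℕ} {η : ℝ} {μ : Measure (ι → ℝ)} (h : MomentMatches k η μ) (p : MvPolynomial ι ℝ)
    (hp : p.totalDegree ≤ k) : Integrable (fun x => eval x p) μ ∧ |(∫ x, eval x p ∂μ) - gE p| ≤ η * l1 p := by
  have hm : ∀ m ∈ p.support, ∑ i, m i ≤ k := fun m hm => by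
    refine le_trans (le_of_eq ?_) ((le_totalDegree hm).trans hp)
    rw [Finsupp.sum_fintype]; simp
  have hI : ∀ m ∈ p.support, Integrable (fun x : ι → ℝ => coeff m p * ∏ i, x i ^ m i) μ := fun m hm' => by
    refine Integrable.const_mul ((h m (hm m hm')).1.mono' ?_ (Filter.Eventually.of_forall fun x => ?_)) _
    · exact (by fun_prop : Continuous fun x : ι → ℝ => ∏ i, x i ^ m i).aestronglyMeasurable
    · rw [Real.norm_eq_abs, Finset.abs_prod]; simp
  have e : ∀ x, eval x p = ∑ m ∈ p.support, coeff m p * ∏ i, x i ^ m i := fun x => by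
    conv_lhs => rw [p.as_sum]
    simp only [map_sum, eval_monomial']
  refine ⟨by simp only [e]; exact integrable_finsetSum _ hI, ?_⟩
  have e1 : gE p = ∑ m ∈ p.support, coeff m p * ∫ y, ∏ i, (y i) ^ m i ∂(stdGaussianPi ι) := by
    conv_lhs => rw [p.as_sum]
    rw [gE_sum]
    exact Finset.sum_congr rfl fun m _ => by simp only [gE, eval_monomial']; exact integral_const_mul _ _
  simp only [e]
  rw [integral_finsetSum _ hI, e1, ← Finset.sum_sub_distrib, l1, Finset.mul_sum]
  refine (Finset.abs_sum_le_sum_abs _ _).trans (Finset.sum_le_sum fun m hm' => ?_)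
  rw [integral_const_mul, ← mul_sub, abs_mul, mul_comm]
  exact mul_le_mul_of_nonneg_right (h m (hm m hm')).2 (abs_nonneg _)

noncomputable def eT (T : ℕ) (S : ℝ) : ℝ := ∑ m ∈ Finset.range T, S ^ m / (m.factorial : ℝ)

lemma bin_id (s S : ℝ) (T : ℕ) : s ^ T / (T.factorial : ℝ) +
    ∑ j ∈ Finset.range T, s ^ j / (j.factorial : ℝ) * (S ^ (T - j) / ((T - j).factorial : ℝ)) = (S + s) ^ T / (T.factorial : ℝ) := by
  rw [add_comm S s, add_pow, Finset.sum_div, Finset.sum_range_succ, add_comm]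
  congr 1
  · refine Finset.sum_congr rfl fun j hj => ?_
    have := Nat.choose_mul_factorial_mul_factorial (Finset.mem_range.1 hj).le
    have : (T.choose j : ℝ) * j.factorial * (T - j).factorial = T.factorial := by exact_mod_cast this
    rw [← this]
    have h1 : (T.choose j : ℝ) ≠ 0 := by exact_mod_cast (Nat.choose_pos (Finset.mem_range.1 hj).le).ne'
    field_simp
  · simp

lemma exp_id (s S : ℝ) (T : ℕ) : ∑ j ∈ Finset.range T, s ^ j / (j.factorial : ℝ) * eT (T - j) S = eT T (S + s) := by
  simp only [eT, Finset.mul_sum]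
  rw [← Finset.sum_range_diag_flip T (fun j m => s ^ j / (j.factorial : ℝ) * (S ^ m / (m.factorial : ℝ)))]
  refine Finset.sum_congr rfl fun n _ => ?_
  rw [← bin_id, Finset.sum_range_succ, add_comm]; simp

lemma eT_one_le {T : ℕ} (hT : 1 ≤ T) {S : ℝ} (hS : 0 ≤ S) : 1 ≤ eT T S := by
  have := Finset.single_le_sum (f := fun m => S ^ m / (m.factorial : ℝ)) (fun m _ => by positivity) (Finset.mem_range.2 hT)
  simpa [eT] using this

noncomputable def ER (d : ℕ) (S : ℕ → ℝ) (T : ℕ → ℕ) : ℝ :=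
  ∑ i ∈ Finset.range (d + 1), S i ^ T i / ((T i).factorial : ℝ) * ∏ l ∈ Finset.Ioc i d, eT (T l) (S l)

lemma ER_rec (d g : ℕ) (hg : g ≤ d) (S : ℕ → ℝ) (hS : ∀ i, 0 ≤ S i) (hSg : ∀ i, g < i → S i = 0) (T : ℕ → ℕ) (hT : ∀ i, 1 ≤ T i)
    (s : ℝ) (hs : 0 ≤ s) :
    s ^ T g / ((T g).factorial : ℝ) + ∑ j ∈ Finset.range (T g), s ^ j / (j.factorial : ℝ) * ER d S (Function.update T g (T g - j))
      ≤ ER d (Function.update S g (S g + s)) T := by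
  have hgm : g ∈ Finset.range (d + 1) := by simp; omega
  simp only [ER, Finset.mul_sum]
  rw [Finset.sum_comm, ← Finset.add_sum_erase _ _ hgm, ← add_assoc, ← Finset.add_sum_erase _ _ hgm]
  refine add_le_add ?_ (Finset.sum_le_sum fun i hi => ?_)
  · simp only [Function.update_self]
    have e : ∀ (T' : ℕ → ℕ) (S' : ℕ → ℝ), (∀ l, g < l → T' l = T l) → (∀ l, g < l → S' l = S l) →
        ∏ l ∈ Finset.Ioc g d, eT (T' l) (S' l) = ∏ l ∈ Finset.Ioc g d, eT (T l) (S l) := fun T' S' h1 h2 =>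
      Finset.prod_congr rfl fun l hl => by rw [h1 l (Finset.mem_Ioc.1 hl).1, h2 l (Finset.mem_Ioc.1 hl).1]
    rw [e T _ (fun _ _ => rfl) (fun l hl => Function.update_of_ne hl.ne' _ _), ← bin_id, add_mul, Finset.sum_mul]
    refine add_le_add ?_ (le_of_eq (Finset.sum_congr rfl fun j _ => ?_))
    · refine le_mul_of_one_le_right (by positivity) ?_
      rw [← Finset.prod_const_one (ι := ℕ) (s := Finset.Ioc g d)]
      exact Finset.prod_le_prod (fun _ _ => zero_le_one) fun l _ => eT_one_le (hT l) (hS l)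
    · rw [e _ S (fun l hl => Function.update_of_ne hl.ne' _ _) (fun _ _ => rfl)]; ring
  · have hig := (Finset.mem_erase.1 hi).1
    simp only [Function.update_of_ne hig]
    rcases lt_or_gt_of_ne hig with h | h
    · have hgI : g ∈ Finset.Ioc i d := Finset.mem_Ioc.2 ⟨h, hg⟩
      have e : ∀ (T' : ℕ → ℕ) (S' : ℕ → ℝ), (∀ l, l ≠ g → T' l = T l) → (∀ l, l ≠ g → S' l = S l) →
        ∏ l ∈ Finset.Ioc i d, eT (T' l) (S' l) = eT (T' g) (S' g) * ∏ l ∈ (Finset.Ioc i d).erase g, eT (T l) (S l) := fun T' S' h1 h2 => by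
          rw [← Finset.mul_prod_erase _ _ hgI]
          congr 1
          exact Finset.prod_congr rfl fun l hl => by rw [h1 l (Finset.mem_erase.1 hl).1, h2 l (Finset.mem_erase.1 hl).1]
      rw [e T _ (fun _ _ => rfl) (fun l hl => Function.update_of_ne hl _ _)]
      simp only [Function.update_self]
      rw [← exp_id, Finset.sum_mul, Finset.mul_sum]
      refine le_of_eq (Finset.sum_congr rfl fun j _ => ?_)
      rw [e _ S (fun l hl => Function.update_of_ne hl _ _) (fun _ _ => rfl)]
      simp only [Function.update_self]; ring
    · simp [hSg i h, zero_pow (Nat.one_le_iff_ne_zero.1 (hT i))]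

variable {V : Type} [Fintype V] [DecidableEq V] {E : Type} [AddCommGroup E] [Module ℝ E]

lemma taylor_multi (d : ℕ) (Φ : MultilinearMap ℝ (fun _ : V => E) ℝ) (N : E → ℝ) (hN : ∀ y, 0 ≤ N y)
    (hΦ : ∀ c, |Φ c| ≤ ∏ ν, N (c ν)) (L : ℝ) (hL : 0 ≤ L) (a : ℕ → E) (ha : ∀ k, N (a k) ≤ L ^ k) (τ : ℝ → E)
    (hτ1 : ∀ v, N (τ v) ≤ 1)
    (hτ : ∀ v T, N (τ v - ∑ k ∈ Finset.range T, ((-v) ^ k / (k.factorial : ℝ)) • a k) ≤ (L * |v|) ^ T / (T.factorial : ℝ))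
    (dg : V → ℕ) (hdg : ∀ ν, dg ν ≤ d) (lf : V → MvPolynomial ι ℝ) (hdeg : ∀ ν, (lf ν).totalDegree ≤ dg ν)
    (K : ℝ) (hK : 1 ≤ K) (hl1 : ∀ ν, L * l1 (lf ν) ≤ K) (s : Finset V) :
    ∀ T : ℕ → ℕ, (∀ i, 1 ≤ T i) → ∀ c : V → E, ∃ Q : MvPolynomial ι ℝ, Q.totalDegree ≤ ∑ i ∈ Finset.range (d + 1), i * T i ∧
      l1 Q ≤ 3 ^ s.card * K ^ (∑ i ∈ Finset.range (d + 1), T i) * ∏ ν ∈ sᶜ, N (c ν) ∧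
      ∀ x, |Φ (fun ν => if ν ∈ s then τ (eval x (lf ν)) else c ν) - eval x Q| ≤
        ER d (fun i => ∑ ν ∈ s with dg ν = i, L * |eval x (lf ν)|) T * ∏ ν ∈ sᶜ, N (c ν) := by
  induction s using Finset.induction_on_max_value dg with
  | empty =>
    intro T hT c
    refine ⟨C (Φ c), by simp, ?_, fun x => ?_⟩
    · refine (l1_C _).trans ((hΦ c).trans ?_)
      simp only [Finset.card_empty, pow_zero, one_mul, Finset.compl_empty]
      exact le_mul_of_one_le_left (Finset.prod_nonneg fun _ _ => hN _) (one_le_pow₀ hK)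
    · have : ER d (fun i => ∑ ν ∈ (∅ : Finset V) with dg ν = i, L * |eval x (lf ν)|) T = 0 :=
        Finset.sum_eq_zero fun i _ => by simp [zero_pow (Nat.one_le_iff_ne_zero.1 (hT i))]
      rw [this]; simp
  | insert ν s hν hmax ih =>
    intro T hT c
    set g := dg ν with hgd
    have hgm : g ∈ Finset.range (d + 1) := Finset.mem_range.2 (Nat.lt_succ_of_le (hdg ν))
    have hTj : ∀ j ∈ Finset.range (T g), ∀ i, 1 ≤ Function.update T g (T g - j) i := fun j hj i => by
      have := Finset.mem_range.1 hj
      by_cases h : i = g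
      · subst h; simp; omega
      · rw [Function.update_of_ne h]; exact hT i
    have hcompl : sᶜ = insert ν (insert ν s)ᶜ := by
      ext μ; by_cases h : μ = ν
      · subst h; simp [hν]
      · simp [h]
    have hνc : ν ∉ (insert ν s)ᶜ := by simp
    set Pc := ∏ μ ∈ (insert ν s)ᶜ, N (c μ) with hPc
    have hPc0 : 0 ≤ Pc := Finset.prod_nonneg fun _ _ => hN _
    have hcj : ∀ y, ∏ μ ∈ sᶜ, N (Function.update c ν y μ) = N y * Pc := fun y => by
      rw [hcompl, Finset.prod_insert hνc, Function.update_self]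
      congr 1
      exact Finset.prod_congr rfl fun μ hμ => by rw [Function.update_of_ne (fun h : μ = ν => hνc (h ▸ hμ))]
    have : ∀ j : ℕ, ∃ Q : MvPolynomial ι ℝ, j ∈ Finset.range (T g) → (Q.totalDegree ≤ ∑ i ∈ Finset.range (d + 1), i * Function.update T g (T g - j) i ∧
      l1 Q ≤ 3 ^ s.card * K ^ (∑ i ∈ Finset.range (d + 1), Function.update T g (T g - j) i) * (N (a j) * Pc) ∧
      ∀ x, |Φ (fun μ => if μ ∈ s then τ (eval x (lf μ)) else Function.update c ν (a j) μ) - eval x Q| ≤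
        ER d (fun i => ∑ ν ∈ s with dg ν = i, L * |eval x (lf ν)|) (Function.update T g (T g - j)) * (N (a j) * Pc)) := by
      intro j
      by_cases hj : j ∈ Finset.range (T g)
      · obtain ⟨Q, h1, h2, h3⟩ := ih _ (hTj j hj) (Function.update c ν (a j))
        rw [hcj] at h2
        exact ⟨Q, fun _ => ⟨h1, h2, fun x => by rw [← hcj]; exact h3 x⟩⟩
      · exact ⟨0, fun h => absurd h hj⟩
    choose Q hQ using this
    have hupd : ∀ (w : ℕ → ℕ) j, j ∈ Finset.range (T g) → ∑ i ∈ Finset.range (d + 1), w i * Function.update T g (T g - j) i + w g * j = ∑ i ∈ Finset.range (d + 1), w i * T i := by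
      intro w j hj
      rw [← Finset.add_sum_erase _ _ hgm, ← Finset.add_sum_erase _ _ hgm, Function.update_self]
      have : ∑ i ∈ (Finset.range (d + 1)).erase g, w i * Function.update T g (T g - j) i = ∑ i ∈ (Finset.range (d + 1)).erase g, w i * T i :=
        Finset.sum_congr rfl fun i hi => by rw [Function.update_of_ne (Finset.mem_erase.1 hi).1]
      rw [this, Nat.mul_sub]
      have := Nat.mul_le_mul_left (w g) (Finset.mem_range.1 hj).le
      omega
    refine ⟨∑ j ∈ Finset.range (T g), C ((-1) ^ j / (j.factorial : ℝ)) * (lf ν ^ j * Q j), ?_, ?_, fun x => ?_⟩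
    · refine totalDegree_finsetSum_le fun j hj => ?_
      refine (totalDegree_mul _ _).trans ?_
      rw [totalDegree_C, zero_add]
      refine (totalDegree_mul _ _).trans ?_
      have h1 := (hQ j hj).1
      have h2 : (lf ν ^ j).totalDegree ≤ j * g := (totalDegree_pow _ _).trans (Nat.mul_le_mul_left _ (hdeg ν))
      have h3 := hupd (fun i => i) j hj
      rw [mul_comm] at h2
      omega
    · refine (l1_sum _ _).trans ?_
      rw [Finset.card_insert_of_notMem hν]
      have h1 : ∀ j ∈ Finset.range (T g), l1 (C ((-1) ^ j / (j.factorial : ℝ)) * (lf ν ^ j * Q j)) ≤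
          1 ^ j / (j.factorial : ℝ) * (3 ^ s.card * K ^ (∑ i ∈ Finset.range (d + 1), T i) * Pc) := by
        intro j hj
        have hu := hupd (fun _ => 1) j hj
        simp only [one_mul] at hu
        have h2 := (hQ j hj).2.1
        have h3 : l1 (lf ν ^ j) * l1 (Q j) ≤ 3 ^ s.card * K ^ (∑ i ∈ Finset.range (d + 1), T i) * Pc := by
          calc l1 (lf ν ^ j) * l1 (Q j) ≤ l1 (lf ν) ^ j * (3 ^ s.card * K ^ (∑ i ∈ Finset.range (d + 1), Function.update T g (T g - j) i) * (L ^ j * Pc)) := by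
                refine mul_le_mul (l1_pow _ _) (h2.trans ?_) (l1_nonneg _) (pow_nonneg (l1_nonneg _) _)
                gcongr; exact ha j
            _ = 3 ^ s.card * (K ^ (∑ i ∈ Finset.range (d + 1), Function.update T g (T g - j) i) * (L * l1 (lf ν)) ^ j) * Pc := by rw [mul_pow]; ring
            _ ≤ 3 ^ s.card * (K ^ (∑ i ∈ Finset.range (d + 1), Function.update T g (T g - j) i) * K ^ j) * Pc := by
                have := mul_nonneg hL (l1_nonneg (lf ν))
                gcongr; exact hl1 ν
            _ = _ := by rw [← pow_add, hu]
        refine (l1_mul _ _).trans (mul_le_mul ((l1_C _).trans ?_) ((l1_mul _ _).trans h3) (l1_nonneg _) (by positivity))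
        rw [abs_div, abs_pow, abs_neg, abs_one, Nat.abs_cast]
      refine (Finset.sum_le_sum h1).trans ?_
      rw [← Finset.sum_mul]
      have h4 : ∑ j ∈ Finset.range (T g), (1:ℝ) ^ j / (j.factorial : ℝ) ≤ 3 :=
        (Real.sum_le_exp_of_nonneg zero_le_one _).trans (by linarith [Real.exp_one_lt_d9])
      calc _ ≤ 3 * (3 ^ s.card * K ^ (∑ i ∈ Finset.range (d + 1), T i) * Pc) := by gcongr
        _ = _ := by ring
    · set v := eval x (lf ν) with hv
      set base : V → E := fun μ => if μ ∈ s then τ (eval x (lf μ)) else c μ with hbase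
      have e1 : (fun μ => if μ ∈ insert ν s then τ (eval x (lf μ)) else c μ) = Function.update base ν (τ v) := by
        funext μ; by_cases h : μ = ν
        · subst h; simp [hv]
        · simp [h, hbase]
      have e2 : ∀ y, (fun μ => if μ ∈ s then τ (eval x (lf μ)) else Function.update c ν y μ) = Function.update base ν y := by
        intro y; funext μ; by_cases h : μ = ν
        · subst h; simp [hν]
        · simp [h, hbase]
      set r := τ v - ∑ k ∈ Finset.range (T g), ((-v) ^ k / (k.factorial : ℝ)) • a k with hr
      have e3 : Φ (Function.update base ν (τ v)) = Φ (Function.update base ν r) +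
          ∑ k ∈ Finset.range (T g), ((-v) ^ k / (k.factorial : ℝ)) * Φ (Function.update base ν (a k)) := by
        have : τ v = r + ∑ k ∈ Finset.range (T g), ((-v) ^ k / (k.factorial : ℝ)) • a k := by rw [hr]; abel
        rw [this, Φ.map_update_add, Φ.map_update_sum]
        simp only [Φ.map_update_smul, smul_eq_mul]
      set s0 := L * |v| with hs0
      have hr' : |Φ (Function.update base ν r)| ≤ s0 ^ T g / ((T g).factorial : ℝ) * Pc := by
        refine (hΦ _).trans ?_
        rw [← Finset.mul_prod_erase _ _ (Finset.mem_univ ν), Function.update_self]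
        refine mul_le_mul (hτ v _) ?_ (Finset.prod_nonneg fun _ _ => hN _) (by positivity)
        have : Finset.univ.erase ν = s ∪ (insert ν s)ᶜ := by
          ext μ; by_cases h : μ = ν
          · subst h; simp [hν]
          · by_cases h' : μ ∈ s <;> simp [h, h']
        rw [this, Finset.prod_union (Finset.disjoint_left.2 fun μ h1 h2 => by simp [h1] at h2)]
        have h1 : ∏ μ ∈ s, N (Function.update base ν r μ) ≤ 1 := Finset.prod_le_one (fun _ _ => hN _) fun μ hμ => by
          rw [Function.update_of_ne (fun h : μ = ν => hν (h ▸ hμ))]; simp only [hbase, hμ, if_true]; exact hτ1 _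
        have h2 : ∏ μ ∈ (insert ν s)ᶜ, N (Function.update base ν r μ) = Pc := Finset.prod_congr rfl fun μ hμ => by
          rw [Function.update_of_ne (fun h : μ = ν => hνc (h ▸ hμ))]
          have : μ ∉ s := fun h => by simp [h] at hμ
          simp [hbase, this]
        rw [h2]; exact mul_le_of_le_one_left hPc0 h1
      have hS : (fun i => ∑ μ ∈ insert ν s with dg μ = i, L * |eval x (lf μ)|) =
          Function.update (fun i => ∑ μ ∈ s with dg μ = i, L * |eval x (lf μ)|) g ((∑ μ ∈ s with dg μ = g, L * |eval x (lf μ)|) + s0) := by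
        funext i
        by_cases h : i = g
        · subst h
          rw [Function.update_self, Finset.filter_insert, if_pos rfl, Finset.sum_insert (by simp [hν]), add_comm]
        · rw [Function.update_of_ne h, Finset.filter_insert, if_neg (fun h' => h h'.symm)]
      rw [e1, e3, hS]
      refine le_trans ?_ (mul_le_mul_of_nonneg_right (ER_rec d g (hdg ν) _ (fun i => Finset.sum_nonneg fun _ _ => by positivity)
        (fun i hi => ?_) T hT s0 (by positivity)) hPc0)
      · have e4 : eval x (∑ j ∈ Finset.range (T g), C ((-1) ^ j / (j.factorial : ℝ)) * (lf ν ^ j * Q j)) =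
            ∑ j ∈ Finset.range (T g), ((-v) ^ j / (j.factorial : ℝ)) * eval x (Q j) := by
          rw [map_sum]
          refine Finset.sum_congr rfl fun j _ => ?_
          simp only [map_mul, map_pow, eval_C, ← hv]
          rw [neg_pow v]; ring
        rw [e4, add_sub_assoc, ← Finset.sum_sub_distrib, add_mul, Finset.sum_mul]
        refine (abs_add_le _ _).trans (add_le_add hr' ((Finset.abs_sum_le_sum_abs _ _).trans (Finset.sum_le_sum fun j hj => ?_)))
        rw [← mul_sub, abs_mul]
        have h1 := (hQ j hj).2.2 x
        rw [e2] at h1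
        have hER : 0 ≤ ER d (fun i => ∑ ν ∈ s with dg ν = i, L * |eval x (lf ν)|) (Function.update T g (T g - j)) :=
          Finset.sum_nonneg fun i _ => mul_nonneg (div_nonneg (pow_nonneg (Finset.sum_nonneg fun _ _ => by positivity) _) (by positivity))
            (Finset.prod_nonneg fun l _ => zero_le_one.trans (eT_one_le (hTj j hj l) (Finset.sum_nonneg fun _ _ => by positivity)))
        calc _ ≤ |(-v) ^ j / (j.factorial : ℝ)| * (ER d (fun i => ∑ ν ∈ s with dg ν = i, L * |eval x (lf ν)|) (Function.update T g (T g - j)) * (L ^ j * Pc)) := by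
              refine mul_le_mul_of_nonneg_left (h1.trans ?_) (abs_nonneg _)
              gcongr; exact ha j
          _ = _ := by rw [abs_div, abs_pow, abs_neg, Nat.abs_cast, hs0, mul_pow]; ring
      · refine Finset.sum_eq_zero fun μ hμ => ?_
        have := Finset.mem_filter.1 hμ
        have := hmax μ this.1
        omega

end FF

section FF2
open MvPolynomial

def L1S : Submodule ℝ (ℝ → ℝ) where
  carrier := {f | Integrable f volume}
  add_mem' h h' := h.add h'
  zero_mem' := integrable_zero _ _ _
  smul_mem' c _ h := h.smul c

lemma updprod {V : Type} [Fintype V] [DecidableEq V] (c : V → L1S) (u : V → ℝ) (ν : V) (z : L1S) :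
    ∏ μ, (Function.update c ν z μ).1 (u μ) = z.1 (u ν) * ∏ μ ∈ ({ν} : Finset V)ᶜ, (c μ).1 (u μ) := by
  rw [Fintype.prod_eq_mul_prod_compl ν, Function.update_self]
  congr 1
  refine Finset.prod_congr rfl fun μ hμ => ?_
  rw [Function.update_of_ne (by simpa using hμ)]

noncomputable def PhiL {V : Type} [Fintype V] (f : (V → ℝ) → ℝ) (hf : Measurable f)
    (h1 : ∀ u, |f u| ≤ 1) : MultilinearMap ℝ (fun _ : V => L1S) ℝ where
  toFun c := ∫ u : V → ℝ, f u * ∏ ν, (c ν).1 (u ν)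
  map_update_add' := by
    intro _ c ν x y
    have hi : ∀ c : V → L1S, Integrable (fun u : V → ℝ => f u * ∏ ν, (c ν).1 (u ν)) volume := fun c =>
      (Integrable.fintype_prod (fun ν => (c ν).2)).bdd_mul hf.aestronglyMeasurable (c := 1) (Filter.Eventually.of_forall h1)
    rw [← integral_add (hi _) (hi _)]
    congr 1; funext u
    simp only [updprod, Submodule.coe_add, Pi.add_apply]; ring
  map_update_smul' := by
    intro _ c ν a x
    rw [smul_eq_mul, ← integral_const_mul]
    congr 1; funext u
    simp only [updprod, SetLike.val_smul, Pi.smul_apply, smul_eq_mul]; ring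

lemma PhiL_le {V : Type} [Fintype V] (f : (V → ℝ) → ℝ) (hf : Measurable f)
    (h1 : ∀ u, |f u| ≤ 1) (c : V → L1S) : |PhiL f hf h1 c| ≤ ∏ ν, ∫ u, |(c ν).1 u| := by
  rw [← integral_fintype_prod_volume_eq_prod (fun ν u => |(c ν).1 u|)]
  refine (abs_integral_le_integral_abs).trans ?_
  refine integral_mono_of_nonneg (Filter.Eventually.of_forall fun _ => abs_nonneg _)
    (Integrable.fintype_prod (fun ν => (c ν).2.abs)) (Filter.Eventually.of_forall fun u => ?_)
  simp only [abs_mul, Finset.abs_prod]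
  exact mul_le_of_le_one_left (Finset.prod_nonneg fun _ _ => abs_nonneg _) (h1 u)

noncomputable def nz (ψ : ℕ → ℝ → ℝ) : Measure ℝ := volume.withDensity fun x => ENNReal.ofReal (ψ 0 x)

variable {ψ : ℕ → ℝ → ℝ} {L : ℝ}

lemma nz_int (m : Moll ψ L) (g : ℝ → ℝ) : ∫ z, g z ∂nz ψ = ∫ z, ψ 0 z * g z := by
  rw [nz, integral_withDensity_eq_integral_toReal_smul (m.cont 0).measurable.ennreal_ofReal (by simp)]
  simp [ENNReal.toReal_ofReal (m.nn _)]

lemma nz_integrable (m : Moll ψ L) (g : ℝ → ℝ) : Integrable g (nz ψ) ↔ Integrable (fun z => ψ 0 z * g z) := by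
  rw [nz, integrable_withDensity_iff_integrable_smul' (m.cont 0).measurable.ennreal_ofReal (by simp)]
  simp [ENNReal.toReal_ofReal (m.nn _)]

lemma nz_prob (m : Moll ψ L) : IsProbabilityMeasure (nz ψ) := ⟨by
  rw [nz, withDensity_apply _ MeasurableSet.univ, Measure.restrict_univ, ← ofReal_integral_eq_lintegral_ofReal (m.int 0)
    (Filter.Eventually.of_forall m.nn), m.one, ENNReal.ofReal_one]⟩

lemma nzpi (m : Moll ψ L) (V : Type) [Fintype V] : Measure.pi (fun _ : V => nz ψ) =
    volume.withDensity fun u : V → ℝ => ENNReal.ofReal (∏ ν, ψ 0 (u ν)) := by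
  have := nz_prob m
  refine Measure.pi_eq fun s hs => ?_
  rw [withDensity_apply _ (MeasurableSet.univ_pi hs), ← lintegral_indicator (MeasurableSet.univ_pi hs)]
  have e : ∀ u : V → ℝ, (Set.univ.pi s).indicator (fun u : V → ℝ => ENNReal.ofReal (∏ ν, ψ 0 (u ν))) u =
      ENNReal.ofReal (∏ ν, (s ν).indicator (ψ 0) (u ν)) := by
    intro u
    by_cases hu : u ∈ Set.univ.pi s
    · rw [Set.indicator_of_mem hu]
      congr 1
      exact Finset.prod_congr rfl fun ν _ => by rw [Set.indicator_of_mem (hu ν trivial)]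
    · rw [Set.indicator_of_notMem hu]
      simp only [Set.mem_pi, Set.mem_univ, true_imp_iff, not_forall] at hu
      obtain ⟨ν, hν⟩ := hu
      rw [Finset.prod_eq_zero (Finset.mem_univ ν) (Set.indicator_of_notMem hν _), ENNReal.ofReal_zero]
  have hn : ∀ ν x, 0 ≤ (s ν).indicator (ψ 0) x := fun ν x => Set.indicator_nonneg (fun x _ => m.nn x) x
  rw [lintegral_congr e, ← ofReal_integral_eq_lintegral_ofReal (μ := volume) (f := fun a : V → ℝ => ∏ ν, (s ν).indicator (ψ 0) (a ν)) (Integrable.fintype_prod fun ν => (m.int 0).indicator (hs ν))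
    (Filter.Eventually.of_forall fun u => Finset.prod_nonneg fun ν _ => hn ν _),
    integral_fintype_prod_volume_eq_prod (fun ν => (s ν).indicator (ψ 0)),
    ENNReal.ofReal_prod_of_nonneg fun ν _ => integral_nonneg (hn ν)]
  refine Finset.prod_congr rfl fun ν _ => ?_
  rw [integral_indicator (hs ν), nz, withDensity_apply _ (hs ν),
    ofReal_integral_eq_lintegral_ofReal (m.int 0).integrableOn (Filter.Eventually.of_forall m.nn)]

lemma taylor_noise {ι V : Type} [Fintype ι] [DecidableEq ι] [Fintype V] [DecidableEq V] (m : Moll ψ L) (d : ℕ) (f : (V → ℝ) → ℝ) (hf : Measurable f)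
    (h1 : ∀ u, |f u| ≤ 1)
    (dg : V → ℕ) (hdg : ∀ ν, dg ν ≤ d) (lf : V → MvPolynomial ι ℝ) (hdeg : ∀ ν, (lf ν).totalDegree ≤ dg ν)
    (K : ℝ) (hK : 1 ≤ K) (hl1 : ∀ ν, L * l1 (lf ν) ≤ K) (T : ℕ → ℕ) (hT : ∀ i, 1 ≤ T i) :
    ∃ Q : MvPolynomial ι ℝ, Q.totalDegree ≤ ∑ i ∈ Finset.range (d + 1), i * T i ∧
      l1 Q ≤ 3 ^ Fintype.card V * K ^ (∑ i ∈ Finset.range (d + 1), T i) ∧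
      ∀ x, |∫ z, f (fun ν => eval x (lf ν) + z ν) ∂(Measure.pi fun _ : V => nz ψ) - eval x Q| ≤
        ER d (fun i => ∑ ν with dg ν = i, L * |eval x (lf ν)|) T := by
  have hs : ∀ v, Integrable (fun u => ψ 0 (u - v)) := fun v => (m.int 0).comp_sub_right v
  obtain ⟨Q, h1', h2, h3⟩ := taylor_multi (E := L1S) d (PhiL f hf h1) (fun c => ∫ u, |c.1 u|) (fun _ => integral_nonneg fun _ => abs_nonneg _)
    (PhiL_le f hf h1) L (zero_le_one.trans m.hL) (fun k => ⟨ψ k, m.int k⟩) m.l1 (fun v => ⟨fun u => ψ 0 (u - v), hs v⟩)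
    (fun v => by
      simp only [abs_of_nonneg (m.nn _)]
      rw [integral_sub_right_eq_self (ψ 0), m.one])
    (fun v T => by
      convert taylor_l1 m T v using 4
      simp) dg hdg lf hdeg K hK hl1 Finset.univ T hT (fun _ => 0)
  refine ⟨Q, h1', by simpa using h2, fun x => ?_⟩
  have h := h3 x
  simp only [Finset.mem_univ, if_true, Finset.compl_univ, Finset.prod_empty, mul_one] at h
  convert h using 3
  rw [nzpi m, integral_withDensity_eq_integral_toReal_smul (by
    refine (Continuous.measurable ?_).ennreal_ofReal
    exact continuous_finsetProd _ fun ν _ => (m.cont 0).comp (continuous_apply ν)) (by simp)]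
  refine Eq.trans ?_ (integral_add_right_eq_self (μ := volume) (fun u : V → ℝ => f u * ∏ ν, ψ 0 (u ν - eval x (lf ν))) (fun ν => eval x (lf ν)))
  congr 1; funext z
  rw [ENNReal.toReal_ofReal (Finset.prod_nonneg fun ν _ => m.nn _), smul_eq_mul, mul_comm]
  simp [Pi.add_def, add_comm]

end FF2

section FG
set_option linter.unusedSectionVars false
open MvPolynomial

def NM {Ω : Type} [MeasurableSpace Ω] (θ : Measure Ω) (H : Ω → ℝ) (p v : ℝ) : Prop :=
  Measurable H ∧ Integrable (fun z => H z ^ 2) θ ∧ ∫ z, H z ∂θ = p ∧ ∫ z, H z ^ 2 ∂θ = p ^ 2 + v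

lemma NM.int {Ω : Type} [MeasurableSpace Ω] {θ : Measure Ω} [IsProbabilityMeasure θ] {H : Ω → ℝ} {p v : ℝ} (h : NM θ H p v) : Integrable H θ :=
  ((memLp_two_iff_integrable_sq h.1.aestronglyMeasurable).2 h.2.1).integrable one_le_two

section
variable {Ω₁ Ω₂ : Type} [MeasurableSpace Ω₁] [MeasurableSpace Ω₂] {θ₁ : Measure Ω₁} {θ₂ : Measure Ω₂}
  [IsProbabilityMeasure θ₁] [IsProbabilityMeasure θ₂]

lemma NM.mul {H₁ : Ω₁ → ℝ} {H₂ : Ω₂ → ℝ} {p₁ v₁ p₂ v₂ : ℝ} (h₁ : NM θ₁ H₁ p₁ v₁) (h₂ : NM θ₂ H₂ p₂ v₂) :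
    NM (θ₁.prod θ₂) (fun z => H₁ z.1 * H₂ z.2) (p₁ * p₂) (v₁ * v₂ + v₁ * p₂ ^ 2 + p₁ ^ 2 * v₂) := by
  refine ⟨(h₁.1.comp measurable_fst).mul (h₂.1.comp measurable_snd), ?_, ?_, ?_⟩
  · simp only [mul_pow]; exact h₁.2.1.mul_prod h₂.2.1
  · rw [integral_prod_mul H₁ H₂, h₁.2.2.1, h₂.2.2.1]
  · simp only [mul_pow]
    rw [integral_prod_mul (fun z => H₁ z ^ 2) (fun z => H₂ z ^ 2), h₁.2.2.2, h₂.2.2.2]; ring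

lemma NM.add {H₁ : Ω₁ → ℝ} {H₂ : Ω₂ → ℝ} {p₁ v₁ p₂ v₂ : ℝ} (c : ℝ) (h₁ : NM θ₁ H₁ p₁ v₁) (h₂ : NM θ₂ H₂ p₂ v₂) :
    NM (θ₁.prod θ₂) (fun z => H₁ z.1 + c * H₂ z.2) (p₁ + c * p₂) (v₁ + c ^ 2 * v₂) := by
  have i1 : Integrable (fun z : Ω₁ × Ω₂ => H₁ z.1) (θ₁.prod θ₂) := h₁.int.comp_fst _
  have i2 : Integrable (fun z : Ω₁ × Ω₂ => H₂ z.2) (θ₁.prod θ₂) := h₂.int.comp_snd _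
  have i3 : Integrable (fun z : Ω₁ × Ω₂ => H₁ z.1 ^ 2) (θ₁.prod θ₂) := h₁.2.1.comp_fst _
  have i4 : Integrable (fun z : Ω₁ × Ω₂ => H₂ z.2 ^ 2) (θ₁.prod θ₂) := h₂.2.1.comp_snd _
  have i5 : Integrable (fun z : Ω₁ × Ω₂ => H₁ z.1 * H₂ z.2) (θ₁.prod θ₂) := h₁.int.mul_prod h₂.int
  have e : (fun z : Ω₁ × Ω₂ => (H₁ z.1 + c * H₂ z.2) ^ 2) =
    fun z => H₁ z.1 ^ 2 + (2 * c * (H₁ z.1 * H₂ z.2) + c ^ 2 * H₂ z.2 ^ 2) := by funext z; ring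
  have j1 : ∫ z, H₁ z.1 ∂(θ₁.prod θ₂) = p₁ := by rw [integral_fun_fst H₁]; simp [h₁.2.2.1]
  have j2 : ∫ z, H₂ z.2 ∂(θ₁.prod θ₂) = p₂ := by rw [integral_fun_snd H₂]; simp [h₂.2.2.1]
  have j3 : ∫ z, H₁ z.1 ^ 2 ∂(θ₁.prod θ₂) = p₁ ^ 2 + v₁ := by rw [integral_fun_fst (fun z => H₁ z ^ 2)]; simp [h₁.2.2.2]
  have j4 : ∫ z, H₂ z.2 ^ 2 ∂(θ₁.prod θ₂) = p₂ ^ 2 + v₂ := by rw [integral_fun_snd (fun z => H₂ z ^ 2)]; simp [h₂.2.2.2]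
  have j5 : ∫ z, H₁ z.1 * H₂ z.2 ∂(θ₁.prod θ₂) = p₁ * p₂ := by rw [integral_prod_mul H₁ H₂, h₁.2.2.1, h₂.2.2.1]
  refine ⟨(h₁.1.comp measurable_fst).add ((h₂.1.comp measurable_snd).const_mul c), ?_, ?_, ?_⟩
  · rw [e]; exact i3.add ((i5.const_mul _).add (i4.const_mul _))
  · rw [integral_add i1 (i2.const_mul c), integral_const_mul, j1, j2]
  · rw [e, (integral_add i3 ((i5.const_mul (2 * c)).add (i4.const_mul (c ^ 2))) : ∫ z, (H₁ z.1 ^ 2 + (2 * c * (H₁ z.1 * H₂ z.2) + c ^ 2 * H₂ z.2 ^ 2)) ∂(θ₁.prod θ₂) = _ + ∫ z, (2 * c * (H₁ z.1 * H₂ z.2) + c ^ 2 * H₂ z.2 ^ 2) ∂(θ₁.prod θ₂)), integral_add (i5.const_mul _) (i4.const_mul _),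
      integral_const_mul, integral_const_mul, j3, j4, j5]; ring

lemma NM.comp {Ω : Type} [MeasurableSpace Ω] {θ : Measure Ω} {H : Ω → ℝ} {p v : ℝ} (h : NM θ H p v) {g : Ω₁ → Ω}
    (hg : MeasurePreserving g θ₁ θ) : NM θ₁ (fun z => H (g z)) p v := by
  have e : ∀ F : Ω → ℝ, Measurable F → ∫ z, F (g z) ∂θ₁ = ∫ z, F z ∂θ := fun F hF => by
    rw [← hg.map_eq, integral_map hg.measurable.aemeasurable hF.aestronglyMeasurable]
  exact ⟨h.1.comp hg.measurable, hg.integrable_comp_of_integrable h.2.1, by rw [e _ h.1, h.2.2.1], by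
    rw [e _ (h.1.pow_const 2), h.2.2.2]⟩
end

noncomputable def s2 (ψ : ℕ → ℝ → ℝ) : ℝ := ∫ z, z ^ 2 ∂nz ψ

variable {ψ : ℕ → ℝ → ℝ} {L : ℝ}

lemma NM_leaf (m : Moll ψ L) (ρ a : ℝ) (hρ : ρ ≠ 0) :
    NM (Measure.pi fun _ : Unit => nz ψ) (fun z => ρ * (ρ⁻¹ * a + z ())) a (ρ ^ 2 * s2 ψ) := by
  have := nz_prob m
  have i2 : Integrable (fun z : ℝ => z ^ 2) (nz ψ) := (nz_integrable m _).2 (by simpa [mul_comm] using m.sq)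
  have i1 : Integrable (fun z : ℝ => z) (nz ψ) :=
    ((memLp_two_iff_integrable_sq measurable_id.aestronglyMeasurable).2 i2).integrable one_le_two
  have z0 : ∫ z, z ∂nz ψ = 0 := by
    have h := nz_int m fun z => z
    have h2 : ∫ z, ψ 0 z * z = ∫ z, ψ 0 (-z) * (-z) := (integral_neg_eq_self (fun z => ψ 0 z * z) volume).symm
    simp only [m.ev, mul_neg, integral_neg] at h2
    linarith
  have key : NM (nz ψ) (fun z => ρ * (ρ⁻¹ * a + z)) a (ρ ^ 2 * s2 ψ) := by
    have e0 : (fun z : ℝ => ρ * (ρ⁻¹ * a + z)) = fun z => a + ρ * z := by funext z; field_simp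
    rw [e0]
    have e : (fun z : ℝ => (a + ρ * z) ^ 2) = fun z => a ^ 2 + (2 * a * ρ * z + ρ ^ 2 * z ^ 2) := by funext z; ring
    refine ⟨by fun_prop, ?_, ?_, ?_⟩
    · rw [e]; exact (integrable_const _).add ((i1.const_mul _).add (i2.const_mul _))
    · rw [integral_add (integrable_const _) (i1.const_mul _), integral_const_mul, z0]; simp
    · rw [e, (integral_add (integrable_const _) ((i1.const_mul (2 * a * ρ)).add (i2.const_mul (ρ ^ 2))) : ∫ z, (a ^ 2 + (2 * a * ρ * z + ρ ^ 2 * z ^ 2)) ∂nz ψ = _ + ∫ z, (2 * a * ρ * z + ρ ^ 2 * z ^ 2) ∂nz ψ), integral_add (i1.const_mul _) (i2.const_mul _),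
        integral_const_mul, integral_const_mul, z0]; simp [s2]
  exact key.comp (measurePreserving_eval (fun _ : Unit => nz ψ) ())

variable {ι : Type} [Fintype ι] [DecidableEq ι]

structure RepS (ψ : ℕ → ℝ → ℝ) (ρ : ℝ) (M : ℕ → ℕ) (P e : MvPolynomial ι ℝ) (V : Type) [Fintype V] (dg : V → ℕ) (lc : V → Finset ι → ℝ)
    (h : (V → ℝ) → ℝ) : Prop where
  one : ∀ ν, 1 ≤ dg ν
  hom : ∀ ν S, lc ν S ≠ 0 → S.card = dg ν
  nrm : ∀ ν, ∑ S, lc ν S ^ 2 ≤ 1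
  reg : ∀ ν, Reg (dg ν) (M (dg ν)) (lc ν)
  meas : Measurable h
  nm : ∀ x, NM (Measure.pi fun _ : V => nz ψ) (fun z => h fun ν => ρ⁻¹ * eval x (mp (lc ν)) + z ν) (eval x P) (eval x e)
  pos : ∀ x, 0 ≤ eval x e

variable {ρ : ℝ} {M : ℕ → ℕ} {P₁ e₁ P₂ e₂ : MvPolynomial ι ℝ} {V₁ V₂ : Type} [Fintype V₁] [Fintype V₂]
  {dg₁ : V₁ → ℕ} {dg₂ : V₂ → ℕ} {lc₁ : V₁ → Finset ι → ℝ} {lc₂ : V₂ → Finset ι → ℝ} {h₁ : (V₁ → ℝ) → ℝ} {h₂ : (V₂ → ℝ) → ℝ}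

lemma RepS.add (m : Moll ψ L) (c : ℝ) (r₁ : RepS ψ ρ M P₁ e₁ V₁ dg₁ lc₁ h₁) (r₂ : RepS ψ ρ M P₂ e₂ V₂ dg₂ lc₂ h₂) :
    RepS ψ ρ M (P₁ + C c * P₂) (e₁ + C (c ^ 2) * e₂) (V₁ ⊕ V₂) (Sum.elim dg₁ dg₂) (Sum.elim lc₁ lc₂)
      (fun u => h₁ (fun ν => u (.inl ν)) + c * h₂ (fun ν => u (.inr ν))) where
  one := by rintro (ν | ν); exacts [r₁.one ν, r₂.one ν]
  hom := by rintro (ν | ν); exacts [r₁.hom ν, r₂.hom ν]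
  nrm := by rintro (ν | ν); exacts [r₁.nrm ν, r₂.nrm ν]
  reg := by rintro (ν | ν); exacts [r₁.reg ν, r₂.reg ν]
  meas := (r₁.meas.comp (by fun_prop)).add ((r₂.meas.comp (by fun_prop)).const_mul c)
  nm x := by
    have := nz_prob m
    have := ((r₁.nm x).add c (r₂.nm x)).comp (measurePreserving_sumPiEquivProdPi (fun _ : V₁ ⊕ V₂ => nz ψ))
    simpa [MeasurableEquiv.sumPiEquivProdPi, Equiv.sumPiEquivProdPi] using this
  pos x := by
    simp only [map_add, map_mul, eval_C]
    have := r₁.pos x; have := r₂.pos x; positivity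

lemma RepS.mul (m : Moll ψ L) (r₁ : RepS ψ ρ M P₁ e₁ V₁ dg₁ lc₁ h₁) (r₂ : RepS ψ ρ M P₂ e₂ V₂ dg₂ lc₂ h₂) :
    RepS ψ ρ M (P₁ * P₂) (e₁ * e₂ + e₁ * P₂ ^ 2 + P₁ ^ 2 * e₂) (V₁ ⊕ V₂) (Sum.elim dg₁ dg₂) (Sum.elim lc₁ lc₂)
      (fun u => h₁ (fun ν => u (.inl ν)) * h₂ (fun ν => u (.inr ν))) where
  one := by rintro (ν | ν); exacts [r₁.one ν, r₂.one ν]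
  hom := by rintro (ν | ν); exacts [r₁.hom ν, r₂.hom ν]
  nrm := by rintro (ν | ν); exacts [r₁.nrm ν, r₂.nrm ν]
  reg := by rintro (ν | ν); exacts [r₁.reg ν, r₂.reg ν]
  meas := (r₁.meas.comp (by fun_prop)).mul (r₂.meas.comp (by fun_prop))
  nm x := by
    have := nz_prob m
    have := ((r₁.nm x).mul (r₂.nm x)).comp (measurePreserving_sumPiEquivProdPi (fun _ : V₁ ⊕ V₂ => nz ψ))
    simpa [MeasurableEquiv.sumPiEquivProdPi, Equiv.sumPiEquivProdPi] using this
  pos x := by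
    simp only [map_add, map_mul, map_pow]
    have := r₁.pos x; have := r₂.pos x; positivity

lemma s2_nonneg (ψ : ℕ → ℝ → ℝ) : 0 ≤ s2 ψ := integral_nonneg fun _ => sq_nonneg _

lemma RepS.leaf (m : Moll ψ L) (hρ : ρ ≠ 0) (i : ℕ) (hi : 1 ≤ i) (f : Finset ι → ℝ) (h0 : ∀ S, f S ≠ 0 → S.card = i) (h1 : ∑ S, f S ^ 2 ≤ 1)
    (hr : Reg i (M i) f) : RepS ψ ρ M (mp f) (C (ρ ^ 2 * s2 ψ)) Unit (fun _ => i) (fun _ => f) (fun u => ρ * u ()) where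
  one _ := hi
  hom _ := h0
  nrm _ := h1
  reg _ := hr
  meas := by fun_prop
  nm x := by simpa using NM_leaf m ρ (eval x (mp f)) hρ
  pos x := by rw [eval_C]; have := s2_nonneg ψ; positivity

end FG

section FG2
set_option linter.unusedSectionVars false
open MvPolynomial

variable {ι : Type} [Fintype ι] [DecidableEq ι]

lemma gE_indep {A B : Set ι} (hAB : Disjoint A B) {p q : MvPolynomial ι ℝ} (hp : p ∈ supported ℝ A) (hq : q ∈ supported ℝ B) :
    gE (p * q) = gE p * gE q := by
  conv_lhs => rw [p.as_sum, q.as_sum, Finset.sum_mul_sum]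
  conv_rhs => rw [p.as_sum, q.as_sum, gE_sum, gE_sum, Finset.sum_mul_sum]
  rw [gE_sum]
  refine Finset.sum_congr rfl fun m hm => ?_
  rw [gE_sum]
  refine Finset.sum_congr rfl fun m' hm' => ?_
  rw [monomial_mul, gE_monomial, gE_monomial, gE_monomial, mul_mul_mul_comm, ← Finset.prod_mul_distrib]
  congr 1
  refine Finset.prod_congr rfl fun i _ => ?_
  have h0 : m i = 0 ∨ m' i = 0 := by
    by_contra hc
    push Not at hc
    have h1 : i ∈ A := mem_supported.1 hp ((mem_vars_iff_mem_support i).2 ⟨m, hm, by simpa using hc.1⟩)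
    have h2 : i ∈ B := mem_supported.1 hq ((mem_vars_iff_mem_support i).2 ⟨m', hm', by simpa using hc.2⟩)
    exact Set.disjoint_left.1 hAB h1 h2
  rcases h0 with h0 | h0 <;> simp [h0]

lemma mp_supported (A : Finset ι) (f : Finset ι → ℝ) (h : ∀ S, f S ≠ 0 → S ⊆ A) : mp f ∈ supported ℝ (A : Set ι) := by
  refine Subalgebra.sum_mem _ fun S _ => ?_
  by_cases hS : f S = 0
  · rw [hS, C_0, zero_mul]; exact Subalgebra.zero_mem _
  · exact Subalgebra.mul_mem _ (Subalgebra.algebraMap_mem _ _) (Subalgebra.prod_mem _ fun i hi => X_mem_supported.2 (h S hS hi))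

lemma prodX (S : Finset ι) : (∏ i ∈ S, X i : MvPolynomial ι ℝ) = monomial (∑ i ∈ S, Finsupp.single i 1) 1 := by
  rw [monomial_sum_one]; rfl

lemma mp_degree (i : ℕ) (f : Finset ι → ℝ) (h : ∀ S, f S ≠ 0 → S.card ≤ i) : (mp f).totalDegree ≤ i := by
  refine totalDegree_finsetSum_le fun S _ => ?_
  by_cases hS : f S = 0
  · simp [hS]
  · refine (totalDegree_mul _ _).trans ?_
    rw [totalDegree_C, zero_add]
    refine (totalDegree_finsetProd _ _).trans ?_
    simpa using h S hS

lemma mp_l1 (i : ℕ) (f : Finset ι → ℝ) (h : ∀ S, f S ≠ 0 → S.card = i) (h1 : ∑ S, f S ^ 2 ≤ 1) :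
    l1 (mp f) ≤ (Fintype.card ι : ℝ) ^ i := by
  have hb : ∀ S, |f S| ≤ 1 := fun S => by
    rw [← sq_le_one_iff_abs_le_one]
    exact (Finset.single_le_sum (f := fun S : Finset ι => f S ^ 2) (fun _ _ => sq_nonneg _) (Finset.mem_univ S)).trans h1
  have : l1 (mp f) ≤ ∑ S : Finset ι, if S ∈ Finset.powersetCard i Finset.univ then (1:ℝ) else 0 := by
    refine (l1_sum _ _).trans (Finset.sum_le_sum fun S _ => ?_)
    have e : C (f S) * ∏ i ∈ S, X i = monomial (∑ i ∈ S, Finsupp.single i 1) (f S) := by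
      rw [prodX, C_mul_monomial, mul_one]
    rw [e]
    refine (l1_monomial _ _).trans ?_
    by_cases hS : f S = 0
    · rw [hS, abs_zero]; positivity
    · rw [if_pos (Finset.mem_powersetCard.2 ⟨Finset.subset_univ _, h S hS⟩)]; exact hb S
  refine this.trans ?_
  rw [Finset.sum_ite_mem, Finset.univ_inter, Finset.sum_const, Finset.card_powersetCard, nsmul_eq_mul, mul_one, Finset.card_univ]
  exact_mod_cast Nat.choose_le_pow _ _

def Rp (ψ : ℕ → ℝ → ℝ) (ρ : ℝ) (M : ℕ → ℕ) (A : Finset ι) (P : MvPolynomial ι ℝ) (D : ℕ) (cnt : ℕ → ℝ) (δ : ℝ) : Prop :=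
  ∃ (V : Type) (_ : Fintype V) (dg : V → ℕ) (lc : V → Finset ι → ℝ) (h : (V → ℝ) → ℝ) (e : MvPolynomial ι ℝ),
    RepS ψ ρ M P e V dg lc h ∧ e ∈ supported ℝ (A : Set ι) ∧ e.totalDegree ≤ 2 * D ∧
    l1 e + (Fintype.card ι : ℝ) ^ (2 * D) ≤ (Fintype.card ι : ℝ) ^ (2 * D) * 2 ^ Fintype.card V ∧ gE e ≤ δ ∧
    ∀ l, ∑ ν, (if dg ν = l then (1:ℝ) else 0) ≤ cnt l

variable {ψ : ℕ → ℝ → ℝ} {L ρ : ℝ} {M : ℕ → ℕ}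

lemma Rp.leaf [Nonempty ι] (m : Moll ψ L) (hρ : ρ ≠ 0) (hr1 : ρ ^ 2 * s2 ψ ≤ 1) (A : Finset ι) (i : ℕ) (hi : 1 ≤ i) (f : Finset ι → ℝ)
    (h0 : ∀ S, f S ≠ 0 → S.card = i) (h1 : ∑ S, f S ^ 2 ≤ 1) (hr : Reg i (M i) f) :
    Rp ψ ρ M A (mp f) i (fun l => if l = i then 1 else 0) (ρ ^ 2 * s2 ψ) := by
  have hn : (1:ℝ) ≤ Fintype.card ι := by exact_mod_cast Fintype.card_pos
  have hs := s2_nonneg ψ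
  refine ⟨Unit, inferInstance, _, _, _, _, RepS.leaf m hρ i hi f h0 h1 hr, Subalgebra.algebraMap_mem _ _, by rw [totalDegree_C]; exact Nat.zero_le _, ?_, (gE_C _).le, ?_⟩
  · have h2 := one_le_pow₀ (n := 2 * i) hn
    have h3 := l1_C (ι := ι) (ρ ^ 2 * s2 ψ)
    rw [abs_of_nonneg (by positivity)] at h3
    rw [Fintype.card_unit, pow_one]; linarith
  · intro l; simp [eq_comm]

lemma Rp.add [Nonempty ι] (m : Moll ψ L) (c : ℝ) (hc : c ^ 2 ≤ 1) {A A₁ A₂ : Finset ι} (hA₁ : A₁ ⊆ A) (hA₂ : A₂ ⊆ A) {P₁ P₂ : MvPolynomial ι ℝ}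
    {D D₁ D₂ : ℕ} (hD₁ : D₁ ≤ D) (hD₂ : D₂ ≤ D) {cnt₁ cnt₂ : ℕ → ℝ} {δ₁ δ₂ : ℝ} (r₁ : Rp ψ ρ M A₁ P₁ D₁ cnt₁ δ₁) (r₂ : Rp ψ ρ M A₂ P₂ D₂ cnt₂ δ₂) :
    Rp ψ ρ M A (P₁ + C c * P₂) D (fun l => cnt₁ l + cnt₂ l) (δ₁ + c ^ 2 * δ₂) := by
  obtain ⟨V₁, _, dg₁, lc₁, h₁, e₁, r₁, s₁, t₁, b₁, g₁, n₁⟩ := r₁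
  obtain ⟨V₂, _, dg₂, lc₂, h₂, e₂, r₂, s₂, t₂, b₂, g₂, n₂⟩ := r₂
  refine ⟨V₁ ⊕ V₂, inferInstance, _, _, _, _, r₁.add m c r₂, ?_, ?_, ?_, ?_, ?_⟩
  · exact Subalgebra.add_mem _ (supported_mono (Finset.coe_subset.2 hA₁) s₁)
      (Subalgebra.mul_mem _ (Subalgebra.algebraMap_mem _ _) (supported_mono (Finset.coe_subset.2 hA₂) s₂))
  · refine (totalDegree_add _ _).trans (max_le (by omega) ((totalDegree_mul _ _).trans ?_))
    rw [totalDegree_C]; omega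
  · have hn : (1:ℝ) ≤ Fintype.card ι := by exact_mod_cast Fintype.card_pos
    set N : ℝ := (Fintype.card ι : ℝ)
    have h1 : l1 (e₁ + C (c ^ 2) * e₂) ≤ l1 e₁ + l1 e₂ := by
      refine (l1_add _ _).trans (add_le_add_right ((l1_mul _ _).trans ?_) _)
      refine mul_le_of_le_one_left (l1_nonneg _) ((l1_C _).trans ?_)
      rwa [abs_of_nonneg (sq_nonneg c)]
    have k1 : (1:ℝ) ≤ 2 ^ Fintype.card V₁ := one_le_pow₀ one_le_two
    have k2 : (1:ℝ) ≤ 2 ^ Fintype.card V₂ := one_le_pow₀ one_le_two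
    rw [Fintype.card_sum, pow_add]
    have m1 : N ^ (2 * D₁) ≤ N ^ (2 * D) := pow_le_pow_right₀ hn (by omega)
    have m2 : N ^ (2 * D₂) ≤ N ^ (2 * D) := pow_le_pow_right₀ hn (by omega)
    have m0 : 0 ≤ N ^ (2 * D) := by positivity
    have q1 : l1 e₁ ≤ N ^ (2 * D) * (2 ^ Fintype.card V₁ - 1) := by
      refine le_trans (by linarith) (mul_le_mul_of_nonneg_right m1 (sub_nonneg.2 k1))
    have q2 : l1 e₂ ≤ N ^ (2 * D) * (2 ^ Fintype.card V₂ - 1) := by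
      refine le_trans (by linarith) (mul_le_mul_of_nonneg_right m2 (sub_nonneg.2 k2))
    have := mul_nonneg m0 (mul_nonneg (sub_nonneg.2 k1) (sub_nonneg.2 k2))
    nlinarith
  · rw [gE_add, gE_smul]
    exact add_le_add g₁ (mul_le_mul_of_nonneg_left g₂ (sq_nonneg c))
  · intro l
    rw [Fintype.sum_sum_type]
    exact add_le_add (n₁ l) (n₂ l)

lemma Rp.mul [Nonempty ι] (m : Moll ψ L) {A₁ A₂ : Finset ι} (hA : Disjoint A₁ A₂) {f₁ f₂ : Finset ι → ℝ}
    {D₁ D₂ : ℕ} {cnt₁ cnt₂ : ℕ → ℝ} {δ₁ δ₂ : ℝ} (r₁ : Rp ψ ρ M A₁ (mp f₁) D₁ cnt₁ δ₁) (r₂ : Rp ψ ρ M A₂ (mp f₂) D₂ cnt₂ δ₂)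
    (hf₁ : ∀ S, f₁ S ≠ 0 → S ⊆ A₁ ∧ S.card = D₁) (hf₂ : ∀ S, f₂ S ≠ 0 → S ⊆ A₂ ∧ S.card = D₂) (hn₁ : ∑ S, f₁ S ^ 2 ≤ 1) (hn₂ : ∑ S, f₂ S ^ 2 ≤ 1) :
    Rp ψ ρ M (A₁ ∪ A₂) (mp f₁ * mp f₂) (D₁ + D₂) (fun l => cnt₁ l + cnt₂ l) ((1 + δ₁) * (1 + δ₂) - 1) := by
  obtain ⟨V₁, _, dg₁, lc₁, h₁, e₁, r₁, s₁, t₁, b₁, g₁, n₁⟩ := r₁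
  obtain ⟨V₂, _, dg₂, lc₂, h₂, e₂, r₂, s₂, t₂, b₂, g₂, n₂⟩ := r₂
  have i1 := mp_supported A₁ f₁ fun S hS => (hf₁ S hS).1
  have i2 := mp_supported A₂ f₂ fun S hS => (hf₂ S hS).1
  have hA' : Disjoint (A₁ : Set ι) A₂ := Finset.disjoint_coe.2 hA
  refine ⟨V₁ ⊕ V₂, inferInstance, _, _, _, _, r₁.mul m r₂, ?_, ?_, ?_, ?_, ?_⟩
  · have u1 := supported_mono (R := ℝ) (Finset.coe_subset.2 (Finset.subset_union_left : A₁ ⊆ A₁ ∪ A₂))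
    have u2 := supported_mono (R := ℝ) (Finset.coe_subset.2 (Finset.subset_union_right : A₂ ⊆ A₁ ∪ A₂))
    exact Subalgebra.add_mem _ (Subalgebra.add_mem _ (Subalgebra.mul_mem _ (u1 s₁) (u2 s₂)) (Subalgebra.mul_mem _ (u1 s₁)
      (Subalgebra.pow_mem _ (u2 i2) 2))) (Subalgebra.mul_mem _ (Subalgebra.pow_mem _ (u1 i1) 2) (u2 s₂))
  · have d1 := (totalDegree_pow (mp f₁) 2).trans (Nat.mul_le_mul_left 2 (mp_degree D₁ f₁ fun S hS => (hf₁ S hS).2.le))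
    have d2 := (totalDegree_pow (mp f₂) 2).trans (Nat.mul_le_mul_left 2 (mp_degree D₂ f₂ fun S hS => (hf₂ S hS).2.le))
    refine (totalDegree_add _ _).trans (max_le ((totalDegree_add _ _).trans (max_le ?_ ?_)) ?_) <;>
      refine (totalDegree_mul _ _).trans ?_ <;> omega
  · set N : ℝ := (Fintype.card ι : ℝ)
    have p1 : l1 (mp f₁ ^ 2) ≤ N ^ (2 * D₁) := by
      refine (l1_pow _ _).trans ?_
      rw [mul_comm 2, pow_mul]
      exact pow_le_pow_left₀ (l1_nonneg _) (mp_l1 D₁ f₁ (fun S hS => (hf₁ S hS).2) hn₁) 2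
    have p2 : l1 (mp f₂ ^ 2) ≤ N ^ (2 * D₂) := by
      refine (l1_pow _ _).trans ?_
      rw [mul_comm 2, pow_mul]
      exact pow_le_pow_left₀ (l1_nonneg _) (mp_l1 D₂ f₂ (fun S hS => (hf₂ S hS).2) hn₂) 2
    rw [Fintype.card_sum, pow_add, mul_add, pow_add]
    have q : l1 (e₁ * e₂ + e₁ * mp f₂ ^ 2 + mp f₁ ^ 2 * e₂) ≤ l1 e₁ * l1 e₂ + l1 e₁ * N ^ (2 * D₂) + N ^ (2 * D₁) * l1 e₂ := by
      refine (l1_add _ _).trans (add_le_add ((l1_add _ _).trans (add_le_add (l1_mul _ _) ((l1_mul _ _).trans ?_))) ((l1_mul _ _).trans ?_))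
      · exact mul_le_mul_of_nonneg_left p2 (l1_nonneg _)
      · exact mul_le_mul_of_nonneg_right p1 (l1_nonneg _)
    have := mul_le_mul b₁ b₂ (by have := l1_nonneg e₂; positivity) (by positivity)
    nlinarith
  · have q1 := gE_nonneg r₁.pos
    have q2 := gE_nonneg r₂.pos
    have c1 := gE_mp_sq f₁
    have c2 := gE_mp_sq f₂
    rw [gE_add, gE_add, gE_indep hA' s₁ s₂, gE_indep hA' s₁ (Subalgebra.pow_mem _ i2 2), gE_indep hA' (Subalgebra.pow_mem _ i1 2) s₂, c1, c2]
    have := mul_le_mul g₁ g₂ q2 (q1.trans g₁)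
    have := mul_le_mul_of_nonneg_left hn₂ q1
    have := mul_le_mul_of_nonneg_right hn₁ q2
    nlinarith
  · intro l
    rw [Fintype.sum_sum_type]
    exact add_le_add (n₁ l) (n₂ l)

lemma Rp.mono {A : Finset ι} {P : MvPolynomial ι ℝ} {D : ℕ} {cnt cnt' : ℕ → ℝ} {δ δ' : ℝ} (r : Rp ψ ρ M A P D cnt δ)
    (hc : ∀ l, cnt l ≤ cnt' l) (hδ : δ ≤ δ') : Rp ψ ρ M A P D cnt' δ' := by
  obtain ⟨V₁, _, dg₁, lc₁, h₁, e₁, r₁, s₁, t₁, b₁, g₁, n₁⟩ := r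
  exact ⟨V₁, _, dg₁, lc₁, h₁, e₁, r₁, s₁, t₁, b₁, g₁.trans hδ, fun l => (n₁ l).trans (hc l)⟩

lemma iusd (U D : Finset ι) : U ∩ D ∪ U \ D = U := by
  ext x; simp only [Finset.mem_union, Finset.mem_inter, Finset.mem_sdiff]; tauto

lemma sum_cut {E : Type*} [AddCommGroup E] [Module ℝ E] (D : Finset ι) (Q R : Finset ι → ℝ) (hQ : ∀ S, Q S ≠ 0 → S ⊆ D)
    (hR : ∀ S, R S ≠ 0 → Disjoint S D) (G : Finset ι → E) :
    ∑ S, ∑ T, (Q S * R T) • G (S ∪ T) = ∑ U, (Q (U ∩ D) * R (U \ D)) • G U := by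
  rw [← Finset.sum_product']
  symm
  refine Finset.sum_of_injOn (fun U => (U ∩ D, U \ D)) ?_ (by simp) ?_ ?_
  · intro U _ U' _ h
    simp only [Prod.mk.injEq] at h
    rw [← iusd U D, h.1, h.2, iusd]
  · rintro ⟨S, T⟩ _ hn
    by_contra hc
    have h1 : Q S ≠ 0 := fun h => hc (by simp [h])
    have h2 : R T ≠ 0 := fun h => hc (by simp [h])
    refine hn ⟨S ∪ T, by simp, ?_⟩
    have := hQ S h1
    have h4 := hR T h2
    simp only [Prod.mk.injEq]
    constructor
    · rw [Finset.union_inter_distrib_right, Finset.inter_eq_left.2 this, Finset.disjoint_iff_inter_eq_empty.1 h4, Finset.union_empty]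
    · rw [Finset.union_sdiff_distrib, Finset.sdiff_eq_empty_iff_subset.2 this, Finset.empty_union, Finset.sdiff_eq_self_of_disjoint h4]
  · intro U _
    simp [iusd]

end FG2

section FG3
set_option linter.unusedSectionVars false
open MvPolynomial

variable {ι : Type} [Fintype ι] [DecidableEq ι]

lemma mp_mul (D : Finset ι) (Q R : Finset ι → ℝ) (hQ : ∀ S, Q S ≠ 0 → S ⊆ D) (hR : ∀ S, R S ≠ 0 → Disjoint S D) :
    mp Q * mp R = mp fun U => Q (U ∩ D) * R (U \ D) := by
  have h := sum_cut D Q R hQ hR (fun U => (∏ i ∈ U, X i : MvPolynomial ι ℝ))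
  simp only [MvPolynomial.smul_eq_C_mul] at h
  rw [mp, mp, mp, ← h, Finset.sum_mul_sum]
  refine Finset.sum_congr rfl fun S _ => Finset.sum_congr rfl fun T _ => ?_
  by_cases h1 : Q S = 0
  · simp [h1]
  by_cases h2 : R T = 0
  · simp [h2]
  rw [Finset.prod_union ((hR T h2).symm.mono_left (hQ S h1)), C_mul]; ring

lemma irreg (A : Finset ι) (i q : ℕ) (f : Finset ι → ℝ) (hf : ∀ S, f S ≠ 0 → S ⊆ A ∧ S.card = i) (hn : ¬ Reg i q f) :
    ∃ (A₁ A₂ : Finset ι) (Q R f1 : Finset ι → ℝ) (e e' : ℕ) (c : ℝ), 1 ≤ e ∧ 1 ≤ e' ∧ e + e' = i ∧ A₁ ⊆ A ∧ A₂ ⊆ A ∧ Disjoint A₁ A₂ ∧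
      (∀ S, Q S ≠ 0 → S ⊆ A₁ ∧ S.card = e) ∧ (∀ S, R S ≠ 0 → S ⊆ A₂ ∧ S.card = e') ∧ ∑ S, Q S ^ 2 = 1 ∧ ∑ S, R S ^ 2 = 1 ∧
      1 < c ^ 2 * (q : ℝ) ^ (3 * min e e') ∧ (∀ S, f1 S ≠ 0 → S ⊆ A ∧ S.card = i) ∧ ∑ S, f1 S ^ 2 = ∑ S, f S ^ 2 - c ^ 2 ∧
      mp f = mp f1 + C c * (mp Q * mp R) := by
  unfold Reg at hn
  push Not at hn
  obtain ⟨D, Q, R, e, e', he, he', hi, hQ, hR, hlt⟩ := hn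
  set Q1 : Finset ι → ℝ := fun S => if S ⊆ A then Q S else 0 with hQ1
  set R1 : Finset ι → ℝ := fun S => if S ⊆ A then R S else 0 with hR1
  have eb : ∑ S, ∑ T, f (S ∪ T) * Q S * R T = ∑ S, ∑ T, (Q1 S * R1 T) • f (S ∪ T) := by
    refine Finset.sum_congr rfl fun S _ => Finset.sum_congr rfl fun T _ => ?_
    by_cases h0 : f (S ∪ T) = 0
    · simp [h0]
    · have := (hf _ h0).1
      simp only [hQ1, hR1, if_pos (Finset.union_subset_left this), if_pos (Finset.union_subset_right this), smul_eq_mul]; ring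
  have nQ : ∑ S, Q1 S ^ 2 ≤ ∑ S, Q S ^ 2 := Finset.sum_le_sum fun S _ => by
    simp only [hQ1]; split_ifs <;> simp [sq_nonneg]
  have nR : ∑ S, R1 S ^ 2 ≤ ∑ S, R S ^ 2 := Finset.sum_le_sum fun S _ => by
    simp only [hR1]; split_ifs <;> simp [sq_nonneg]
  have pQ0 : 0 ≤ ∑ S, Q1 S ^ 2 := Finset.sum_nonneg fun _ _ => sq_nonneg _
  have pR0 : 0 ≤ ∑ S, R1 S ^ 2 := Finset.sum_nonneg fun _ _ => sq_nonneg _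
  have hQ1D : ∀ S, Q1 S ≠ 0 → S ⊆ A ∩ D ∧ S.card = e := fun S hS => by
    simp only [hQ1] at hS
    split_ifs at hS with h
    · exact ⟨Finset.subset_inter h (hQ S hS).1, (hQ S hS).2⟩
    · exact absurd rfl hS
  have hR1D : ∀ S, R1 S ≠ 0 → S ⊆ A \ D ∧ S.card = e' := fun S hS => by
    simp only [hR1] at hS
    split_ifs at hS with h
    · exact ⟨Finset.subset_sdiff.2 ⟨h, (hR S hS).1⟩, (hR S hS).2⟩
    · exact absurd rfl hS
  set b := ∑ S, ∑ T, (Q1 S * R1 T) • f (S ∪ T) with hb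
  have hlt2 : (∑ S, Q1 S ^ 2) * ∑ S, R1 S ^ 2 < b ^ 2 * (q : ℝ) ^ (3 * min e e') := by
    rw [← eb]; exact (mul_le_mul nQ nR pR0 (pQ0.trans nQ)).trans_lt hlt
  have hb0 : b ≠ 0 := by
    intro h; rw [h] at hlt2
    have := mul_nonneg pQ0 pR0
    norm_num at hlt2; linarith
  have pQ : 0 < ∑ S, Q1 S ^ 2 := by
    refine lt_of_le_of_ne pQ0 fun h => hb0 ?_
    have : ∀ S, Q1 S = 0 := fun S => by
      have := (Finset.sum_eq_zero_iff_of_nonneg (fun _ _ => sq_nonneg _)).1 h.symm S (Finset.mem_univ _)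
      exact pow_eq_zero_iff two_ne_zero |>.1 this
    simp [hb, this]
  have pR : 0 < ∑ S, R1 S ^ 2 := by
    refine lt_of_le_of_ne pR0 fun h => hb0 ?_
    have : ∀ S, R1 S = 0 := fun S => by
      have := (Finset.sum_eq_zero_iff_of_nonneg (fun _ _ => sq_nonneg _)).1 h.symm S (Finset.mem_univ _)
      exact pow_eq_zero_iff two_ne_zero |>.1 this
    simp [hb, this]
  set sQ := √(∑ S, Q1 S ^ 2) with hsQ
  set sR := √(∑ S, R1 S ^ 2) with hsR
  have sQ2 : sQ ^ 2 = ∑ S, Q1 S ^ 2 := Real.sq_sqrt pQ0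
  have sR2 : sR ^ 2 = ∑ S, R1 S ^ 2 := Real.sq_sqrt pR0
  have sQp : 0 < sQ := Real.sqrt_pos.2 pQ
  have sRp : 0 < sR := Real.sqrt_pos.2 pR
  set Q2 : Finset ι → ℝ := fun S => Q1 S / sQ with hQ2
  set R2 : Finset ι → ℝ := fun S => R1 S / sR with hR2
  have hQ2D : ∀ S, Q2 S ≠ 0 → S ⊆ A ∩ D ∧ S.card = e := fun S hS => hQ1D S fun h => hS (by simp [hQ2, h])
  have hR2D : ∀ S, R2 S ≠ 0 → S ⊆ A \ D ∧ S.card = e' := fun S hS => hR1D S fun h => hS (by simp [hR2, h])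
  have hQs : ∀ S, Q2 S ≠ 0 → S ⊆ D := fun S hS => (hQ2D S hS).1.trans Finset.inter_subset_right
  have hRs : ∀ S, R2 S ≠ 0 → Disjoint S D := fun S hS => (Finset.subset_sdiff.1 (hR2D S hS).1).2
  have q1 : ∑ S, Q2 S ^ 2 = 1 := by
    simp only [hQ2, div_pow]; rw [← Finset.sum_div, sQ2]; exact div_self pQ.ne'
  have r1 : ∑ S, R2 S ^ 2 = 1 := by
    simp only [hR2, div_pow]; rw [← Finset.sum_div, sR2]; exact div_self pR.ne'
  set g : Finset ι → ℝ := fun U => Q2 (U ∩ D) * R2 (U \ D) with hg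
  set c := b / (sQ * sR) with hc
  have hcg : ∑ U, g U * f U = c := by
    have h := sum_cut D Q2 R2 hQs hRs f
    simp only [smul_eq_mul] at h
    rw [← h, hc, hb, Finset.sum_div]
    refine Finset.sum_congr rfl fun S _ => ?_
    rw [Finset.sum_div]
    refine Finset.sum_congr rfl fun T _ => ?_
    simp only [hQ2, hR2, smul_eq_mul]; field_simp
  have hg1 : ∑ U, g U ^ 2 = 1 := by
    have h := sum_cut D (fun S => Q2 S ^ 2) (fun S => R2 S ^ 2) (fun S hS => hQs S fun h => hS (by simp [h]))
      (fun S hS => hRs S fun h => hS (by simp [h])) (fun _ => (1:ℝ))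
    simp only [smul_eq_mul, mul_one] at h
    simp only [hg, mul_pow]
    rw [← h, ← Finset.sum_mul_sum, q1, r1, one_mul]
  refine ⟨A ∩ D, A \ D, Q2, R2, fun U => f U - c * g U, e, e', c, he, he', hi, Finset.inter_subset_left, Finset.sdiff_subset,
    (Finset.disjoint_sdiff_inter A D).symm, hQ2D, hR2D, q1, r1, ?_, ?_, ?_, ?_⟩
  · rw [hc, div_pow, mul_pow, sQ2, sR2, div_mul_eq_mul_div, one_lt_div (mul_pos pQ pR)]; exact hlt2
  · intro U hU
    by_cases h0 : f U = 0
    · have h2 : g U ≠ 0 := fun h => hU (by simp [h0, h])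
      have hq := hQ2D _ (left_ne_zero_of_mul h2)
      have hr := hR2D _ (right_ne_zero_of_mul h2)
      constructor
      · rw [← iusd U D]
        exact Finset.union_subset (hq.1.trans Finset.inter_subset_left) (hr.1.trans Finset.sdiff_subset)
      · rw [← iusd U D, Finset.card_union_of_disjoint (Finset.disjoint_sdiff_inter U D).symm, hq.2, hr.2, hi]
    · exact hf U h0
  · have : ∀ U, (f U - c * g U) ^ 2 = f U ^ 2 - 2 * c * (g U * f U) + c ^ 2 * g U ^ 2 := fun U => by ring
    simp only [this]
    rw [Finset.sum_add_distrib, Finset.sum_sub_distrib, ← Finset.mul_sum, ← Finset.mul_sum, hcg, hg1]; ring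
  · rw [mp_mul D Q2 R2 hQs hRs]
    simp only [mp, Finset.mul_sum]
    rw [← Finset.sum_add_distrib]
    refine Finset.sum_congr rfl fun U _ => ?_
    simp only [C_sub, C_mul, hg]; ring

variable {ψ : ℕ → ℝ → ℝ} {L ρ : ℝ} {M : ℕ → ℕ}

noncomputable def NN (W : ℕ → ℕ → ℝ) (i l : ℕ) : ℝ := (if l = i then 1 else 0) + W i l

lemma greedy [Nonempty ι] (m : Moll ψ L) (hρ : ρ ≠ 0) (hr1 : ρ ^ 2 * s2 ψ ≤ 1) (W : ℕ → ℕ → ℝ) (hW0 : ∀ i l, 0 ≤ W i l) (d : ℕ)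
    (hM : ∀ i, 1 ≤ M i) (hW : ∀ e e' l, 1 ≤ e → 1 ≤ e' → e + e' ≤ d →
      (M (e + e') : ℝ) ^ (3 * min e e') * (NN W e l + NN W e' l) ≤ W (e + e') l) :
    ∀ i, 1 ≤ i → i ≤ d → ∀ (A : Finset ι) (f : Finset ι → ℝ), (∀ S, f S ≠ 0 → S ⊆ A ∧ S.card = i) → ∑ S, f S ^ 2 ≤ 1 →
      Rp ψ ρ M A (mp f) i (NN W i) ((1 + ρ ^ 2 * s2 ψ) ^ (2 * i - 1) - 1) := by
  intro i
  induction i using Nat.strong_induction_on with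
  | _ i ih =>
  intro hi hid A
  set r := ρ ^ 2 * s2 ψ with hr
  have hr0 : 0 ≤ r := mul_nonneg (sq_nonneg _) (s2_nonneg ψ)
  have hM1 : (1:ℝ) ≤ M i := by exact_mod_cast hM i
  have hκ : (1:ℝ) ≤ (1 + r) ^ (2 * i - 2) := one_le_pow₀ (by linarith)
  have inner : ∀ j : ℕ, ∀ f : Finset ι → ℝ, (∀ S, f S ≠ 0 → S ⊆ A ∧ S.card = i) → ∑ S, f S ^ 2 ≤ 1 → (∑ S, f S ^ 2) * (M i : ℝ) ^ (3 * i) ≤ j →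
      Rp ψ ρ M A (mp f) i (fun l => (if l = i then 1 else 0) + (∑ S, f S ^ 2) * W i l) (r + (∑ S, f S ^ 2) * ((1 + r) ^ (2 * i - 2) - 1)) := by
    intro j
    induction j with
    | zero =>
      intro f hf h1 hj
      have hs : 0 ≤ ∑ S, f S ^ 2 := Finset.sum_nonneg fun _ _ => sq_nonneg _
      by_cases hreg : Reg i (M i) f
      · exact (Rp.leaf m hρ hr1 A i hi f (fun S hS => (hf S hS).2) h1 hreg).mono
          (fun l => le_add_of_nonneg_right (mul_nonneg hs (hW0 _ _))) (le_add_of_nonneg_right (mul_nonneg hs (by linarith)))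
      · exfalso
        obtain ⟨A₁, A₂, Q, R, f1, e, e', c, he, he', hee, hA1, hA2, hdis, hQ, hR, q1, r1, hc, hf1, hs1, hmp⟩ := irreg A i (M i) f hf hreg
        have hs1' : 0 ≤ ∑ S, f1 S ^ 2 := Finset.sum_nonneg fun _ _ => sq_nonneg _
        have hle : c ^ 2 ≤ ∑ S, f S ^ 2 := by linarith
        have hpw : (M i : ℝ) ^ (3 * min e e') ≤ (M i : ℝ) ^ (3 * i) := pow_le_pow_right₀ hM1 (by omega)
        have := mul_le_mul hle hpw (by positivity) hs
        push_cast at hj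
        linarith
    | succ j ihj =>
      intro f hf h1 hj
      have hs : 0 ≤ ∑ S, f S ^ 2 := Finset.sum_nonneg fun _ _ => sq_nonneg _
      by_cases hreg : Reg i (M i) f
      · exact (Rp.leaf m hρ hr1 A i hi f (fun S hS => (hf S hS).2) h1 hreg).mono
          (fun l => le_add_of_nonneg_right (mul_nonneg hs (hW0 _ _))) (le_add_of_nonneg_right (mul_nonneg hs (by linarith)))
      · obtain ⟨A₁, A₂, Q, R, f1, e, e', c, he, he', hee, hA1, hA2, hdis, hQ, hR, q1, r1, hc, hf1, hs1, hmp⟩ := irreg A i (M i) f hf hreg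
        have hs1' : 0 ≤ ∑ S, f1 S ^ 2 := Finset.sum_nonneg fun _ _ => sq_nonneg _
        have hle : c ^ 2 ≤ ∑ S, f S ^ 2 := by linarith
        have hpw : (M i : ℝ) ^ (3 * min e e') ≤ (M i : ℝ) ^ (3 * i) := pow_le_pow_right₀ hM1 (by omega)
        have hc1 : c ^ 2 * (M i : ℝ) ^ (3 * min e e') ≤ c ^ 2 * (M i : ℝ) ^ (3 * i) := mul_le_mul_of_nonneg_left hpw (sq_nonneg c)
        have k1 := ihj f1 hf1 (by linarith [sq_nonneg c]) (by rw [hs1]; push_cast at hj; linarith)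
        have k2 := ih e (by omega) he (by omega) A₁ Q hQ q1.le
        have k3 := ih e' (by omega) he' (by omega) A₂ R hR r1.le
        have k4 := k2.mul m hdis k3 hQ hR q1.le r1.le
        have k5 := k1.add m c (by linarith) (Finset.Subset.refl A) (Finset.union_subset hA1 hA2) le_rfl hee.le k4
        rw [← hmp] at k5
        refine k5.mono (fun l => ?_) ?_
        · have w := hW e e' l he he' (hee ▸ hid)
          rw [hee] at w
          have hNN : 0 ≤ NN W e l + NN W e' l := by
            have := hW0 e l; have := hW0 e' l; unfold NN; positivity
          have : NN W e l + NN W e' l ≤ c ^ 2 * W i l := by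
            calc NN W e l + NN W e' l ≤ c ^ 2 * (M i : ℝ) ^ (3 * min e e') * (NN W e l + NN W e' l) := le_mul_of_one_le_left hNN hc.le
              _ ≤ _ := by rw [mul_assoc]; exact mul_le_mul_of_nonneg_left w (sq_nonneg c)
          rw [hs1]; linarith
        · have : (1 + ((1 + r) ^ (2 * e - 1) - 1)) * (1 + ((1 + r) ^ (2 * e' - 1) - 1)) = (1 + r) ^ (2 * i - 2) := by
            rw [add_sub_cancel, add_sub_cancel, ← pow_add]; congr 1; omega
          rw [this, hs1]; linarith
  intro f hf h1
  obtain ⟨j, hj⟩ := exists_nat_ge ((∑ S, f S ^ 2) * (M i : ℝ) ^ (3 * i))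
  refine (inner j f hf h1 hj).mono (fun l => ?_) ?_
  · exact add_le_add_right (mul_le_of_le_one_left (hW0 _ _) h1) _
  · have e : (1 + r) ^ (2 * i - 1) = (1 + r) ^ (2 * i - 2) * (1 + r) := by rw [← pow_succ]; congr 1; omega
    rw [e]
    have := mul_le_of_le_one_left (sub_nonneg.2 hκ) h1
    nlinarith

end FG3

section FG4
set_option linter.unusedSectionVars false
open MvPolynomial

def yy (d i : ℕ) : ℕ := 3 * (7 ^ (d - i) - 1)
def xx (d i : ℕ) : ℕ := 6 * 7 ^ (d - i) - 2

lemma xx_yy (d i : ℕ) : xx d i = 2 * yy d i + 4 := by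
  have : 1 ≤ 7 ^ (d - i) := Nat.one_le_pow _ _ (by norm_num)
  unfold xx yy; omega

lemma yy_rec (d i e k : ℕ) (he : 1 ≤ e) (hi : i ≤ d) (hk : k + e ≤ i) : 1 + 3 * e * (xx d i + 1) + yy d i ≤ yy d k := by
  have h1 : 1 ≤ 7 ^ (d - i) := Nat.one_le_pow _ _ (by norm_num)
  have hb : 1 + e * 6 ≤ 7 ^ e := by
    clear he hk
    induction e with
    | zero => simp
    | succ e ih => rw [pow_succ]; omega
  have h2 : 7 ^ (d - i) * 7 ^ e ≤ 7 ^ (d - k) := by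
    rw [← pow_add]; exact Nat.pow_le_pow_right (by norm_num) (by omega)
  have h3 := (Nat.mul_le_mul_left (7 ^ (d - i)) hb).trans h2
  unfold xx yy
  obtain ⟨a, ha⟩ : ∃ a, 7 ^ (d - i) = a + 1 := ⟨7 ^ (d - i) - 1, by omega⟩
  rw [ha] at h3 ⊢
  have e1 : 6 * (a + 1) - 2 + 1 = 6 * a + 5 := by omega
  rw [e1]
  have e2 : 3 * e * (6 * a + 5) = 18 * (e * a) + 15 * e := by ring
  have e3 : (a + 1) * (1 + e * 6) = a + 1 + 6 * (e * a) + 6 * e := by ring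
  rw [e2]; rw [e3] at h3
  omega

lemma one_add_pow_le' (r : ℝ) (h0 : 0 ≤ r) (h1 : r ≤ 1) (n : ℕ) : (1 + r) ^ n ≤ 1 + (2 ^ n - 1) * r := by
  induction n with
  | zero => simp
  | succ n ih =>
    have h2 : (1:ℝ) ≤ 2 ^ n := one_le_pow₀ one_le_two
    rw [pow_succ, pow_succ]
    have := mul_le_mul_of_nonneg_right ih (by linarith : 0 ≤ 1 + r)
    have : 0 ≤ (2 ^ n - 1) * (r * (1 - r)) := by
      have := sub_nonneg.2 h1; have := sub_nonneg.2 h2; positivity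
    nlinarith

variable {ι : Type} [Fintype ι] [DecidableEq ι] {ψ : ℕ → ℝ → ℝ} {L ρ : ℝ}

lemma Rp.const (m : Moll ψ L) (M : ℕ → ℕ) (A : Finset ι) (c : ℝ) : Rp ψ ρ M A (C c) 0 (fun _ => 0) 0 := by
  have := nz_prob m
  refine ⟨Empty, inferInstance, fun _ => 0, fun _ _ => 0, fun _ => c, 0, ⟨by simp, by simp, by simp, by simp, by fun_prop, fun x => ?_, by simp⟩,
    Subalgebra.zero_mem _, by simp, by simp [l1_zero], by simp [gE], by simp⟩
  exact ⟨by fun_prop, integrable_const _, by simp, by simp⟩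

noncomputable def WW (d B i l : ℕ) : ℝ := if l < i then (B : ℝ) ^ yy d l / (B : ℝ) ^ yy d i else 0

lemma WW_nonneg (d B i l : ℕ) : 0 ≤ WW d B i l := by unfold WW; positivity

lemma NN_eq (d B i l : ℕ) (hB : 1 ≤ B) : NN (WW d B) i l = if l ≤ i then (B : ℝ) ^ yy d l / (B : ℝ) ^ yy d i else 0 := by
  have : (0:ℝ) < B := by exact_mod_cast hB
  unfold NN WW
  rcases lt_trichotomy l i with h | h | h
  · simp [h, h.ne, h.le]
  · simp [h, (pow_pos this _).ne']
  · simp [h.ne', h.not_gt, h.not_ge]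

lemma WW_rec (d B : ℕ) (hd : 1 ≤ d) (hB2 : 2 ≤ B) (hBd : d ≤ B) (e e' l : ℕ) (he : 1 ≤ e) (he' : 1 ≤ e') (h : e + e' ≤ d) :
    ((d * B ^ xx d (e + e') : ℕ) : ℝ) ^ (3 * min e e') * (NN (WW d B) e l + NN (WW d B) e' l) ≤ WW d B (e + e') l := by
  set i := e + e' with hi
  set e0 := min e e' with he0
  have hB0 : (0:ℝ) < B := by exact_mod_cast (by omega : 0 < B)
  have key : ∀ k, k + e0 ≤ i → 2 * (((d * B ^ xx d i : ℕ) : ℝ) ^ (3 * e0) * NN (WW d B) k l) ≤ WW d B i l := by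
    intro k hk
    rw [NN_eq d B k l (by omega)]
    split_ifs with hl
    · unfold WW
      rw [if_pos (by omega)]
      have h1 : 2 * ((d * B ^ xx d i : ℕ)) ^ (3 * e0) * B ^ yy d i ≤ B ^ yy d k := by
        calc 2 * ((d * B ^ xx d i : ℕ)) ^ (3 * e0) * B ^ yy d i ≤ B * (B * B ^ xx d i) ^ (3 * e0) * B ^ yy d i := by gcongr
          _ = B ^ (1 + 3 * e0 * (xx d i + 1) + yy d i) := by rw [← pow_succ', ← pow_mul, pow_add, pow_add, pow_one, mul_comm (xx d i + 1)]
          _ ≤ _ := Nat.pow_le_pow_right (by omega) (yy_rec d i e0 k (by omega) h hk)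
      have h2 : 2 * ((d * B ^ xx d i : ℕ) : ℝ) ^ (3 * e0) * (B : ℝ) ^ yy d i ≤ (B : ℝ) ^ yy d k := by exact_mod_cast h1
      rw [← mul_assoc, mul_div_assoc', div_le_div_iff₀ (pow_pos hB0 _) (pow_pos hB0 _), mul_right_comm, mul_comm]
      exact mul_le_mul_of_nonneg_left h2 (by positivity)
    · simp only [mul_zero]; exact WW_nonneg _ _ _ _
  have k1 := key e (by omega)
  have k2 := key e' (by omega)
  linarith

lemma full_rep [Nonempty ι] (m : Moll ψ L) (hρ : ρ ≠ 0) (hr1 : ρ ^ 2 * s2 ψ ≤ 1) (d B : ℕ) (hd : 1 ≤ d) (hB2 : 2 ≤ B) (hBd : d ≤ B)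
    (f : Finset ι → ℝ) (hf : ∀ S, f S ≠ 0 → S.card ≤ d) (h1 : ∑ S, f S ^ 2 ≤ 1) :
    Rp ψ ρ (fun i => d * B ^ xx d i) Finset.univ (mp f) d (fun l => if l ≤ d then d * (B : ℝ) ^ yy d l else 0) (d * 4 ^ d * (ρ ^ 2 * s2 ψ)) := by
  set r := ρ ^ 2 * s2 ψ with hr
  have hr0 : 0 ≤ r := mul_nonneg (sq_nonneg _) (s2_nonneg ψ)
  have hB0 : (1:ℝ) ≤ B := by exact_mod_cast (by omega : 1 ≤ B)
  have part : ∀ j, j ≤ d → Rp ψ ρ (fun i => d * B ^ xx d i) Finset.univ (mp fun S => if S.card ≤ j then f S else 0) d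
      (fun l => if l ≤ d then j * (B : ℝ) ^ yy d l else 0) (j * (4 ^ d * r)) := by
    intro j
    induction j with
    | zero =>
      intro _
      have e0 : (mp fun S : Finset ι => if S.card ≤ 0 then f S else 0) = C (f ∅) + C 0 * C 0 := by
        rw [mp, Finset.sum_eq_single ∅ (fun S _ hS => by simp [hS]) (by simp)]; simp
      rw [e0]
      refine ((Rp.const (ρ := ρ) m (fun i => d * B ^ xx d i) Finset.univ (f ∅)).add m 0 (by simp) (Finset.Subset.refl _) (Finset.Subset.refl _) (Nat.zero_le d) (Nat.zero_le d)
        (Rp.const m _ Finset.univ 0)).mono (fun l => by simp) (by simp)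
    | succ j ih =>
      intro hj
      have k1 := ih (by omega)
      have k2 := greedy (M := fun i => d * B ^ xx d i) m hρ hr1 (WW d B) (WW_nonneg d B) d (fun i => Nat.mul_pos hd (Nat.pow_pos (by omega)))
        (fun e e' l he he' h => WW_rec d B hd hB2 hBd e e' l he he' h) (j + 1) (by omega) hj Finset.univ
        (fun S => if S.card = j + 1 then f S else 0) (fun S hS => ⟨Finset.subset_univ _, by by_contra h; simp [h] at hS⟩)
        (le_trans (Finset.sum_le_sum fun S _ => by split_ifs <;> simp [sq_nonneg]) h1)
      have k3 := k1.add m 1 (by simp) (Finset.Subset.refl _) (Finset.Subset.refl _) le_rfl hj k2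
      have e : (mp fun S : Finset ι => if S.card ≤ j then f S else 0) + C 1 * (mp fun S : Finset ι => if S.card = j + 1 then f S else 0) =
          mp fun S : Finset ι => if S.card ≤ j + 1 then f S else 0 := by
        rw [C_1, one_mul, mp, mp, mp, ← Finset.sum_add_distrib]
        refine Finset.sum_congr rfl fun S _ => ?_
        rw [← add_mul, ← C_add]
        congr 2
        rcases lt_trichotomy S.card (j + 1) with h | h | h
        · simp [h.le, h.ne, Nat.lt_succ_iff.1 h]
        · simp [h]
        · rw [if_neg (by omega), if_neg (by omega), if_neg (by omega), add_zero]
      rw [e] at k3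
      refine k3.mono (fun l => ?_) ?_
      · rw [NN_eq d B (j + 1) l (by omega)]
        by_cases hl : l ≤ d
        · simp only [hl, if_true]
          push_cast
          rw [add_mul, one_mul]
          refine add_le_add_right ?_ _
          split_ifs
          · exact div_le_self (by positivity) (one_le_pow₀ hB0)
          · positivity
        · simp [hl, show ¬ l ≤ j + 1 by omega]
      · have a1 := one_add_pow_le' r hr0 hr1 (2 * (j + 1) - 1)
        have a2 : (2:ℝ) ^ (2 * (j + 1) - 1) ≤ 4 ^ d := by
          rw [show (4:ℝ) = 2 ^ 2 by norm_num, ← pow_mul]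
          exact pow_le_pow_right₀ one_le_two (by omega)
        have a3 := mul_le_mul_of_nonneg_right a2 hr0
        push_cast
        nlinarith
  have k := part d le_rfl
  rw [mul_assoc]
  convert k using 3 with S
  by_cases h : f S = 0
  · simp [h]
  · simp [hf S h]

end FG4

section FH1
set_option linter.unusedSectionVars false
open MvPolynomial
variable {ι : Type} [Fintype ι] [DecidableEq ι]

structure SG (s : ℝ → ℝ) : Prop where
  mono : Monotone s
  bd : ∀ t, |s t| ≤ 1
  jump : ∀ t u, 0 ≤ u → u < |t| → s (t + u) = s t

lemma sgn_SG : SG sgn := by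
  refine ⟨fun a b h => ?_, fun t => ?_, fun t u hu ht => ?_⟩
  · simp only [sgn]; split_ifs <;> linarith
  · simp only [sgn]; split_ifs <;> simp
  · simp only [sgn]
    rcases lt_abs.1 ht with h | h
    · rw [if_pos (by linarith), if_pos (by linarith)]
    · rw [if_neg (by linarith), if_neg (by linarith)]

lemma sgn_SG' : SG fun t => -sgn (-t) := by
  refine ⟨fun a b h => neg_le_neg (sgn_SG.mono (neg_le_neg h)), fun t => by rw [abs_neg]; exact sgn_SG.bd _, fun t u hu ht => ?_⟩
  simp only [sgn]
  rcases lt_abs.1 ht with h | h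
  · rw [if_neg (by linarith), if_neg (by linarith)]
  · rw [if_pos (by linarith), if_pos (by linarith)]

lemma SG.dev {s : ℝ → ℝ} (hs : SG s) {w : ℝ} (hw : 0 < w) (p H : ℝ) : s p ≤ s (H + w) + 2 / w ^ 2 * (H - p) ^ 2 := by
  by_cases h : p ≤ H + w
  · have := hs.mono h
    have : 0 ≤ 2 / w ^ 2 * (H - p) ^ 2 := by positivity
    linarith
  · push Not at h
    have h1 := abs_le.1 (hs.bd p); have h2 := abs_le.1 (hs.bd (H + w))
    have h3 : 2 ≤ 2 / w ^ 2 * (H - p) ^ 2 := by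
      rw [div_mul_eq_mul_div, le_div_iff₀ (by positivity)]
      nlinarith
    linarith [h1.2, h2.1]

lemma SG.dev2 {s : ℝ → ℝ} (hs : SG s) {w : ℝ} (hw : 0 < w) (p H : ℝ) : s (H + w) ≤ s (p + 2 * w) + 2 / w ^ 2 * (H - p) ^ 2 := by
  have := hs.dev hw (H + w) (p + w)
  rw [show p + w + w = p + 2 * w by ring, show p + w - (H + w) = -(H - p) by ring, neg_sq] at this
  exact this

lemma NM.dev {Ω : Type} [MeasurableSpace Ω] {θ : Measure Ω} [IsProbabilityMeasure θ] {H : Ω → ℝ} {p v : ℝ} (h : NM θ H p v)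
    {s : ℝ → ℝ} (hs : SG s) {w : ℝ} (hw : 0 < w) :
    s p ≤ ∫ z, s (H z + w) ∂θ + 2 / w ^ 2 * v ∧ ∫ z, s (H z + w) ∂θ ≤ s (p + 2 * w) + 2 / w ^ 2 * v := by
  have i1 := h.int
  have i0 : Integrable (fun z => s (H z + w)) θ := by
    refine Integrable.of_bound ((hs.mono.measurable.comp (h.1.add_const w)).aestronglyMeasurable) 1 (Filter.Eventually.of_forall fun z => ?_)
    rw [Real.norm_eq_abs]; exact hs.bd _
  have e2 : (fun z => 2 / w ^ 2 * (H z - p) ^ 2) = fun z => 2 / w ^ 2 * H z ^ 2 + ((-(2 / w ^ 2 * 2 * p)) * H z + 2 / w ^ 2 * p ^ 2) := by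
    funext z; ring
  have i3 : Integrable (fun z => 2 / w ^ 2 * (H z - p) ^ 2) θ := by
    rw [e2]; exact (h.2.1.const_mul _).add ((i1.const_mul _).add (integrable_const _))
  have j3 : ∫ z, 2 / w ^ 2 * (H z - p) ^ 2 ∂θ = 2 / w ^ 2 * v := by
    rw [e2, (integral_add (h.2.1.const_mul _) ((i1.const_mul _).add (integrable_const _)) : ∫ z, (2 / w ^ 2 * H z ^ 2 + ((-(2 / w ^ 2 * 2 * p)) * H z + 2 / w ^ 2 * p ^ 2)) ∂θ = _ + ∫ z, ((-(2 / w ^ 2 * 2 * p)) * H z + 2 / w ^ 2 * p ^ 2) ∂θ),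
      integral_add (i1.const_mul _) (integrable_const _), integral_const_mul, integral_const_mul, h.2.2.1, h.2.2.2]
    simp; ring
  constructor
  · rw [← j3, ← integral_add i0 i3]
    calc s p = ∫ z, s p ∂θ := by simp
      _ ≤ _ := integral_mono (integrable_const _) (i0.add i3) fun z => hs.dev hw p (H z)
  · rw [← j3]
    calc ∫ z, s (H z + w) ∂θ ≤ ∫ z, (s (p + 2 * w) + 2 / w ^ 2 * (H z - p) ^ 2) ∂θ :=
          integral_mono i0 ((integrable_const _).add i3) fun z => hs.dev2 hw p (H z)
      _ = _ := by rw [integral_add (integrable_const _) i3]; simp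

theorem one_sided {k : ℕ} {η : ℝ} {μ : Measure (ι → ℝ)} [IsProbabilityMeasure μ] (h : MomentMatches k η μ)
    {Ω : Type} [MeasurableSpace Ω] (θ : Measure Ω) [IsProbabilityMeasure θ] (H : (ι → ℝ) → Ω → ℝ)
    (P e Q U : MvPolynomial ι ℝ) (hnm : ∀ x, NM θ (H x) (eval x P) (eval x e))
    {s : ℝ → ℝ} (hs : SG s) {w : ℝ} (hw : 0 < w)
    (hQ : ∀ x, |∫ z, s (H x z + w) ∂θ - eval x Q| ≤ eval x U)
    (de : e.totalDegree ≤ k) (dQ : Q.totalDegree ≤ k) (dU : U.totalDegree ≤ k) :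
    ∫ x, s (eval x P) ∂μ ≤ ∫ x, s (eval x P) ∂(stdGaussianPi ι) + 2 * (stdGaussianPi ι).real {x | |eval x P| ≤ 2 * w} +
      2 / w ^ 2 * (2 * gE e + η * l1 e) + 2 * gE U + η * (l1 Q + l1 U) := by
  have mP : Measurable fun x : ι → ℝ => eval x P := (continuous_eval P).measurable
  have is : ∀ ν : Measure (ι → ℝ), IsProbabilityMeasure ν → Integrable (fun x => s (eval x P)) ν := fun ν _ => by
    refine Integrable.of_bound ((hs.mono.measurable.comp mP).aestronglyMeasurable) 1 (Filter.Eventually.of_forall fun z => ?_)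
    rw [Real.norm_eq_abs]; exact hs.bd _
  obtain ⟨iQ, mQ⟩ := mm_poly h Q dQ
  obtain ⟨iU, mU⟩ := mm_poly h U dU
  obtain ⟨ie, me⟩ := mm_poly h e de
  have p1 : ∫ x, s (eval x P) ∂μ ≤ ∫ x, eval x Q ∂μ + ∫ x, eval x U ∂μ + 2 / w ^ 2 * ∫ x, eval x e ∂μ := by
    have iQU : Integrable (fun x => eval x Q + eval x U) μ := iQ.add iU
    rw [← integral_const_mul, ← integral_add iQ iU, ← integral_add iQU (ie.const_mul _)]
    refine integral_mono (is μ inferInstance) ((iQ.add iU).add (ie.const_mul _)) fun x => ?_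
    have a1 := ((hnm x).dev hs hw).1
    have a2 := abs_le.1 (hQ x)
    change s (eval x P) ≤ eval x Q + eval x U + 2 / w ^ 2 * eval x e
    linarith [a2.2]
  set S : Set (ι → ℝ) := {x | |eval x P| ≤ 2 * w} with hS
  have mS : MeasurableSet S := measurableSet_le mP.abs measurable_const
  have iS : Integrable (S.indicator fun _ => (2:ℝ)) (stdGaussianPi ι) := (integrable_const _).indicator mS
  have jS : ∫ x, S.indicator (fun _ => (2:ℝ)) x ∂(stdGaussianPi ι) = 2 * (stdGaussianPi ι).real S := by
    rw [integral_indicator mS]; simp [mul_comm]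
  have p2 : gE Q ≤ ∫ x, s (eval x P) ∂(stdGaussianPi ι) + 2 * (stdGaussianPi ι).real S + gE U + 2 / w ^ 2 * gE e := by
    have i1 : Integrable (fun x => s (eval x P) + S.indicator (fun _ => (2:ℝ)) x) (stdGaussianPi ι) := (is _ inferInstance).add iS
    have i2 : Integrable (fun x => s (eval x P) + S.indicator (fun _ => (2:ℝ)) x + eval x U) (stdGaussianPi ι) := i1.add (int_eval U)
    rw [← jS, gE, gE, gE, ← integral_const_mul, ← integral_add (is _ inferInstance) iS, ← integral_add i1 (int_eval U),
      ← integral_add i2 ((int_eval e).const_mul _)]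
    refine integral_mono (int_eval Q) (i2.add ((int_eval e).const_mul _)) fun x => ?_
    have a1 := ((hnm x).dev hs hw).2
    have a2 := abs_le.1 (hQ x)
    change eval x Q ≤ s (eval x P) + S.indicator (fun _ => (2:ℝ)) x + eval x U + 2 / w ^ 2 * eval x e
    have a3 : s (eval x P + 2 * w) ≤ s (eval x P) + S.indicator (fun _ => (2:ℝ)) x := by
      by_cases hx : x ∈ S
      · rw [Set.indicator_of_mem hx]
        linarith [(abs_le.1 (hs.bd (eval x P))).1, (abs_le.1 (hs.bd (eval x P + 2 * w))).2]
      · rw [Set.indicator_of_notMem hx, add_zero]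
        exact (hs.jump _ _ (by linarith) (not_le.1 hx)).le
    linarith [a2.1]
  have q1 := (abs_le.1 mQ).2
  have q2 := (abs_le.1 mU).2
  have q3 := mul_le_mul_of_nonneg_left (abs_le.1 me).2 (show 0 ≤ 2 / w ^ 2 by positivity)
  linarith

end FH1

section FH2
set_option linter.unusedSectionVars false
open MvPolynomial
variable {ι : Type} [Fintype ι] [DecidableEq ι]

lemma Reg.mono {i q M : ℕ} {f : Finset ι → ℝ} (h : Reg i M f) (hq : q ≤ M) : Reg i q f := by
  intro D Q R e e' he he' hi hQ hR
  refine le_trans (mul_le_mul_of_nonneg_left ?_ (sq_nonneg _)) (h D Q R e e' he he' hi hQ hR)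
  exact pow_le_pow_left₀ (Nat.cast_nonneg _) (Nat.cast_le.2 hq) _

def UB (F : (ι → ℝ) → ℝ) (D : ℕ) (g c : ℝ) : Prop :=
  ∃ U : MvPolynomial ι ℝ, (∀ x, F x ≤ eval x U) ∧ U.totalDegree ≤ D ∧ gE U ≤ g ∧ l1 U ≤ c

lemma UB.add {F G : (ι → ℝ) → ℝ} {D : ℕ} {g c g' c' : ℝ} (h : UB F D g c) (h' : UB G D g' c') :
    UB (fun x => F x + G x) D (g + g') (c + c') := by
  obtain ⟨U, a1, a2, a3, a4⟩ := h
  obtain ⟨U', b1, b2, b3, b4⟩ := h'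
  exact ⟨U + U', fun x => by rw [map_add]; exact add_le_add (a1 x) (b1 x), (totalDegree_add _ _).trans (max_le a2 b2),
    by rw [gE_add]; exact add_le_add a3 b3, (l1_add _ _).trans (add_le_add a4 b4)⟩

lemma UB.const (D : ℕ) {a : ℝ} (ha : 0 ≤ a) : UB (fun _ : ι → ℝ => a) D a a :=
  ⟨C a, fun x => by simp, by simp, by rw [gE_C], (l1_C _).trans (abs_of_nonneg ha).le⟩

lemma UB.smul {F : (ι → ℝ) → ℝ} {D : ℕ} {g c a : ℝ} (h : UB F D g c) (ha : 0 ≤ a) :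
    UB (fun x => a * F x) D (a * g) (a * c) := by
  obtain ⟨U, a1, a2, a3, a4⟩ := h
  refine ⟨C a * U, fun x => by simpa using mul_le_mul_of_nonneg_left (a1 x) ha, (totalDegree_mul _ _).trans (by simpa using a2),
    by rw [gE_smul]; exact mul_le_mul_of_nonneg_left a3 ha, (l1_mul _ _).trans ?_⟩
  exact mul_le_mul ((l1_C _).trans (abs_of_nonneg ha).le) a4 (l1_nonneg _) ha

lemma UB.mono {F G : (ι → ℝ) → ℝ} {D D' : ℕ} {g c g' c' : ℝ} (h : UB F D g c) (hG : ∀ x, G x ≤ F x) (hD : D ≤ D') (hg : g ≤ g')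
    (hc : c ≤ c') : UB G D' g' c' := by
  obtain ⟨U, a1, a2, a3, a4⟩ := h
  exact ⟨U, fun x => (hG x).trans (a1 x), a2.trans hD, a3.trans hg, a4.trans hc⟩

lemma UB.sum {κ : Type} (s : Finset κ) {F : κ → (ι → ℝ) → ℝ} {D : ℕ} {g c : ℝ} (h : ∀ i ∈ s, UB (F i) D g c) :
    UB (fun x => ∑ i ∈ s, F i x) D (s.card * g) (s.card * c) := by
  classical
  induction s using Finset.induction_on with
  | empty => simpa using UB.const (ι := ι) D le_rfl
  | insert a s ha ih =>
    refine ((h a (Finset.mem_insert_self _ _)).add (ih fun i hi => h i (Finset.mem_insert_of_mem hi))).mono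
      (fun x => by rw [Finset.sum_insert ha]) le_rfl ?_ ?_
    all_goals (rw [Finset.card_insert_of_notMem ha]; push_cast; linarith)

lemma UB_S {V : Type} [Fintype V] {l q : ℕ} (hl : 1 ≤ l) (hq : 1 ≤ q) {d : ℕ} (hld : l ≤ d) (s : Finset V) (lc : V → Finset ι → ℝ)
    (hom : ∀ ν ∈ s, ∀ S, lc ν S ≠ 0 → S.card = l) (nrm : ∀ ν, ∑ S, lc ν S ^ 2 ≤ 1) (reg : ∀ ν ∈ s, Reg l q (lc ν))
    {b B n : ℝ} (hb : 0 ≤ b) (hbB : b ≤ B) (hs : (s.card : ℝ) ≤ n) [Nonempty ι] :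
    UB (fun x => (∑ ν ∈ s, b * |eval x (mp (lc ν))|) ^ (6 * q)) (6 * d * q)
      ((B * n) ^ (6 * q) * ((d:ℝ) ^ (2 * d) * 55296 ^ d * q) ^ (3 * q)) ((B * n * (Fintype.card ι : ℝ) ^ d) ^ (6 * q)) := by
  have hB := hb.trans hbB
  have hN : (1:ℝ) ≤ Fintype.card ι := by exact_mod_cast Fintype.card_pos
  have hd1 : (1:ℝ) ≤ d := by exact_mod_cast hl.trans hld
  have hll : (1:ℝ) ≤ l := by exact_mod_cast hl
  have hld' : (l:ℝ) ≤ d := by exact_mod_cast hld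
  have h1 : ∀ ν ∈ s, UB (fun x => eval x (mp (lc ν)) ^ (6 * q)) (6 * d * q) (((d:ℝ) ^ (2 * d) * 55296 ^ d * q) ^ (3 * q))
      (((Fintype.card ι : ℝ) ^ d) ^ (6 * q)) := fun ν hν => by
    refine ⟨mp (lc ν) ^ (6 * q), fun x => by rw [map_pow], (totalDegree_pow _ _).trans ?_, (moment_bound hl hq (lc ν) (hom ν hν) (reg ν hν) (nrm ν)).trans ?_,
      (l1_pow _ _).trans ?_⟩
    · have := mp_degree d (lc ν) fun S hS => (hom ν hν S hS).trans_le hld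
      calc _ ≤ 6 * q * d := Nat.mul_le_mul_left _ this
        _ = _ := by ring
    · gcongr ?_ ^ _
      gcongr ?_ * _
      gcongr ?_ * ?_
      · calc (l:ℝ) ^ (2 * l) ≤ (d:ℝ) ^ (2 * l) := by gcongr
          _ ≤ _ := pow_le_pow_right₀ hd1 (by omega)
      · exact pow_le_pow_right₀ (by norm_num) hld
    · refine pow_le_pow_left₀ (l1_nonneg _) ((mp_l1 l (lc ν) (hom ν hν) (nrm ν)).trans ?_) _
      exact pow_le_pow_right₀ hN hld
  have h2 := (UB.sum s h1).smul (a := b ^ (6 * q) * (s.card : ℝ) ^ (6 * q - 1)) (by positivity)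
  have e6 : ∀ y : ℝ, y ^ (6 * q) = y ^ (6 * q - 1) * y := fun y => by rw [← pow_succ]; congr 1; omega
  have hbs : b * (s.card : ℝ) ≤ B * n := mul_le_mul hbB hs (Nat.cast_nonneg _) hB
  have key : ∀ y : ℝ, 0 ≤ y → b ^ (6 * q) * (s.card : ℝ) ^ (6 * q - 1) * (s.card * y) ≤ (B * n) ^ (6 * q) * y := fun y hy => by
    calc _ = (b * s.card) ^ (6 * q) * y := by rw [mul_pow, e6 (s.card : ℝ)]; ring
      _ ≤ _ := by gcongr
  refine h2.mono (fun x => ?_) le_rfl (key _ (by positivity)) ((key _ (by positivity)).trans (by rw [mul_pow _ (_ ^ d)]))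
  rw [← Finset.mul_sum, mul_pow, mul_assoc]
  refine mul_le_mul_of_nonneg_left ?_ (by positivity)
  have p := pow_sum_le_card_mul_sum_pow (s := s) (f := fun ν => |eval x (mp (lc ν))|) (fun _ _ => abs_nonneg _) (6 * q - 1)
  rw [show 6 * q - 1 + 1 = 6 * q by omega] at p
  refine p.trans_eq (congrArg _ (Finset.sum_congr rfl fun ν _ => ?_))
  exact Even.pow_abs ⟨3 * q, by ring⟩ _

lemma eT_le (T : ℕ) {S : ℝ} (hS : 0 ≤ S) : eT T S ≤ (1 + S) ^ T := by
  rw [eT, add_comm, add_pow, Finset.sum_range_succ]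
  have : ∑ m ∈ Finset.range T, S ^ m / (m.factorial : ℝ) ≤ ∑ m ∈ Finset.range T, S ^ m * 1 ^ (T - m) * (T.choose m : ℝ) := by
    refine Finset.sum_le_sum fun m hm => ?_
    rw [one_pow, mul_one]
    have h1 : (1:ℝ) ≤ T.choose m := by exact_mod_cast Nat.choose_pos (Finset.mem_range.1 hm).le
    have h2 : (1:ℝ) ≤ m.factorial := by exact_mod_cast Nat.one_le_iff_ne_zero.2 (Nat.factorial_ne_zero m)
    exact (div_le_self (by positivity) h2).trans (le_mul_of_one_le_right (by positivity) h1)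
  have h3 : 0 ≤ S ^ T * 1 ^ (T - T) * (T.choose T : ℝ) := by positivity
  linarith

lemma prod_le_max {I : Finset ℕ} {d : ℕ} (hI : I.card ≤ d) (Y : ℕ → ℝ) (hY : ∀ l ∈ I, 1 ≤ Y l) :
    ∏ l ∈ I, Y l ≤ 1 + ∑ l ∈ I, Y l ^ d := by
  have h0 : ∀ l ∈ I, 0 ≤ Y l := fun l hl => zero_le_one.trans (hY l hl)
  rcases I.eq_empty_or_nonempty with rfl | hne
  · simp
  obtain ⟨l, hl, hm⟩ := Finset.exists_max_image I Y hne
  calc ∏ l ∈ I, Y l ≤ Y l ^ I.card := (Finset.prod_le_prod h0 hm).trans_eq (by simp)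
    _ ≤ Y l ^ d := pow_le_pow_right₀ (hY l hl) hI
    _ ≤ ∑ l ∈ I, Y l ^ d := Finset.single_le_sum (f := fun l => Y l ^ d) (fun l hl => pow_nonneg (h0 l hl) _) hl
    _ ≤ _ := by linarith

lemma ER_le (d : ℕ) (S : ℕ → ℝ) (hS : ∀ i, 0 ≤ S i) (hS0 : S 0 = 0) (T : ℕ → ℕ) (hT : ∀ i, 1 ≤ T i) (Λ : ℕ → ℝ) (hΛ : ∀ i, 0 < Λ i) :
    ER d S T ≤ ∑ i ∈ Finset.Icc 1 d, (Λ i / ((T i).factorial : ℝ) ^ 2 * S i ^ (2 * T i) +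
      (Λ i)⁻¹ * (1 + ∑ l ∈ Finset.Ioc i d, 2 ^ (2 * d * T l) * (1 + S l ^ (2 * d * T l)))) := by
  have e : ER d S T = ∑ i ∈ Finset.Icc 1 d, S i ^ T i / ((T i).factorial : ℝ) * ∏ l ∈ Finset.Ioc i d, eT (T l) (S l) := by
    rw [ER]; symm
    refine Finset.sum_subset (fun i hi => by simp at hi ⊢; omega) fun i hi hi' => ?_
    have : i = 0 := by simp at hi hi'; omega
    have h1 := hT 0
    rw [this, hS0, zero_pow (by omega)]; simp
  rw [e]
  refine Finset.sum_le_sum fun i _ => ?_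
  set a := S i ^ T i / ((T i).factorial : ℝ)
  set b := ∏ l ∈ Finset.Ioc i d, eT (T l) (S l)
  have hb : b ^ 2 ≤ 1 + ∑ l ∈ Finset.Ioc i d, 2 ^ (2 * d * T l) * (1 + S l ^ (2 * d * T l)) := by
    calc b ^ 2 = ∏ l ∈ Finset.Ioc i d, eT (T l) (S l) ^ 2 := by rw [Finset.prod_pow]
      _ ≤ 1 + ∑ l ∈ Finset.Ioc i d, (eT (T l) (S l) ^ 2) ^ d :=
          prod_le_max (by simp) _ fun l _ => one_le_pow₀ (eT_one_le (hT l) (hS l))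
      _ ≤ _ := by
          refine add_le_add_right (Finset.sum_le_sum fun l _ => ?_) _
          have h1 : 0 ≤ eT (T l) (S l) := zero_le_one.trans (eT_one_le (hT l) (hS l))
          calc (eT (T l) (S l) ^ 2) ^ d ≤ (((1 + S l) ^ T l) ^ 2) ^ d := by gcongr; exact eT_le _ (hS l)
            _ = (1 + S l) ^ (2 * d * T l) := by rw [← pow_mul, ← pow_mul]; congr 1; ring
            _ ≤ 2 ^ (2 * d * T l - 1) * (1 ^ (2 * d * T l) + S l ^ (2 * d * T l)) := add_pow_le zero_le_one (hS l) _
            _ ≤ _ := by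
              rw [one_pow]
              have := hS l
              gcongr
              · norm_num
              · omega
  have h2 : a * b ≤ Λ i * a ^ 2 + (Λ i)⁻¹ * b ^ 2 := by
    have h3 := hΛ i
    have h4 : Λ i * (Λ i)⁻¹ = 1 := mul_inv_cancel₀ h3.ne'
    have h5 : 0 ≤ (Λ i)⁻¹ := by positivity
    have : 0 ≤ (Λ i)⁻¹ * (Λ i * a - b) ^ 2 := by positivity
    have h6 : (Λ i)⁻¹ * (Λ i * a - b) ^ 2 = (Λ i * (Λ i)⁻¹) * Λ i * a ^ 2 - 2 * (Λ i * (Λ i)⁻¹) * (a * b) + (Λ i)⁻¹ * b ^ 2 := by ring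
    rw [h4] at h6
    nlinarith [mul_nonneg h3.le (sq_nonneg a), mul_nonneg h5 (sq_nonneg b)]
  refine h2.trans (add_le_add (le_of_eq ?_) (mul_le_mul_of_nonneg_left hb (inv_nonneg.2 (hΛ i).le)))
  simp only [a]
  rw [div_pow, ← pow_mul, mul_comm (T i) 2]; ring

end FH2

section FH3
set_option linter.unusedSectionVars false
open MvPolynomial
variable {ι : Type} [Fintype ι] [DecidableEq ι]

lemma fac_ge (q : ℕ) : (q:ℝ) ^ (3 * q) ≤ ((3 * q).factorial : ℝ) := by
  have h := Real.pow_div_factorial_le_exp (x := ((3 * q : ℕ) : ℝ)) (Nat.cast_nonneg _) (3 * q)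
  have h1 : Real.exp ((3 * q : ℕ) : ℝ) ≤ 3 ^ (3 * q) := by
    rw [← mul_one (((3 * q : ℕ) : ℝ)), Real.exp_nat_mul]
    exact pow_le_pow_left₀ (Real.exp_pos _).le (by linarith [Real.exp_one_lt_d9]) _
  have h2 := h.trans h1
  rw [div_le_iff₀ (by positivity)] at h2
  push_cast at h2
  rw [mul_pow] at h2
  exact le_of_mul_le_mul_left h2 (by positivity)

/-- parameter conditions -/
structure PC (d B : ℕ) : Prop where
  hd : 1 ≤ d
  big : d ^ 6 * (d ^ (2 * d) * 55296 ^ d) ^ 3 ≤ B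
  hx : 6 * (6 * 7 ^ d) + 14 ≤ B

noncomputable abbrev CC (d : ℕ) : ℝ := (d:ℝ) ^ (2 * d) * 55296 ^ d

variable {d B : ℕ}

lemma PC.two (h : PC d B) : (2:ℝ) ≤ B := by exact_mod_cast (by have := h.hx; omega : 2 ≤ B)
lemma PC.pd (h : PC d B) : (1:ℝ) ≤ d := by exact_mod_cast h.hd
lemma PC.cc1 (h : PC d B) : 1 ≤ CC d := one_le_mul_of_one_le_of_one_le (one_le_pow₀ h.pd) (one_le_pow₀ (by norm_num))
lemma PC.bigR (h : PC d B) : (d:ℝ) ^ 6 * CC d ^ 3 ≤ B := by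
  have h2 : ((d ^ 6 * (d ^ (2 * d) * 55296 ^ d) ^ 3 : ℕ) : ℝ) ≤ B := Nat.cast_le.2 h.big
  push_cast at h2; exact h2
lemma PC.dB (h : PC d B) : (d:ℝ) ≤ B :=
  calc (d:ℝ) ≤ (d:ℝ) ^ 6 := le_self_pow₀ h.pd (by norm_num)
    _ ≤ (d:ℝ) ^ 6 * CC d ^ 3 := le_mul_of_one_le_right (by positivity) (one_le_pow₀ h.cc1)
    _ ≤ B := h.bigR
lemma PC.cB (h : PC d B) : CC d ≤ B :=
  calc CC d ≤ CC d ^ 3 := le_self_pow₀ h.cc1 (by norm_num)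
    _ ≤ (d:ℝ) ^ 6 * CC d ^ 3 := le_mul_of_one_le_left (by positivity) (one_le_pow₀ h.pd)
    _ ≤ B := h.bigR

lemma num1 (h : PC d B) (x y : ℕ) (hxy : x = 2 * y + 4) :
    (B:ℝ) ^ (B ^ x) / (((3 * B ^ x).factorial : ℝ)) ^ 2 * (((B:ℝ) * (d * (B:ℝ) ^ y)) ^ (6 * B ^ x) * (CC d * (B ^ x : ℕ)) ^ (3 * B ^ x)) ≤ 1 / B := by
  have hb := h.two
  have hc := h.cc1
  set q := B ^ x with hq
  have hq1 : 1 ≤ q := Nat.one_le_pow _ _ (by exact_mod_cast (by linarith : (0:ℝ) < B))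
  have hq1' : (1:ℝ) ≤ q := by exact_mod_cast hq1
  have hqb : (q:ℝ) = (B:ℝ) ^ (2 * y + 4) := by rw [hq, hxy]; push_cast; rfl
  set b := (B:ℝ)
  have hbig := h.bigR
  have hf := fac_ge q
  rw [div_mul_eq_mul_div, div_le_div_iff₀ (by positivity) (by linarith), one_mul]
  refine le_trans ?_ (pow_le_pow_left₀ (by positivity) hf 2)
  calc b ^ q * ((b * (d * b ^ y)) ^ (6 * q) * (CC d * q) ^ (3 * q)) * b
      ≤ b ^ q * ((b * (d * b ^ y)) ^ (6 * q) * (CC d * q) ^ (3 * q)) * b ^ q := by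
        gcongr; exact le_self_pow₀ (by linarith) (by omega)
    _ = (b ^ 8 * b ^ (6 * y) * (d ^ 6 * CC d ^ 3) * q ^ 3) ^ q := by
        rw [pow_mul, pow_mul, ← mul_pow, ← mul_pow, ← mul_pow]; congr 1; ring
    _ ≤ (b ^ 8 * b ^ (6 * y) * b ^ 4 * q ^ 3) ^ q := by
        gcongr; exact hbig.trans (le_self_pow₀ (by linarith) (by norm_num))
    _ = (q ^ 6) ^ q := by rw [hqb]; congr 1; ring
    _ = _ := by rw [← pow_mul, ← pow_mul]; congr 1; ring

lemma num2 (h : PC d B) (x y q : ℕ) (hxy : x = 2 * y + 4) (hq : q = d * B ^ x) :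
    2 ^ (6 * q) * (1 + ((B:ℝ) * (d * (B:ℝ) ^ y)) ^ (6 * q) * (CC d * (q : ℕ)) ^ (3 * q)) ≤ (B:ℝ) ^ (q * (6 * x + 13)) := by
  have hb := h.two
  have hc := h.cc1
  have hcB := h.cB
  have hdB := h.dB
  have hd := h.hd
  have hq1 : 1 ≤ q := by rw [hq]; exact Nat.mul_pos hd (Nat.pow_pos (by exact_mod_cast (by linarith : (0:ℝ) < B)))
  have hqb : (q:ℝ) ≤ (B:ℝ) ^ (x + 1) := by
    rw [hq, pow_succ, mul_comm]; push_cast; gcongr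
  set b := (B:ℝ)
  have hb1 : 1 ≤ b := by linarith
  have e1 : b * (d * b ^ y) ≤ b ^ (y + 2) := by rw [pow_add, sq]; nlinarith [mul_le_mul_of_nonneg_right hdB (show 0 ≤ b * b ^ y by positivity)]
  have e2 : CC d * q ≤ b ^ (x + 2) := by
    calc CC d * q ≤ b * b ^ (x + 1) := by gcongr
      _ = _ := by ring
  have e3 : (b * (d * b ^ y)) ^ (6 * q) * (CC d * q) ^ (3 * q) ≤ b ^ (q * (6 * x + 6)) :=
    calc _ ≤ (b ^ (y + 2)) ^ (6 * q) * (b ^ (x + 2)) ^ (3 * q) := by gcongr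
      _ = _ := by rw [← pow_mul, ← pow_mul, ← pow_add, hxy]; congr 1; ring
  calc _ ≤ b ^ (6 * q) * (b ^ (q * (6 * x + 6)) + b ^ (q * (6 * x + 6))) := by
        gcongr; exact one_le_pow₀ hb1
    _ ≤ b ^ (6 * q) * (b * b ^ (q * (6 * x + 6))) := by gcongr; nlinarith [show 0 ≤ b ^ (q * (6 * x + 6)) by positivity]
    _ = b ^ (6 * q + 1 + q * (6 * x + 6)) := by ring
    _ ≤ _ := pow_le_pow_right₀ hb1 (by nlinarith)

lemma num3 (h : PC d B) {i l : ℕ} (hi : i < l) (hl : l ≤ d) : d * B ^ xx d l * (6 * xx d l + 13) + 1 ≤ B ^ xx d i := by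
  have h1 : 1 ≤ 7 ^ (d - l) := Nat.one_le_pow _ _ (by norm_num)
  have h2 : 7 * 7 ^ (d - l) ≤ 7 ^ (d - i) := by
    rw [← pow_succ']; exact Nat.pow_le_pow_right (by norm_num) (by omega)
  have h3 : xx d l + 2 ≤ xx d i := by unfold xx; omega
  have h4 : 7 ^ (d - l) ≤ 7 ^ d := Nat.pow_le_pow_right (by norm_num) (by omega)
  have h5 : 6 * xx d l + 13 + 1 ≤ B := by have := h.hx; unfold xx; omega
  have hB : 1 ≤ B := by omega
  have h6 : d ≤ B := by exact_mod_cast h.dB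
  have h7 : 1 ≤ B ^ xx d l := Nat.one_le_pow _ _ hB
  calc d * B ^ xx d l * (6 * xx d l + 13) + 1 ≤ d * B ^ xx d l * (6 * xx d l + 13 + 1) := by
        have := Nat.mul_le_mul h.hd h7; rw [mul_add (d * B ^ xx d l) (6 * xx d l + 13) 1]; omega
    _ ≤ B * B ^ xx d l * B := by gcongr
    _ = B ^ (xx d l + 2) := by ring
    _ ≤ _ := Nat.pow_le_pow_right hB h3

lemma xx_anti (d : ℕ) {i j : ℕ} (h : i ≤ j) : xx d j ≤ xx d i := by
  have : 7 ^ (d - j) ≤ 7 ^ (d - i) := Nat.pow_le_pow_right (by norm_num) (by omega)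
  unfold xx; omega

lemma PC.l1b (h : PC d B) {l : ℕ} (hl : 1 ≤ l) {N : ℝ} (hN : 1 ≤ N) :
    B * (d * (B:ℝ) ^ yy d l) * N ^ d ≤ (B:ℝ) ^ xx d 1 * N ^ d := by
  have hdB := h.dB
  have hb := h.two
  have := xx_yy d l
  have h3 := xx_anti d hl
  gcongr
  calc (B:ℝ) * (d * (B:ℝ) ^ yy d l) ≤ B * (B * (B:ℝ) ^ yy d l) := by gcongr
    _ = (B:ℝ) ^ (yy d l + 2) := by ring
    _ ≤ _ := pow_le_pow_right₀ (by linarith) (by omega)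

theorem ER_UB [Nonempty ι] (h : PC d B) {V : Type} [Fintype V] (dg : V → ℕ) (lc : V → Finset ι → ℝ) (one : ∀ ν, 1 ≤ dg ν)
    (hom : ∀ ν S, lc ν S ≠ 0 → S.card = dg ν) (nrm : ∀ ν, ∑ S, lc ν S ^ 2 ≤ 1) (reg : ∀ ν, Reg (dg ν) (d * B ^ xx d (dg ν)) (lc ν))
    (cnt : ∀ l, ∑ ν, (if dg ν = l then (1:ℝ) else 0) ≤ if l ≤ d then d * (B:ℝ) ^ yy d l else 0)
    {b : ℝ} (hb : 0 ≤ b) (hbB : b ≤ B) :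
    UB (fun x : ι → ℝ => ER d (fun i => ∑ ν with dg ν = i, b * |eval x (mp (lc ν))|) fun i => 3 * B ^ xx d (max i 1))
      (6 * d ^ 2 * B ^ xx d 1) (d * (d + 2) / B) (((B:ℝ) ^ xx d 1 * (Fintype.card ι : ℝ) ^ d) ^ (17 * d * B ^ xx d 1)) := by
  have hB2 := h.two
  have hB1 : (1:ℝ) ≤ B := by linarith
  have hBn : 1 ≤ B := by exact_mod_cast hB1
  have hN : (1:ℝ) ≤ Fintype.card ι := by exact_mod_cast Fintype.card_pos
  have hd1 := h.pd
  have hdB := h.dB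
  set N : ℝ := (Fintype.card ι : ℝ) with hNdef
  set R := B ^ xx d 1 with hR
  have hxx : 1 ≤ xx d 1 := by have := xx_yy d 1; omega
  have hBR : B ≤ R := Nat.le_self_pow (by omega) B
  have hRc : (R:ℝ) = (B:ℝ) ^ xx d 1 := by rw [hR]; push_cast; rfl
  rw [← hRc]
  set Z : ℝ := R * N ^ d with hZ
  have hBR' : (B:ℝ) ≤ R := by exact_mod_cast hBR
  have hRZ : (R:ℝ) ≤ Z := le_mul_of_one_le_right (by positivity) (one_le_pow₀ hN)
  have hBZ : (B:ℝ) ≤ Z := hBR'.trans hRZ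
  have hZ1 : 1 ≤ Z := by linarith
  have hB14 : (14:ℝ) ≤ B := by exact_mod_cast (by have := h.hx; omega : 14 ≤ B)
  have hqR : ∀ l, 1 ≤ l → B ^ xx d l ≤ R := fun l hl => Nat.pow_le_pow_right hBn (xx_anti d hl)
  have base : ∀ l q, 1 ≤ l → l ≤ d → 1 ≤ q → q ≤ d * B ^ xx d l →
      UB (fun x : ι → ℝ => (∑ ν with dg ν = l, b * |eval x (mp (lc ν))|) ^ (6 * q)) (6 * d ^ 2 * R)
      ((B * (d * (B:ℝ) ^ yy d l)) ^ (6 * q) * (CC d * q) ^ (3 * q)) (Z ^ (6 * q)) := fun l q hl hld hq hqM => by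
    have c1 : ((Finset.univ.filter fun ν => dg ν = l).card : ℝ) ≤ d * (B:ℝ) ^ yy d l := by
      have := cnt l
      rw [if_pos hld] at this
      simpa using this
    refine (UB_S hl hq hld _ lc (fun ν hν S hS => ?_) nrm (fun ν hν => ?_) hb hbB c1).mono (fun x => le_rfl) ?_ le_rfl ?_
    · rw [hom ν S hS]; simpa using hν
    · have e : dg ν = l := by simpa using hν
      have := reg ν
      rw [e] at this
      exact this.mono hqM
    · calc 6 * d * q ≤ 6 * d * (d * R) := Nat.mul_le_mul_left _ (hqM.trans (Nat.mul_le_mul_left _ (hqR l hl)))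
        _ = _ := by ring
    · refine pow_le_pow_left₀ (by positivity) ?_ _
      rw [hZ, hRc]
      exact h.l1b hl hN
  have X : ∀ i ∈ Finset.Icc 1 d, UB (fun x : ι → ℝ => (B:ℝ) ^ (B ^ xx d i) / (((3 * B ^ xx d (max i 1)).factorial : ℝ)) ^ 2 *
      (∑ ν with dg ν = i, b * |eval x (mp (lc ν))|) ^ (2 * (3 * B ^ xx d (max i 1)))) (6 * d ^ 2 * R) (1 / B) (Z ^ (7 * d * R)) := fun i hi => by
    obtain ⟨hi1, hid⟩ := Finset.mem_Icc.1 hi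
    rw [max_eq_left hi1, show 2 * (3 * B ^ xx d i) = 6 * B ^ xx d i by ring]
    have hq1 : 1 ≤ B ^ xx d i := Nat.one_le_pow _ _ hBn
    refine ((base i (B ^ xx d i) hi1 hid hq1 (Nat.le_mul_of_pos_left _ h.hd)).smul (by positivity)).mono (fun x => le_rfl) le_rfl
      (num1 h _ _ (xx_yy d i)) ?_
    have f1 : (1:ℝ) ≤ (((3 * B ^ xx d i).factorial : ℝ)) ^ 2 := one_le_pow₀ (by exact_mod_cast Nat.one_le_iff_ne_zero.2 (Nat.factorial_ne_zero _))
    calc _ ≤ Z ^ (B ^ xx d i) * Z ^ (6 * B ^ xx d i) := by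
          gcongr
          exact (div_le_self (by positivity) f1).trans (by gcongr)
      _ = Z ^ (7 * B ^ xx d i) := by rw [← pow_add]; congr 1; ring
      _ ≤ _ := pow_le_pow_right₀ hZ1 (by nlinarith [hqR i hi1, h.hd, Nat.mul_le_mul h.hd (hqR i hi1)])
  have Y : ∀ i ∈ Finset.Icc 1 d, UB (fun x : ι → ℝ => ((B:ℝ) ^ (B ^ xx d i))⁻¹ * (1 + ∑ l ∈ Finset.Ioc i d, 2 ^ (2 * d * (3 * B ^ xx d (max l 1))) *
      (1 + (∑ ν with dg ν = l, b * |eval x (mp (lc ν))|) ^ (2 * d * (3 * B ^ xx d (max l 1)))))) (6 * d ^ 2 * R) ((1 + d) / B)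
      (1 + d * (2 * Z ^ (12 * d * R))) := fun i hi => by
    obtain ⟨hi1, hid⟩ := Finset.mem_Icc.1 hi
    have hq1 : 1 ≤ B ^ xx d i := Nat.one_le_pow _ _ hBn
    set G : ℝ := (B:ℝ) ^ (B ^ xx d i) / B with hG
    have hG1 : 1 ≤ G := by rw [hG, one_le_div (by linarith)]; exact le_self_pow₀ hB1 (by omega)
    have y1 : ∀ l ∈ Finset.Ioc i d, UB (fun x : ι → ℝ => 2 ^ (2 * d * (3 * B ^ xx d (max l 1))) *
      (1 + (∑ ν with dg ν = l, b * |eval x (mp (lc ν))|) ^ (2 * d * (3 * B ^ xx d (max l 1))))) (6 * d ^ 2 * R) G (2 * Z ^ (12 * d * R)) := fun l hl => by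
      obtain ⟨hl1, hld⟩ := Finset.mem_Ioc.1 hl
      have hl0 : 1 ≤ l := by omega
      rw [max_eq_left hl0, show 2 * d * (3 * B ^ xx d l) = 6 * (d * B ^ xx d l) by ring]
      refine (((UB.const _ zero_le_one).add (base l (d * B ^ xx d l) hl0 hld (Nat.mul_pos h.hd (Nat.pow_pos hBn)) le_rfl)).smul (a := 2 ^ (6 * (d * B ^ xx d l))) (by positivity)).mono
        (fun x => le_rfl) le_rfl ((num2 h _ _ _ (xx_yy d l) rfl).trans ?_) ?_
      · rw [hG, le_div_iff₀ (by linarith), ← pow_succ]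
        exact pow_le_pow_right₀ hB1 (num3 h hl1 hld)
      · have z1 : 6 * (d * B ^ xx d l) ≤ 6 * d * R := by rw [← mul_assoc]; exact Nat.mul_le_mul_left _ (hqR l hl0)
        have z2 : Z ^ (6 * (d * B ^ xx d l)) ≤ Z ^ (6 * d * R) := pow_le_pow_right₀ hZ1 z1
        have z3 : (2:ℝ) ^ (6 * (d * B ^ xx d l)) ≤ Z ^ (6 * d * R) := (pow_le_pow_left₀ zero_le_two (hB2.trans hBZ) _).trans z2
        calc _ ≤ Z ^ (6 * d * R) * (Z ^ (6 * d * R) + Z ^ (6 * d * R)) := by gcongr; exact one_le_pow₀ hZ1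
          _ = _ := by rw [← two_mul, mul_left_comm, ← pow_add]; congr 2; ring
    have cd : (((Finset.Ioc i d).card : ℕ) : ℝ) ≤ d := by exact_mod_cast (by simp : (Finset.Ioc i d).card ≤ d)
    refine (((UB.const _ zero_le_one).add (UB.sum _ y1)).smul (by positivity)).mono (fun x => le_rfl) le_rfl ?_ ?_
    · have : (B:ℝ) ^ (B ^ xx d i) = G * B := by rw [hG]; field_simp
      rw [this, inv_mul_le_iff₀ (by positivity)]
      calc _ ≤ G + d * G := by gcongr
        _ = _ := by field_simp
    · calc _ ≤ 1 * (1 + d * (2 * Z ^ (12 * d * R))) := by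
            gcongr
            exact inv_le_one_of_one_le₀ (one_le_pow₀ hB1)
        _ = _ := one_mul _
  refine (UB.sum (Finset.Icc 1 d) fun i hi => (X i hi).add (Y i hi)).mono (fun x => ?_) le_rfl ?_ ?_
  · refine ER_le d _ (fun i => Finset.sum_nonneg fun ν _ => by positivity) (Finset.sum_eq_zero fun ν hν => ?_) _ (fun i => Nat.mul_pos (by norm_num) (Nat.pow_pos hBn)) _
      fun i => by positivity
    have := one ν
    simp at hν; omega
  · rw [Nat.card_Icc, Nat.add_sub_cancel, ← add_div]; exact le_of_eq (by ring)
  · rw [Nat.card_Icc, Nat.add_sub_cancel]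
    have hdR : 1 ≤ d * R := Nat.mul_pos h.hd (by omega)
    have w1 : Z ^ (7 * d * R) ≤ Z ^ (12 * d * R) := pow_le_pow_right₀ hZ1 (by nlinarith)
    have w2 : 1 ≤ Z ^ (12 * d * R) := one_le_pow₀ hZ1
    have hdZ : (d:ℝ) ≤ Z := hdB.trans hBZ
    calc d * (Z ^ (7 * d * R) + (1 + d * (2 * Z ^ (12 * d * R)))) ≤ Z * (Z ^ (12 * d * R) + (Z ^ (12 * d * R) + Z * (2 * Z ^ (12 * d * R)))) := by gcongr
      _ = (Z * (2 + 2 * Z)) * Z ^ (12 * d * R) := by ring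
      _ ≤ (Z ^ 5) * Z ^ (12 * d * R) := by
          gcongr
          have hZ14 : 14 ≤ Z := hB14.trans hBZ
          have z4 := pow_le_pow_right₀ hZ1 (show 2 ≤ 4 by norm_num)
          rw [pow_succ' Z 4]
          exact mul_le_mul_of_nonneg_left (by nlinarith) (by linarith)
      _ = Z ^ (5 + 12 * d * R) := by rw [pow_add]
      _ ≤ _ := pow_le_pow_right₀ hZ1 (by nlinarith)

end FH3

section FH4
set_option linter.unusedSectionVars false
open MvPolynomial
variable {ι : Type} [Fintype ι] [DecidableEq ι] {d B : ℕ} {ψ : ℕ → ℝ → ℝ} {L : ℝ}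

theorem core [Nonempty ι] (h : PC d B) (m : Moll ψ L) {ρ : ℝ} (hρ : 0 < ρ) (hr1 : ρ ^ 2 * s2 ψ ≤ 1) (hLB : L * ρ⁻¹ ≤ B)
    (f : Finset ι → ℝ) (hf : ∀ S, f S ≠ 0 → S.card ≤ d) (h1 : ∑ S, f S ^ 2 ≤ 1)
    {k : ℕ} (hk : 6 * d ^ 2 * B ^ xx d 1 ≤ k) {η : ℝ} (hη : 0 ≤ η) {μ : Measure (ι → ℝ)} [IsProbabilityMeasure μ] (hμ : MomentMatches k η μ)
    {s : ℝ → ℝ} (hs : SG s) {w : ℝ} (hw : 0 < w) :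
    ∫ x, s (eval x (mp f)) ∂μ ≤ ∫ x, s (eval x (mp f)) ∂(stdGaussianPi ι) + 2 * (stdGaussianPi ι).real {x | |eval x (mp f)| ≤ 2 * w} +
      4 / w ^ 2 * (d * 4 ^ d * (ρ ^ 2 * s2 ψ)) + 2 * (d * (d + 2) / B) +
      η * ((2 / w ^ 2 + 2) * ((B:ℝ) ^ xx d 1 * (Fintype.card ι : ℝ) ^ d) ^ (17 * d * B ^ xx d 1)) := by
  classical
  have hB2 := h.two
  have hB1 : (1:ℝ) ≤ B := by linarith
  have hBn : 1 ≤ B := by exact_mod_cast hB1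
  have hB14 : 14 ≤ B := by have := h.hx; omega
  have hN : (1:ℝ) ≤ Fintype.card ι := by exact_mod_cast Fintype.card_pos
  have hd1 := h.pd
  have hdB := h.dB
  have hdB' : d ≤ B := by exact_mod_cast hdB
  have hd := h.hd
  have hL := m.hL
  have := nz_prob m
  obtain ⟨V, _, dg, lc, hh, e, rs, -, de, le, ge, cnt⟩ := full_rep m hρ.ne' hr1 d B h.hd (by omega) hdB' f hf h1
  beta_reduce at cnt
  have hdg : ∀ ν, dg ν ≤ d := fun ν => by
    by_contra hc
    have c1 := cnt (dg ν)
    rw [if_neg hc] at c1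
    have c2 := Finset.single_le_sum (f := fun ν' => if dg ν' = dg ν then (1:ℝ) else 0) (fun _ _ => by split_ifs <;> simp) (Finset.mem_univ ν)
    simp only [if_true] at c2
    linarith
  have hxx : 1 ≤ xx d 1 := by have := xx_yy d 1; omega
  have hBR : B ≤ B ^ xx d 1 := Nat.le_self_pow (by omega) B
  have hRc : ((B ^ xx d 1 : ℕ) : ℝ) = (B:ℝ) ^ xx d 1 := by push_cast; rfl
  obtain ⟨U, u1, u2, u3, u4⟩ := ER_UB h dg lc rs.one rs.hom rs.nrm rs.reg cnt (b := L * ρ⁻¹) (by positivity) hLB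
  set N : ℝ := (Fintype.card ι : ℝ) with hNdef
  set R := B ^ xx d 1 with hR
  rw [← hRc] at u4 ⊢
  set Z : ℝ := R * N ^ d with hZ
  have hBR' : (B:ℝ) ≤ R := by exact_mod_cast hBR
  have hRZ : (R:ℝ) ≤ Z := le_mul_of_one_le_right (by positivity) (one_le_pow₀ hN)
  have hBZ : (B:ℝ) ≤ Z := hBR'.trans hRZ
  have hZ3 : 3 ≤ Z := by have : (14:ℝ) ≤ B := by exact_mod_cast hB14
                         linarith
  have hZ1 : 1 ≤ Z := by linarith
  have hdR : 1 ≤ d * R := Nat.mul_pos hd (by omega)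
  have hNZ : N ^ d ≤ Z := le_mul_of_one_le_left (by positivity) (hB1.trans hBR')
  have hT : ∀ i, 1 ≤ 3 * B ^ xx d (max i 1) := fun i => Nat.mul_pos (by norm_num) (Nat.pow_pos hBn)
  have hTR : ∀ i, 3 * B ^ xx d (max i 1) ≤ 3 * R := fun i => Nat.mul_le_mul_left _ (Nat.pow_le_pow_right hBn (xx_anti d (le_max_right i 1)))
  obtain ⟨Q, q1, q2, q3⟩ := taylor_noise m d (fun u => s (hh u + w)) (hs.mono.measurable.comp (rs.meas.add_const w)) (fun u => hs.bd _) dg hdg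
    (fun ν => C ρ⁻¹ * mp (lc ν)) (fun ν => (totalDegree_mul _ _).trans (by simpa using mp_degree _ _ fun S hS => (rs.hom ν S hS).le))
    (B * N ^ d) (one_le_mul_of_one_le_of_one_le hB1 (one_le_pow₀ hN)) (fun ν => by
      have a1 : l1 (C ρ⁻¹ * mp (lc ν)) ≤ ρ⁻¹ * N ^ d := by
        refine (l1_mul _ _).trans (mul_le_mul ((l1_C _).trans (abs_of_pos (by positivity)).le) ?_ (l1_nonneg _) (by positivity))
        exact (mp_l1 _ _ (rs.hom ν) (rs.nrm ν)).trans (pow_le_pow_right₀ hN (hdg ν))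
      calc L * l1 (C ρ⁻¹ * mp (lc ν)) ≤ L * (ρ⁻¹ * N ^ d) := by gcongr
        _ = L * ρ⁻¹ * N ^ d := by ring
        _ ≤ _ := by gcongr) (fun i => 3 * B ^ xx d (max i 1)) hT
  have hV : Fintype.card V ≤ d * R := by
    have c0 : ∀ l ∈ Finset.Icc 1 d, (Finset.univ.filter fun ν => dg ν = l).card ≤ R := fun l hl => by
      obtain ⟨hl1, hld⟩ := Finset.mem_Icc.1 hl
      have c1 := cnt l
      rw [if_pos hld] at c1
      have c2 : ((Finset.univ.filter fun ν => dg ν = l).card : ℝ) ≤ d * (B:ℝ) ^ yy d l := by simpa using c1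
      have c3 : ((Finset.univ.filter fun ν => dg ν = l).card : ℝ) ≤ R := by
        refine c2.trans ?_
        have c4 := xx_yy d l
        have c5 := xx_anti d hl1
        rw [hRc]
        calc d * (B:ℝ) ^ yy d l ≤ B * (B:ℝ) ^ yy d l := by gcongr
          _ = (B:ℝ) ^ (yy d l + 1) := by ring
          _ ≤ _ := pow_le_pow_right₀ hB1 (by omega)
      exact_mod_cast c3
    have c6 := Finset.card_eq_sum_card_fiberwise (s := (Finset.univ : Finset V)) (t := Finset.Icc 1 d) (f := dg) (fun ν _ => by
      simp [rs.one ν, hdg ν])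
    rw [← Finset.card_univ, c6]
    refine (Finset.sum_le_sum c0).trans ?_
    simp
  have lQ : l1 Q ≤ Z ^ (17 * d * R) := by
    have t1 : ∑ i ∈ Finset.range (d + 1), 3 * B ^ xx d (max i 1) ≤ 6 * (d * R) := by
      refine (Finset.sum_le_sum fun i _ => hTR i).trans ?_
      simp only [Finset.sum_const, Finset.card_range, smul_eq_mul]
      nlinarith [Nat.mul_le_mul_right R hd]
    refine q2.trans ?_
    calc _ ≤ Z ^ (d * R) * Z ^ (6 * (d * R)) := by
          refine mul_le_mul ?_ ?_ (by positivity) (by positivity)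
          · exact (pow_le_pow_left₀ (by norm_num) hZ3 _).trans (pow_le_pow_right₀ hZ1 hV)
          · exact (pow_le_pow_left₀ (by positivity) (mul_le_mul_of_nonneg_right hBR' (by positivity) : (B:ℝ) * N ^ d ≤ Z) _).trans (pow_le_pow_right₀ hZ1 t1)
      _ ≤ _ := by rw [← pow_add]; exact pow_le_pow_right₀ hZ1 (by nlinarith)
  have lE : l1 e ≤ Z ^ (17 * d * R) := by
    have t2 : l1 e ≤ N ^ (2 * d) * 2 ^ Fintype.card V := by
      have : 0 ≤ N ^ (2 * d) := by positivity
      linarith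
    refine t2.trans ?_
    calc _ ≤ Z ^ 2 * Z ^ (d * R) := by
          refine mul_le_mul ?_ ?_ (by positivity) (by positivity)
          · rw [mul_comm, pow_mul]; exact pow_le_pow_left₀ (by positivity) hNZ _
          · exact (pow_le_pow_left₀ (by norm_num) (by linarith) _).trans (pow_le_pow_right₀ hZ1 hV)
      _ ≤ _ := by rw [← pow_add]; exact pow_le_pow_right₀ hZ1 (by nlinarith)
  have main := one_sided hμ (Measure.pi fun _ : V => nz ψ) (fun x z => hh fun ν => ρ⁻¹ * eval x (mp (lc ν)) + z ν) (mp f) e Q U rs.nm hs hw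
    (fun x => by
      have a1 := q3 x
      have a2 := u1 x
      simp only [map_mul, eval_C] at a1
      refine a1.trans (le_trans (le_of_eq ?_) a2)
      congr 1
      funext i
      refine Finset.sum_congr rfl fun ν _ => ?_
      rw [abs_mul, abs_of_pos (by positivity : 0 < ρ⁻¹)]; ring)
    (de.trans (le_trans (by nlinarith) hk)) (q1.trans (le_trans ?_ hk)) (u2.trans hk)
  · have g2 : 2 / w ^ 2 * (2 * gE e + η * l1 e) ≤ 2 / w ^ 2 * (2 * (d * 4 ^ d * (ρ ^ 2 * s2 ψ)) + η * Z ^ (17 * d * R)) := by gcongr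
    have g3 : η * (l1 Q + l1 U) ≤ η * (Z ^ (17 * d * R) + Z ^ (17 * d * R)) := by gcongr
    have g4 : 4 / w ^ 2 = 2 * (2 / w ^ 2) := by ring
    rw [g4]
    linarith
  · calc _ ≤ ∑ i ∈ Finset.range (d + 1), d * (3 * R) := Finset.sum_le_sum fun i hi => Nat.mul_le_mul (by simp at hi; omega) (hTR i)
      _ ≤ _ := by
        simp only [Finset.sum_const, Finset.card_range, smul_eq_mul]
        nlinarith [Nat.mul_le_mul_right (d * R) hd]

end FH4

section FH5
set_option linter.unusedSectionVars false
open MvPolynomial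

lemma anticonc_eps {ι : Type} [Fintype ι] [DecidableEq ι] (d : ℕ) (hd : 1 ≤ d) (f : Finset ι → ℝ) (hf : ∀ S, f S ≠ 0 → S.card ≤ d)
    (h1 : ∑ S, f S ^ 2 = 1) (ε : ℝ) (hε : 0 < ε) :
    (stdGaussianPi ι).real {x | |eval x (mp f)| ≤ 2 * ε ^ (2 * d)} ≤ 8 * d * 9 ^ d * ((2 * d + 1) * 2 ^ (d + 4)) * ε := by
  have hd1 : (1:ℝ) ≤ d := by exact_mod_cast hd
  set Ci : ℝ := (2 * d + 1) * 2 ^ (d + 4) with hCi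
  have h2 : (1:ℝ) ≤ 2 ^ d := one_le_pow₀ (by norm_num)
  have hCi2 : 2 ≤ Ci := by rw [hCi, pow_add]; nlinarith
  have h9 : (1:ℝ) ≤ 9 ^ d := one_le_pow₀ (by norm_num)
  by_cases hc : Ci * ε ≤ 1
  · set y := 1 / (Ci * ε) with hy
    have hy1 : 1 ≤ y := by rw [hy, le_div_iff₀ (by positivity)]; linarith
    have k1 : 1 ≤ ⌊y⌋₊ := (Nat.one_le_floor_iff _).2 hy1
    have k2 : (⌊y⌋₊ : ℝ) ≤ y := Nat.floor_le (by linarith)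
    have k3 : y < ⌊y⌋₊ + 1 := Nat.lt_floor_add_one y
    have k1' : (1:ℝ) ≤ ⌊y⌋₊ := by exact_mod_cast k1
    refine (anticonc d ⌊y⌋₊ k1 f hf h1 (2 * ε ^ (2 * d)) (by positivity) ?_).trans ?_
    · have a1 : 2 * (⌊y⌋₊ : ℝ) * ε ≤ 2 / Ci := by
        calc 2 * (⌊y⌋₊ : ℝ) * ε ≤ 2 * y * ε := by gcongr
          _ = 2 / Ci := by rw [hy]; field_simp
      have a2 : (2 * (⌊y⌋₊ : ℝ) * ε) ^ (2 * d) ≤ 2 / Ci := by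
        refine (pow_le_pow_left₀ (by positivity) a1 _).trans (pow_le_of_le_one (by positivity) ?_ (by omega))
        rw [div_le_one (by linarith)]; exact hCi2
      calc (2 * (d:ℝ) + 1) * (2 ^ d * (2 * ε ^ (2 * d))) * (2 * ⌊y⌋₊) ^ (2 * d) = (2 * d + 1) * 2 ^ (d + 1) * (2 * (⌊y⌋₊ : ℝ) * ε) ^ (2 * d) := by
            rw [mul_pow _ ε]; ring
        _ ≤ (2 * d + 1) * 2 ^ (d + 1) * (2 / Ci) := by gcongr
        _ = 1 / 4 := by rw [hCi, pow_add, pow_add]; field_simp; norm_num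
        _ < 1 / 2 := by norm_num
    · rw [div_le_iff₀ (by linarith)]
      have b1 : 1 = y * (Ci * ε) := by rw [hy]; field_simp
      have b2 : 1 ≤ 2 * ⌊y⌋₊ * (Ci * ε) := by
        calc 1 = y * (Ci * ε) := b1
          _ ≤ _ := by gcongr; linarith
      calc 4 * (d:ℝ) * 9 ^ d = 4 * d * 9 ^ d * 1 := by ring
        _ ≤ 4 * d * 9 ^ d * (2 * ⌊y⌋₊ * (Ci * ε)) := by gcongr
        _ = _ := by ring
  · push Not at hc
    refine measureReal_le_one.trans ?_
    calc 1 ≤ 1 * (Ci * ε) := by linarith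
      _ ≤ 8 * d * 9 ^ d * (Ci * ε) := by gcongr; nlinarith
      _ = _ := by ring

lemma eta_bound {n k d : ℕ} (hn : 1 ≤ n) {A η ε Z v : ℝ} {R : ℕ} (hA : 17 * d + 3 ≤ A) (hη : 0 < η) (hk1 : 4 ≤ k)
    (hηk : η ≤ (n : ℝ) ^ (-(A * k)) * (k : ℝ) ^ (-(A * k))) (hε : 0 < ε) (hεk : ε⁻¹ ≤ k) (hv0 : 0 ≤ v) (hv : v ≤ 4 * k) (hd : 1 ≤ d)
    (hZ0 : 1 ≤ Z) (hZ : Z ≤ k * (n:ℝ) ^ d) (hR' : R ≤ k) : η * (v * Z ^ (17 * R)) ≤ ε := by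
  have hn1 : (1:ℝ) ≤ n := by exact_mod_cast hn
  have hk4 : (4:ℝ) ≤ k := by exact_mod_cast hk1
  have hk0 : (1:ℝ) ≤ k := by linarith
  set E := (17 * d + 3) * k with hE
  have hEA : (E:ℝ) ≤ A * k := by rw [hE]; push_cast; gcongr
  have e1 : ∀ y : ℝ, 1 ≤ y → y ^ (-(A * k)) ≤ (y ^ E)⁻¹ := fun y hy => by
    rw [← Real.rpow_natCast, ← Real.rpow_neg (by linarith)]
    exact Real.rpow_le_rpow_of_exponent_le hy (by linarith)
  have e2 : η ≤ ((n:ℝ) ^ E)⁻¹ * ((k:ℝ) ^ E)⁻¹ := hηk.trans (by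
    have := e1 n hn1; have := e1 k hk0
    gcongr)
  have e3 : η * ((k:ℝ) * n) ^ E ≤ 1 := by
    rw [← mul_inv, ← mul_pow, mul_comm (n:ℝ)] at e2
    calc _ ≤ (((k:ℝ) * n) ^ E)⁻¹ * ((k:ℝ) * n) ^ E := by gcongr
      _ = 1 := inv_mul_cancel₀ (by positivity)
  set y := (k:ℝ) * n with hy
  have hky : (k:ℝ) ≤ y := le_mul_of_one_le_right (by linarith) hn1
  have hy1 : 1 ≤ y := hk0.trans hky
  have z1 : Z ≤ y ^ d := by
    refine hZ.trans ?_
    rw [hy, mul_pow]; gcongr; exact le_self_pow₀ hk0 (by omega)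
  have z2 : v * Z ^ (17 * R) * k ≤ y ^ E := by
    calc v * Z ^ (17 * R) * k ≤ (y * y) * (y ^ d) ^ (17 * R) * y := by
          gcongr
          calc v ≤ 4 * k := hv
            _ ≤ k * k := by nlinarith
            _ ≤ y * y := by gcongr
      _ = y ^ (3 + 17 * (d * R)) := by ring
      _ ≤ _ := pow_le_pow_right₀ hy1 (by rw [hE]; nlinarith [Nat.mul_le_mul_left d hR'])
  have z3 : η * (v * Z ^ (17 * R)) * k ≤ 1 := by
    calc _ = η * (v * Z ^ (17 * R) * k) := by ring
      _ ≤ η * y ^ E := by gcongr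
      _ ≤ 1 := e3
  calc η * (v * Z ^ (17 * R)) ≤ 1 / k := by rw [le_div_iff₀ (by linarith)]; exact z3
    _ ≤ ε := by rw [div_le_iff₀ (by linarith)]; rw [inv_le_iff_one_le_mul₀ hε] at hεk; linarith

set_option maxHeartbeats 1000000 in
theorem one_eps (d : ℕ) (hd : 1 ≤ d) : ∃ A : ℝ, 1 ≤ A ∧ ∀ n : ℕ, 1 ≤ n → ∀ ε : ℝ, 0 < ε → ε < 1 →
    ∀ k : ℕ, A * (ε⁻¹) ^ (4 * d * 7 ^ d) ≤ k → ∀ η : ℝ, 0 < η → η ≤ (n : ℝ) ^ (-(A * k)) * (k : ℝ) ^ (-(A * k)) →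
    ∀ μ : Measure (Fin n → ℝ), IsProbabilityMeasure μ → MomentMatches k η μ → ∀ f : Finset (Fin n) → ℝ, (∀ S, f S ≠ 0 → S.card ≤ d) →
    ∑ S, f S ^ 2 = 1 → ∀ s : ℝ → ℝ, SG s →
    ∫ x, s (eval x (mp f)) ∂μ ≤ ∫ x, s (eval x (mp f)) ∂(stdGaussianPi (Fin n)) + A * ε := by
  obtain ⟨ψ, L, m⟩ := moll_exists
  set σ := s2 ψ with hσ
  have hσ0 : 0 ≤ σ := s2_nonneg ψ
  have hL := m.hL
  set K : ℕ := ⌈L * (1 + σ)⌉₊ + (d ^ 6 * (d ^ (2 * d) * 55296 ^ d) ^ 3 + (6 * (6 * 7 ^ d) + 14)) with hK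
  have hKL : L * (1 + σ) ≤ K := (Nat.le_ceil _).trans (by exact_mod_cast Nat.le_add_right _ _)
  have hd1 : (1:ℝ) ≤ d := by exact_mod_cast hd
  set a1 : ℝ := 6 * d ^ 2 * (2 * K) ^ xx d 1 with ha1
  set a2 : ℝ := 17 * d + 3 with ha2
  set a3 : ℝ := 2 * (8 * d * 9 ^ d * ((2 * d + 1) * 2 ^ (d + 4))) + 4 * (d * 4 ^ d) + 2 * (d * (d + 2)) + 1 with ha3
  have p1 : 0 ≤ a1 := by positivity
  have p2 : 20 ≤ a2 := by linarith
  have p3 : 0 ≤ a3 := by positivity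
  refine ⟨a1 + a2 + a3, by linarith, ?_⟩
  intro n hn ε hε hε1 k hk η hη hηk μ hμp hμ f hf h1 s hs
  have : Nonempty (Fin n) := ⟨⟨0, hn⟩⟩
  set t := ε⁻¹ with ht
  have ht1 : 1 ≤ t := (one_le_inv₀ hε).2 hε1.le
  have htε : t * ε = 1 := inv_mul_cancel₀ hε.ne'
  have hK1 : (1:ℝ) ≤ K := by exact_mod_cast (by omega : 1 ≤ K)
  set B := ⌈K * t ^ (3 * d)⌉₊ with hB
  have htd : 1 ≤ t ^ (3 * d) := one_le_pow₀ ht1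
  have hKt : 1 ≤ K * t ^ (3 * d) := one_le_mul_of_one_le_of_one_le hK1 htd
  have hB1 : K * t ^ (3 * d) ≤ B := Nat.le_ceil _
  have hB2 : (B:ℝ) ≤ 2 * K * t ^ (3 * d) := by
    have := Nat.ceil_lt_add_one (show 0 ≤ K * t ^ (3 * d) by positivity)
    linarith
  have hKB : (K:ℝ) ≤ B := (le_mul_of_one_le_right (by positivity) htd).trans hB1
  have hKB' : K ≤ B := by exact_mod_cast hKB
  have pc : PC d B := ⟨hd, by omega, by omega⟩
  set ρ := ε ^ (3 * d) / (1 + σ) with hρ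
  have hρ0 : 0 < ρ := by positivity
  have hρσ : ρ ^ 2 * σ ≤ ε ^ (6 * d) := by
    rw [hρ, div_pow, div_mul_eq_mul_div, div_le_iff₀ (by positivity), ← pow_mul, show 3 * d * 2 = 6 * d by ring]
    gcongr; nlinarith
  have hr1 : ρ ^ 2 * s2 ψ ≤ 1 := hρσ.trans (pow_le_one₀ hε.le hε1.le)
  have hLB : L * ρ⁻¹ ≤ B := by
    rw [hρ, inv_div, div_eq_mul_inv, ← inv_pow, ← mul_assoc]
    exact (mul_le_mul_of_nonneg_right hKL (by positivity)).trans hB1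
  have hBb : (1:ℝ) ≤ B := hK1.trans hKB
  have hkA : a1 * t ^ (4 * d * 7 ^ d) ≤ k := le_trans (by gcongr; linarith) hk
  have hkB : 20 * t ^ (4 * d * 7 ^ d) ≤ k := le_trans (by gcongr; linarith) hk
  have hx1 : 3 * d * xx d 1 ≤ 4 * d * 7 ^ d := by
    have h7 : 7 ^ d = 7 * 7 ^ (d - 1) := by rw [← pow_succ']; congr 1; omega
    rw [h7, xx]
    have : 3 * (6 * 7 ^ (d - 1) - 2) ≤ 4 * (7 * 7 ^ (d - 1)) := by omega
    calc 3 * d * (6 * 7 ^ (d - 1) - 2) = d * (3 * (6 * 7 ^ (d - 1) - 2)) := by ring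
      _ ≤ d * (4 * (7 * 7 ^ (d - 1))) := Nat.mul_le_mul_left _ this
      _ = _ := by ring
  have hkR : 6 * d ^ 2 * B ^ xx d 1 ≤ k := by
    have : ((6 * d ^ 2 * B ^ xx d 1 : ℕ) : ℝ) ≤ k := by
      push_cast
      calc 6 * (d:ℝ) ^ 2 * (B:ℝ) ^ xx d 1 ≤ 6 * d ^ 2 * (2 * K * t ^ (3 * d)) ^ xx d 1 := by gcongr
        _ = a1 * t ^ (3 * d * xx d 1) := by rw [ha1, mul_pow _ (t ^ _), ← pow_mul]; ring
        _ ≤ a1 * t ^ (4 * d * 7 ^ d) := by gcongr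
        _ ≤ k := hkA
    exact_mod_cast this
  have hw : 0 < ε ^ (2 * d) := by positivity
  have main := core pc m hρ0 hr1 hLB f hf h1.le hkR hη.le hμ hs hw
  have b1 := anticonc_eps d hd f hf h1 ε hε
  have hεd : ε ^ (2 * d) ≤ ε := pow_le_of_le_one hε.le hε1.le (by omega)
  have b2 : 4 / (ε ^ (2 * d)) ^ 2 * (d * 4 ^ d * (ρ ^ 2 * s2 ψ)) ≤ 4 * (d * 4 ^ d) * ε := by
    calc _ ≤ 4 / (ε ^ (2 * d)) ^ 2 * (d * 4 ^ d * ε ^ (6 * d)) := by gcongr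
      _ = 4 * (d * 4 ^ d) * ε ^ (2 * d) := by
          rw [show 6 * d = 2 * d + 2 * d + 2 * d by ring, pow_add, pow_add]; field_simp
      _ ≤ _ := by gcongr
  have b3 : 2 * (d * (d + 2) / (B:ℝ)) ≤ 2 * (d * (d + 2)) * ε := by
    have : 1 ≤ B * ε := by
      calc 1 = t * ε := htε.symm
        _ ≤ B * ε := by
          gcongr
          exact (le_self_pow₀ ht1 (by omega)).trans ((le_mul_of_one_le_left (by positivity) hK1).trans hB1)
    rw [mul_div_assoc', div_le_iff₀ (by linarith)]
    calc 2 * ((d:ℝ) * (d + 2)) = 2 * (d * (d + 2)) * 1 := by ring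
      _ ≤ 2 * (d * (d + 2)) * (B * ε) := by gcongr
      _ = _ := by ring
  have ht6 : 1 ≤ t ^ (4 * d * 7 ^ d) := one_le_pow₀ ht1
  have ht4 : t ^ (4 * d) ≤ t ^ (4 * d * 7 ^ d) := pow_le_pow_right₀ ht1 (Nat.le_mul_of_pos_right _ (by positivity))
  have ht5 : t ≤ t ^ (4 * d) := le_self_pow₀ ht1 (by omega)
  have hRk : B ^ xx d 1 ≤ k := le_trans (Nat.le_mul_of_pos_left _ (by positivity)) hkR
  have hdRk : d * B ^ xx d 1 ≤ k := le_trans (by nlinarith [Nat.zero_le (d * B ^ xx d 1)]) hkR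
  have hRk' : (B:ℝ) ^ xx d 1 ≤ k := by exact_mod_cast hRk
  have hn1 : (1:ℝ) ≤ n := by exact_mod_cast hn
  have b4 := eta_bound (v := 2 / (ε ^ (2 * d)) ^ 2 + 2) (Z := (B:ℝ) ^ xx d 1 * (Fintype.card (Fin n) : ℝ) ^ d) (R := d * B ^ xx d 1) hn
    (show 17 * d + 3 ≤ a1 + a2 + a3 by linarith) hη
    (by have : (4:ℝ) ≤ k := by linarith
        exact_mod_cast this) hηk hε (by linarith) (by positivity) (by
      have e : 2 / (ε ^ (2 * d)) ^ 2 = 2 * t ^ (4 * d) := by rw [ht, inv_pow, ← pow_mul, show 2 * d * 2 = 4 * d by ring]; rfl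
      rw [e]; linarith) hd
    (by rw [Fintype.card_fin]; exact one_le_mul_of_one_le_of_one_le (one_le_pow₀ hBb) (one_le_pow₀ hn1))
    (by rw [Fintype.card_fin]; gcongr) hdRk
  rw [← mul_assoc 17 d] at b4
  have fin : (a1 + a2 + a3) * ε = a1 * ε + a2 * ε + (2 * (8 * d * 9 ^ d * ((2 * d + 1) * 2 ^ (d + 4)) * ε) + 4 * (d * 4 ^ d) * ε + 2 * (d * (d + 2)) * ε + ε) := by
    rw [ha3]; ring
  have f1 : 0 ≤ a1 * ε := by positivity
  have f2 : 0 ≤ a2 * ε := by positivity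
  rw [fin]
  linarith

end FH5

section FH6
open MvPolynomial

lemma eval_multilin {n : ℕ} (p : MvPolynomial (Fin n) ℝ) (hp : ∀ m ∈ p.support, ∀ i, m i ≤ 1)
    (x : Fin n → ℝ) :
    eval x p = eval x (mp fun S => coeff (Finsupp.indicator S fun _ _ => 1) p) := by
  classical
  rw [eval_mp, eval_eq']
  refine Finset.sum_of_injOn (fun m => m.support) ?_ (fun _ _ => Finset.mem_coe.2 (Finset.mem_univ _)) ?_ ?_
  · intro m hm m' hm' h
    ext i
    have h1 := hp m hm i
    have h2 := hp m' hm' i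
    have h3 : i ∈ m.support ↔ i ∈ m'.support := by
      have : m.support = m'.support := h
      rw [this]
    rw [Finsupp.mem_support_iff, Finsupp.mem_support_iff] at h3
    omega
  · intro S _ hS
    have : coeff (Finsupp.indicator S fun _ _ => 1) p = 0 := by
      by_contra hc
      apply hS
      refine ⟨Finsupp.indicator S fun _ _ => 1, Finset.mem_coe.2 (mem_support_iff.2 hc), ?_⟩
      ext i
      simp [Finsupp.indicator_apply]
    rw [this, zero_mul]
  · intro m hm
    have e : (Finsupp.indicator m.support fun _ _ => 1) = m := by
      ext i
      have := hp m hm i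
      rw [Finsupp.indicator_apply]
      split_ifs with h
      · rw [Finsupp.mem_support_iff] at h; omega
      · rw [Finsupp.notMem_support_iff] at h; exact h.symm
    rw [e]
    congr 1
    rw [← Finset.prod_subset (Finset.subset_univ m.support)]
    · refine Finset.prod_congr rfl fun i hi => ?_
      have := hp m hm i
      rw [Finsupp.mem_support_iff] at hi
      rw [show m i = 1 by omega, pow_one]
    · intro i _ hi
      rw [Finsupp.notMem_support_iff] at hi
      rw [hi, pow_zero]

lemma sgn_pos_mul {c : ℝ} (hc : 0 < c) (t : ℝ) : sgn (c * t) = sgn t := by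
  simp only [sgn, mul_nonneg_iff_of_pos_left hc]

end FH6

theorem fooling_multilinear_PTFs (d : ℕ) (hd : 1 ≤ d) :
    ∃ A : ℝ, 1 ≤ A ∧
      ∀ (n : ℕ), 1 ≤ n →
      ∀ ε : ℝ, ε ∈ Set.Ioo (0 : ℝ) 1 →
      ∀ k : ℕ, A * ε ^ (-((4 * d * 7 ^ d : ℕ) : ℝ)) ≤ (k : ℝ) →
      ∀ η : ℝ, 0 < η → η ≤ (n : ℝ) ^ (-(A * k)) * (k : ℝ) ^ (-(A * k)) →
      ∀ μ : Measure (Fin n → ℝ), IsProbabilityMeasure μ →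
        MomentMatches k η μ →
      ∀ p : MvPolynomial (Fin n) ℝ, p.totalDegree ≤ d →
        (∀ m ∈ p.support, ∀ i, m i ≤ 1) →
        |(∫ x, sgn (MvPolynomial.eval x p) ∂μ) -
            ∫ y, sgn (MvPolynomial.eval y p) ∂(stdGaussianPi (Fin n))| ≤ A * ε := by
  obtain ⟨A, hA, H⟩ := one_eps d hd
  refine ⟨A, hA, ?_⟩
  intro n hn ε hε k hk η hη hηk μ hμp hμ p hpd hp
  have hk' : A * (ε⁻¹) ^ (4 * d * 7 ^ d) ≤ k := by
    rwa [Real.rpow_neg hε.1.le, Real.rpow_natCast, ← inv_pow] at hk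
  set f : Finset (Fin n) → ℝ := fun S => MvPolynomial.coeff (Finsupp.indicator S fun _ _ => 1) p with hf
  have hev : ∀ x, MvPolynomial.eval x p = ∑ S, f S * ∏ i ∈ S, x i := fun x => by
    rw [eval_multilin p hp x, eval_mp]
  have hfd : ∀ S, f S ≠ 0 → S.card ≤ d := by
    intro S hS
    have := MvPolynomial.le_totalDegree (MvPolynomial.mem_support_iff.2 hS)
    refine le_trans (le_of_eq ?_) (this.trans hpd)
    rw [Finsupp.sum_fintype _ _ (fun _ => rfl)]
    simp [Finsupp.indicator_apply]
  have hG : IsProbabilityMeasure (stdGaussianPi (Fin n)) := by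
    unfold stdGaussianPi; infer_instance
  by_cases h0 : ∑ S, f S ^ 2 = 0
  · have hz : ∀ S, f S = 0 := by
      intro S
      have := (Finset.sum_eq_zero_iff_of_nonneg (fun S _ => sq_nonneg (f S))).1 h0 S (Finset.mem_univ _)
      exact pow_eq_zero_iff (two_ne_zero) |>.1 this
    have : ∀ x, MvPolynomial.eval x p = 0 := fun x => by rw [hev]; simp [hz]
    simp only [this, integral_const, probReal_univ, sub_self, abs_zero]
    have := hε.1
    positivity
  · have hpos : 0 < ∑ S, f S ^ 2 := lt_of_le_of_ne (Finset.sum_nonneg fun S _ => sq_nonneg _) (Ne.symm h0)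
    set c : ℝ := (Real.sqrt (∑ S, f S ^ 2))⁻¹ with hc
    have hc0 : 0 < c := by positivity
    have hc2 : c ^ 2 * ∑ S, f S ^ 2 = 1 := by
      rw [hc, inv_pow, Real.sq_sqrt hpos.le, inv_mul_cancel₀ h0]
    have e1 : ∀ x, MvPolynomial.eval x (mp fun S => c * f S) = c * MvPolynomial.eval x p := fun x => by
      rw [eval_mp, hev, Finset.mul_sum]; exact Finset.sum_congr rfl fun S _ => by ring
    have e2 : ∀ x, MvPolynomial.eval x (mp fun S => -(c * f S)) = -(c * MvPolynomial.eval x p) := fun x => by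
      rw [eval_mp, hev, Finset.mul_sum, ← Finset.sum_neg_distrib]; exact Finset.sum_congr rfl fun S _ => by ring
    have u1 := H n hn ε hε.1 hε.2 k hk' η hη hηk μ hμp hμ (fun S => c * f S)
      (fun S h => hfd S (right_ne_zero_of_mul h)) (by simp only [mul_pow]; rw [← Finset.mul_sum, hc2]) sgn sgn_SG
    have u2 := H n hn ε hε.1 hε.2 k hk' η hη hηk μ hμp hμ (fun S => -(c * f S))
      (fun S h => hfd S (right_ne_zero_of_mul (neg_ne_zero.1 h))) (by simp only [neg_sq, mul_pow]; rw [← Finset.mul_sum, hc2])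
      (fun t => -sgn (-t)) sgn_SG'
    simp only [e1, sgn_pos_mul hc0] at u1
    simp only [e2, neg_neg, sgn_pos_mul hc0, integral_neg] at u2
    rw [abs_sub_le_iff]
    constructor <;> linarith
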